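/- arXiv:2010.04982 — 2 statements merged into one kernel-verified Lean document; each statement's English description precedes it below -/
import Mathlib

section
/- There exist an absolute constant C_0 > 2 and an absolute constant C > 0 such that for every M ∈ Ω(C_0), writing M = A·m as in the definition of Ω, one has |S(R_M) − (2M²/|R_M| − M·A/|R_A|)| ≤ C·M·(log M)^{−0.4}. -/
open Finset

/-- The set of quadratic residues modulo `M`, as a finset of `ZMod M`. -/
def QR (M : ℕ) : Finset (ZMod M) := (Finset.range M).image (fun a : ℕ => ((a : ZMod M)) ^ 2)

/-- The cyclic gap from `u` to the next element of `U`: the least `k ≥ 1` with `u + k ∈ U`. -/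
noncomputable def cycGap (M : ℕ) (U : Finset (ZMod M)) (u : ZMod M) : ℕ :=
  sInf {k : ℕ | 0 < k ∧ u + (k : ZMod M) ∈ U}

/-- The stochasticity parameter `S(U)`: the sum of the squares of the consecutive
(cyclic) distances between elements of `U`. -/
noncomputable def stoch (M : ℕ) (U : Finset (ZMod M)) : ℕ :=
  ∑ u ∈ U, (cycGap M U u) ^ 2

/-- Membership in the set `Ω(C₀)` (apart from the "sufficiently large" cutoff):
`M` is square-free, `0.9 log log M < ω(M) < 1.1 log log M`, and `M = A·m` with
`3 ≤ A ≤ (log M)^0.1` and every prime divisor of `m` exceeding `(log M)^C₀`. -/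
def inOmega (C₀ : ℝ) (M : ℕ) : Prop :=
  Squarefree M ∧
  0.9 * Real.log (Real.log M) < (M.primeFactors.card : ℝ) ∧
  (M.primeFactors.card : ℝ) < 1.1 * Real.log (Real.log M) ∧
  ∃ A m : ℕ, M = A * m ∧ 3 ≤ A ∧ (A : ℝ) ≤ Real.log M ^ (0.1 : ℝ) ∧
    ∀ p : ℕ, p.Prime → p ∣ m → Real.log M ^ C₀ < (p : ℝ)

namespace SquareGaps

open Polynomial in
/-- The operator sending `r` to `f` times the derivative of `r` plus `c` times `r` times the derivative
of `f`, which describes how differentiation acts on `f ^ n * r`. -/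
noncomputable def stepOp {K : Type*} [Field K] (f : K[X]) (c : K) : K[X] →ₗ[K] K[X] :=
  (LinearMap.mulLeft K f).comp Polynomial.derivative +
    LinearMap.mulLeft K (C c * derivative f)

open Polynomial in
/-- Iterates of `stepOp` with the constant decreasing by one at each step. -/
noncomputable def stepIter {K : Type*} [Field K] (f : K[X]) (c : K) : ℕ → (K[X] →ₗ[K] K[X])
  | 0 => LinearMap.id
  | k + 1 => (stepOp f (c - k)).comp (stepIter f c k)

open Polynomial in
lemma iterate_derivative_pow_mul {K : Type*} [Field K] (p : ℕ) [CharP K p] (f : K[X]) (n j : ℕ)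
    (r : K[X]) (k : ℕ) (hk : k ≤ n) :
    derivative^[k] (f ^ n * r * (X ^ p) ^ j) =
      f ^ (n - k) * stepIter f (n : K) k r * (X ^ p) ^ j := by
  induction k with
  | zero => simp [stepIter]
  | succ k ih =>
    rw [Function.iterate_succ_apply', ih (by omega)]
    obtain ⟨d, hd⟩ : ∃ d, n - k = d + 1 := ⟨n - k - 1, by omega⟩
    have hd' : n - (k + 1) = d := by omega
    have hc : ((n : K) - k) = d + 1 := by
      have : n = d + 1 + k := by omega
      rw [this]; push_cast; ring
    have hX : derivative ((X ^ p : K[X]) ^ j) = 0 := by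
      rw [derivative_pow, derivative_X_pow]; simp
    rw [hd, hd', derivative_mul, hX, derivative_mul, derivative_pow_succ]
    simp only [stepIter, stepOp, LinearMap.comp_apply, LinearMap.add_apply,
      LinearMap.mulLeft_apply, hc]
    simp only [map_add, map_natCast, map_one]
    ring

open Polynomial in
lemma natDegree_stepIter_le {K : Type*} [Field K] (f : K[X]) (m : ℕ) (hf : f.natDegree ≤ m)
    (c : K) (D : ℕ) (r : K[X]) (hr : r.natDegree ≤ D) (k : ℕ) :
    (stepIter f c k r).natDegree ≤ D + k * m := by
  induction k with
  | zero => simpa [stepIter] using hr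
  | succ k ih =>
    simp only [stepIter, stepOp, LinearMap.comp_apply, LinearMap.add_apply,
      LinearMap.mulLeft_apply]
    have h1 := natDegree_derivative_le (stepIter f c k r)
    have h2 := natDegree_derivative_le f
    refine (natDegree_add_le _ _).trans (max_le ?_ ?_)
    · refine natDegree_mul_le.trans ?_
      rw [add_mul]; omega
    · refine natDegree_mul_le.trans ?_
      have := natDegree_C_mul_le (c - k) (derivative f)
      rw [add_mul]; omega

open Polynomial in
/-- If `r² f = c s²` and `f` has a root of odd multiplicity then `r = s = 0`. -/
lemma eq_zero_of_sq_mul_eq {K : Type*} [Field K] (f r s : K[X]) (c a : K) (hc : c ≠ 0)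
    (hodd : Odd (f.rootMultiplicity a)) (h : r ^ 2 * f = C c * s ^ 2) : r = 0 ∧ s = 0 := by
  have hf : f ≠ 0 := by rintro rfl; simp at hodd
  by_cases hr : r = 0
  · subst hr
    refine ⟨rfl, ?_⟩
    simp only [ne_eq, OfNat.ofNat_ne_zero, not_false_eq_true, zero_pow, zero_mul] at h
    have := (mul_eq_zero.1 h.symm).resolve_left (by simpa using hc)
    exact pow_eq_zero_iff (two_ne_zero) |>.1 this
  · exfalso
    have hs : s ≠ 0 := by
      rintro rfl
      simp [hr, hf] at h
    have h1 := congrArg (rootMultiplicity a) h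
    rw [rootMultiplicity_mul (by simp [hr, hf]), rootMultiplicity_mul (by simp [hs, hc]),
      rootMultiplicity_C, sq, sq, rootMultiplicity_mul (by simp [hr]),
      rootMultiplicity_mul (by simp [hs])] at h1
    obtain ⟨t, ht⟩ := hodd
    omega

open Polynomial in
/-- Independence of the auxiliary family in Stepanov's method. -/
lemma stepanov_indep (p : ℕ) [Fact p.Prime] (hp2 : p ≠ 2) (f : (ZMod p)[X]) (m : ℕ)
    (hf : f.natDegree ≤ m) (a : ZMod p) (hodd : Odd (f.rootMultiplicity a))
    (h0 : f.coeff 0 ≠ 0) (D : ℕ) (hD : 2 * D + m < p) :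
    ∀ (J : ℕ) (r s : ℕ → (ZMod p)[X]), (∀ j, (r j).natDegree ≤ D) → (∀ j, (s j).natDegree ≤ D) →
      ∑ j ∈ range J, (r j + s j * f ^ (p / 2)) * (X ^ p) ^ j = 0 →
      ∀ j < J, r j = 0 ∧ s j = 0 := by
  have hp : p.Prime := Fact.out
  intro J
  induction J with
  | zero => intro r s _ _ _ j hj; omega
  | succ J ih =>
    intro r s hr hs h
    rw [sum_range_succ'] at h
    have hXdvd : (X ^ p : (ZMod p)[X]) ∣ r 0 + s 0 * f ^ (p / 2) := by
      have : r 0 + s 0 * f ^ (p / 2) =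
        - X ^ p * ∑ j ∈ range J, (r (j + 1) + s (j + 1) * f ^ (p / 2)) * (X ^ p) ^ j := by
        have h' := eq_neg_of_add_eq_zero_right h
        rw [pow_zero, mul_one] at h'
        rw [h', mul_sum, ← sum_neg_distrib]
        refine sum_congr rfl fun j _ => ?_
        rw [pow_succ]; ring
      rw [this]
      exact Dvd.dvd.mul_right (dvd_neg.2 dvd_rfl) _
    have hodd2 : p / 2 + p / 2 + 1 = p := by
      have := hp.eq_two_or_odd; omega
    have hfp : (X ^ p : (ZMod p)[X]) ∣ f ^ p - C (f.coeff 0) := by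
      have h1 : f ^ p = expand (ZMod p) p f := (ZMod.expand_card f).symm
      rw [h1]
      have h2 : X ∣ f - C (f.coeff 0) := by
        rw [X_dvd_iff]; simp
      obtain ⟨g, hg⟩ := h2
      have h3 : f = X * g + C (f.coeff 0) := by rw [← hg]; ring
      refine ⟨expand (ZMod p) p g, ?_⟩
      conv_lhs => rw [h3]
      simp
    have hkey : (X ^ p : (ZMod p)[X]) ∣ r 0 ^ 2 * f - C (f.coeff 0) * s 0 ^ 2 := by
      have e : r 0 ^ 2 * f - C (f.coeff 0) * s 0 ^ 2 =
          (r 0 + s 0 * f ^ (p / 2)) * ((r 0 - s 0 * f ^ (p / 2)) * f) +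
          (f ^ p - C (f.coeff 0)) * s 0 ^ 2 := by
        have : f ^ p = f ^ (p / 2) * f ^ (p / 2) * f := by
          rw [← pow_add, ← pow_succ]
          exact congrArg (f ^ ·) hodd2.symm
        rw [this]; ring
      rw [e]
      exact dvd_add (Dvd.dvd.mul_right hXdvd _) (Dvd.dvd.mul_right hfp _)
    have hz : r 0 ^ 2 * f - C (f.coeff 0) * s 0 ^ 2 = 0 := by
      by_contra hne
      have := natDegree_le_of_dvd hkey hne
      rw [natDegree_X_pow] at this
      have h1 : (r 0 ^ 2 * f - C (f.coeff 0) * s 0 ^ 2).natDegree ≤ 2 * D + m := by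
        have ha := natDegree_pow_le_of_le 2 (hr 0)
        have hb := natDegree_pow_le_of_le 2 (hs 0)
        refine (natDegree_sub_le _ _).trans (max_le ?_ ?_)
        · refine natDegree_mul_le.trans ?_; omega
        · refine (natDegree_C_mul_le _ _).trans ?_; omega
      omega
    have h00 := eq_zero_of_sq_mul_eq f (r 0) (s 0) (f.coeff 0) a h0 hodd (sub_eq_zero.1 hz)
    have hrest : ∑ j ∈ range J, (r (j + 1) + s (j + 1) * f ^ (p / 2)) * (X ^ p) ^ j = 0 := by
      have hX : (X ^ p : (ZMod p)[X]) ≠ 0 := pow_ne_zero _ X_ne_zero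
      refine (mul_eq_zero.1 ?_).resolve_left hX
      rw [h00.1, h00.2] at h
      simp only [zero_mul, add_zero] at h
      rw [mul_sum, ← h]
      refine sum_congr rfl fun j _ => ?_
      rw [pow_succ]; ring
    have := ih (fun j => r (j + 1)) (fun j => s (j + 1)) (fun j => hr _) (fun j => hs _) hrest
    intro j hj
    cases j with
    | zero => exact h00
    | succ j => exact this j (by omega)

open Polynomial in
lemma exists_stepanov_family {K : Type*} [Field K] (f : K[X]) (m : ℕ) (hf : f.natDegree ≤ m)
    (c₁ c₂ b : K) (D J l : ℕ) (hcount : ∑ k ∈ range l, (D + J + k * m) < 2 * J * (D + 1)) :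
    ∃ r s : ℕ → K[X], (∀ j, (r j).natDegree ≤ D) ∧ (∀ j, (s j).natDegree ≤ D) ∧
      (∃ j < J, ¬ (r j = 0 ∧ s j = 0)) ∧
      ∀ k < l, ∑ j ∈ range J, (stepIter f c₁ k (r j) + C b * stepIter f c₂ k (s j)) * X ^ j = 0 := by
  classical
  let V := (Fin J → degreeLT K (D + 1)) × (Fin J → degreeLT K (D + 1))
  have : FiniteDimensional K (degreeLT K (D + 1)) :=
    Module.Finite.equiv (degreeLTEquiv K (D + 1)).symm
  have hfr : Module.finrank K (degreeLT K (D + 1)) = D + 1 := by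
    rw [(degreeLTEquiv K (D + 1)).finrank_eq]; simp
  let P : Fin l → (V →ₗ[K] K[X]) := fun k =>
    ∑ j : Fin J, ((LinearMap.mulRight K (X ^ (j : ℕ))).comp
      (((stepIter f c₁ k).comp ((degreeLT K (D + 1)).subtype)).comp
        ((LinearMap.proj j).comp (LinearMap.fst K _ _)) +
       ((LinearMap.mulLeft K (C b)).comp
        ((stepIter f c₂ k).comp ((degreeLT K (D + 1)).subtype))).comp
        ((LinearMap.proj j).comp (LinearMap.snd K _ _))))
  let F : V →ₗ[K] ((Σ k : Fin l, Fin (D + J + k * m)) → K) :=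
    LinearMap.pi fun i => (Polynomial.lcoeff K (i.2 : ℕ)).comp (P i.1)
  have hker : LinearMap.ker F ≠ ⊥ := by
    apply LinearMap.ker_ne_bot_of_finrank_lt
    rw [Module.finrank_fintype_fun_eq_card, Module.finrank_prod, Module.finrank_pi_fintype]
    simp only [hfr, Fintype.card_sigma, Fintype.card_fin, sum_const, card_univ, smul_eq_mul]
    rw [Fin.sum_univ_eq_sum_range (fun k => D + J + k * m)]
    linarith
  obtain ⟨v, hv, hv0⟩ := (Submodule.ne_bot_iff _).1 hker
  have hdeg : ∀ w : degreeLT K (D + 1), (w : K[X]).natDegree ≤ D := fun w => by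
    have := mem_degreeLT.1 w.2
    by_cases h0 : (w : K[X]) = 0
    · simp [h0]
    · have := (natDegree_lt_iff_degree_lt h0).2 this
      omega
  refine ⟨fun j => if h : j < J then v.1 ⟨j, h⟩ else 0, fun j => if h : j < J then v.2 ⟨j, h⟩ else 0,
    ?_, ?_, ?_, ?_⟩
  · intro j; dsimp only; split_ifs <;> simp [hdeg]
  · intro j; dsimp only; split_ifs <;> simp [hdeg]
  · by_contra! hcon
    apply hv0
    refine Prod.ext (funext fun j => Subtype.ext ?_) (funext fun j => Subtype.ext ?_)
    · simpa using (hcon j j.2).1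
    · simpa using (hcon j j.2).2
  · intro k hk
    rw [← Fin.sum_univ_eq_sum_range (fun j => (stepIter f c₁ k (if h : j < J then (v.1 ⟨j, h⟩ : K[X]) else 0) +
      C b * stepIter f c₂ k (if h : j < J then (v.2 ⟨j, h⟩ : K[X]) else 0)) * X ^ j)]
    have hP : P ⟨k, hk⟩ v = ∑ j : Fin J, (stepIter f c₁ k (v.1 j : K[X]) +
      C b * stepIter f c₂ k (v.2 j : K[X])) * X ^ (j : ℕ) := by
      simp [P]
      rfl
    simp only [Fin.is_lt, dite_true, Fin.eta]
    rw [← hP]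
    ext i
    rw [coeff_zero]
    by_cases hi : i < D + J + k * m
    · exact congrFun (LinearMap.mem_ker.1 hv) ⟨⟨k, hk⟩, ⟨i, hi⟩⟩
    · refine coeff_eq_zero_of_natDegree_lt (lt_of_lt_of_le ?_ (not_lt.1 hi))
      rw [hP]
      have hJ : 0 < D + J + k * m := by
        by_contra h0
        have hJ0 : J = 0 := by omega
        subst hJ0
        simp at hcount
      refine lt_of_le_of_lt (natDegree_sum_le_of_forall_le (n := D + J + k * m - 1) _ _ ?_) (by omega)
      intro j _
      have h1 := natDegree_stepIter_le f m hf c₁ D _ (hdeg (v.1 j)) k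
      have h2 := natDegree_stepIter_le f m hf c₂ D _ (hdeg (v.2 j)) k
      have h3 := (natDegree_C_mul_le b (stepIter f c₂ k (v.2 j : K[X]))).trans h2
      have h4 := (natDegree_add_le (stepIter f c₁ k (v.1 j : K[X])) _).trans (max_le h1 h3)
      refine natDegree_mul_le.trans ?_
      rw [natDegree_X_pow]
      have := j.2
      omega

open Polynomial in
/-- Stepanov's bound for the number of `x` with `f(x) ^ ((p - 1) / 2) = b`. -/
lemma stepanov_card_le (p : ℕ) [Fact p.Prime] (hp2 : p ≠ 2) (f : (ZMod p)[X]) (m : ℕ)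
    (hf : f.natDegree ≤ m) (a : ZMod p) (hodd : Odd (f.rootMultiplicity a))
    (h0 : f.coeff 0 ≠ 0) (D J l : ℕ) (hD : 2 * D + m < p) (hl : l < p)
    (hcount : ∑ k ∈ range l, (D + J + k * m) < 2 * J * (D + 1)) (b : ZMod p) :
    #{x : ZMod p | (f.eval x) ^ (p / 2) = b} * l ≤ l * m + D + (p / 2) * m + (J - 1) * p := by
  have hp : p.Prime := Fact.out
  obtain ⟨r, s, hr, hs, ⟨j₀, hj₀, hne⟩, hz⟩ := exists_stepanov_family f m hf (l : ZMod p)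
    ((l + p / 2 : ℕ) : ZMod p) b D J l hcount
  set Φ : (ZMod p)[X] := ∑ j ∈ range J, (f ^ l * r j * (X ^ p) ^ j +
    f ^ (l + p / 2) * s j * (X ^ p) ^ j) with hΦ
  have hf0 : f ≠ 0 := by rintro rfl; simp at h0
  have hΦ0 : Φ ≠ 0 := by
    intro h
    have e : Φ = f ^ l * ∑ j ∈ range J, (r j + s j * f ^ (p / 2)) * (X ^ p) ^ j := by
      rw [hΦ, mul_sum]
      refine sum_congr rfl fun j _ => ?_
      rw [pow_add]; ring
    rw [e] at h
    have h' := (mul_eq_zero.1 h).resolve_left (pow_ne_zero _ hf0)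
    exact hne (stepanov_indep p hp2 f m hf a hodd h0 D hD J r s hr hs h' j₀ hj₀)
  have hdeg : Φ.natDegree ≤ l * m + D + (p / 2) * m + (J - 1) * p := by
    refine natDegree_sum_le_of_forall_le _ _ fun j hj => ?_
    have hj' : j ≤ J - 1 := by have := mem_range.1 hj; omega
    have hjp : p * j ≤ (J - 1) * p := by rw [mul_comm]; exact Nat.mul_le_mul_right _ hj'
    have hX : ((X ^ p : (ZMod p)[X]) ^ j).natDegree = p * j := by
      rw [← pow_mul, natDegree_X_pow]
    have e1 := natDegree_pow_le_of_le l hf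
    have e2 := natDegree_pow_le_of_le (l + p / 2) hf
    rw [add_mul] at e2
    refine (natDegree_add_le _ _).trans (max_le ?_ ?_)
    · refine natDegree_mul_le.trans ?_
      have := natDegree_mul_le (p := f ^ l) (q := r j)
      have := hr j
      omega
    · refine natDegree_mul_le.trans ?_
      have := natDegree_mul_le (p := f ^ (l + p / 2)) (q := s j)
      have := hs j
      omega
  have hmult : ∀ x ∈ ({x : ZMod p | (f.eval x) ^ (p / 2) = b} : Finset (ZMod p)),
      l ≤ Φ.rootMultiplicity x := by
    intro x hx
    have hx' : (f.eval x) ^ (p / 2) = b := by simpa using hx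
    rcases Nat.eq_zero_or_pos l with rfl | hlpos
    · simp
    have : l - 1 < Φ.rootMultiplicity x := by
      apply lt_rootMultiplicity_of_isRoot_iterate_derivative_of_mem_nonZeroDivisors hΦ0
      · intro k hk
        have hkl : k < l := by omega
        have e : derivative^[k] Φ = ∑ j ∈ range J, (f ^ (l - k) * stepIter f (l : ZMod p) k (r j) * (X ^ p) ^ j
            + f ^ (l + p / 2 - k) * stepIter f ((l + p / 2 : ℕ) : ZMod p) k (s j) * (X ^ p) ^ j) := by
          rw [hΦ, iterate_derivative_sum]
          refine sum_congr rfl fun j _ => ?_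
          rw [iterate_map_add, iterate_derivative_pow_mul p f l j _ k (by omega),
            iterate_derivative_pow_mul p f (l + p / 2) j _ k (by omega)]
        have hz' := congrArg (eval x) (hz k hkl)
        rw [IsRoot.def, e, eval_finsetSum]
        rw [eval_finsetSum, eval_zero] at hz'
        rw [← mul_zero (eval x f ^ (l - k)), ← hz', mul_sum]
        refine sum_congr rfl fun j _ => ?_
        have hexp : l + p / 2 - k = (l - k) + p / 2 := by omega
        simp only [eval_add, eval_mul, eval_pow, eval_X, eval_C, ZMod.pow_card, hexp, pow_add, hx']
        ring
      · apply mem_nonZeroDivisors_of_ne_zero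
        rw [Ne, ZMod.natCast_eq_zero_iff, hp.dvd_factorial]
        omega
    omega
  have hdvd : ∏ x ∈ ({x : ZMod p | (f.eval x) ^ (p / 2) = b} : Finset (ZMod p)), (X - C x) ^ l ∣ Φ := by
    apply Finset.prod_dvd_of_coprime
    · intro x _ y _ hxy
      exact (isCoprime_X_sub_C_of_isUnit_sub (sub_ne_zero.2 hxy).isUnit).pow
    · intro x hx
      exact (pow_dvd_pow _ (hmult x hx)).trans (pow_rootMultiplicity_dvd Φ x)
  have := (natDegree_le_of_dvd hdvd hΦ0).trans hdeg
  rw [natDegree_prod_of_monic _ _ (fun x _ => (monic_X_sub_C x).pow l)] at this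
  simpa [natDegree_X_sub_C] using this

open Polynomial in
lemma quadraticChar_sum_le_of_coeff_zero_ne_zero (p : ℕ) [Fact p.Prime] (hp2 : p ≠ 2)
    (f : (ZMod p)[X]) (m u : ℕ) (hf : f.natDegree ≤ m) (a : ZMod p)
    (hodd : Odd (f.rootMultiplicity a)) (h0 : f.coeff 0 ≠ 0) (hu : 1 ≤ u) (hup : 4 * u ^ 2 ≤ p)
    (hmu : 2 * (m + 2 * u) ≤ p) :
    |∑ x : ZMod p, (quadraticChar (ZMod p) (f.eval x) : ℝ)| * (2 * u) ≤
      6 * m * u + (3 * m + 3) * p := by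
  have hp : p.Prime := Fact.out
  have hodd2 : p / 2 + p / 2 + 1 = p := by
    have := hp.eq_two_or_odd; omega
  have hf0 : f ≠ 0 := by rintro rfl; simp at h0
  obtain ⟨D, hD1, hD2⟩ : ∃ D, 2 * D + m < p ∧ p ≤ 2 * (D + 1) + m :=
    ⟨(p - m - 1) / 2, by omega, by omega⟩
  have hcount : ∑ k ∈ range (2 * u), (D + (u + m + 2) + k * m) < 2 * (u + m + 2) * (D + 1) := by
    have hg := Finset.sum_range_id_mul_two (2 * u)
    have e : (∑ k ∈ range (2 * u), (D + (u + m + 2) + k * m)) =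
        2 * u * (D + (u + m + 2)) + (∑ k ∈ range (2 * u), k) * m := by
      rw [sum_add_distrib, sum_mul]; simp
    rw [e]
    have hg2 : (∑ k ∈ range (2 * u), k) ≤ 2 * u ^ 2 := by
      have : 2 * u * (2 * u - 1) ≤ 2 * u * (2 * u) := Nat.mul_le_mul_left _ (by omega)
      nlinarith
    have hg3 := Nat.mul_le_mul_right m hg2
    zify at *
    nlinarith
  have hN : ∀ b : ZMod p, (#{x : ZMod p | (f.eval x) ^ (p / 2) = b} : ℝ) * (2 * (2 * u)) ≤
      2 * (2 * u * m) + (m + 1) * p + 2 * (u + m + 1) * p := by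
    intro b
    have := stepanov_card_le p hp2 f m hf a hodd h0 D (u + m + 2) (2 * u) hD1 (by nlinarith)
      hcount b
    have e : u + m + 2 - 1 = u + m + 1 := by omega
    rw [e] at this
    have h2 : #{x : ZMod p | (f.eval x) ^ (p / 2) = b} * (2 * (2 * u)) ≤
      2 * (2 * u * m) + (m + 1) * p + 2 * (u + m + 1) * p := by
      have : (p / 2) * m * 2 ≤ p * m := by
        have : p / 2 * 2 ≤ p := by omega
        nlinarith
      nlinarith
    exact_mod_cast h2
  have hne : (1 : ZMod p) ≠ -1 := by
    intro h
    have : ((2 : ℕ) : ZMod p) = 0 := by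
      push_cast; linear_combination h
    rw [ZMod.natCast_eq_zero_iff] at this
    exact hp2 ((Nat.prime_dvd_prime_iff_eq hp Nat.prime_two).1 this)
  have hchar : ∀ y : ZMod p, (quadraticChar (ZMod p) y : ℝ) =
      (if y ^ (p / 2) = 1 then 1 else 0) - (if y ^ (p / 2) = -1 then 1 else 0) := by
    intro y
    have hrc : ringChar (ZMod p) ≠ 2 := by rwa [ZMod.ringChar_zmod_n]
    have hq := quadraticChar_eq_pow_of_char_ne_two' hrc y
    rw [ZMod.card] at hq
    by_cases hy : y = 0
    · subst hy
      have : p / 2 ≠ 0 := by have := hp.two_le; omega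
      simp [this]
    · rw [← hq]
      rcases quadraticChar_dichotomy hy with h | h <;> rw [h]
      · simp [hne]
      · simp [hne.symm]
  have hsum : ∑ x : ZMod p, (quadraticChar (ZMod p) (f.eval x) : ℝ) =
      #{x : ZMod p | (f.eval x) ^ (p / 2) = 1} - #{x : ZMod p | (f.eval x) ^ (p / 2) = -1} := by
    simp only [hchar, sum_sub_distrib, sum_boole]
  have htot : (p : ℝ) - m ≤ (#{x : ZMod p | (f.eval x) ^ (p / 2) = 1} : ℝ) +
      #{x : ZMod p | (f.eval x) ^ (p / 2) = -1} := by
    have hcov : (univ : Finset (ZMod p)) ⊆ ({x : ZMod p | (f.eval x) ^ (p / 2) = 1} : Finset (ZMod p)) ∪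
        ({x : ZMod p | (f.eval x) ^ (p / 2) = -1} : Finset (ZMod p)) ∪ f.roots.toFinset := by
      intro x _
      simp only [mem_union, mem_filter, mem_univ, true_and, Multiset.mem_toFinset, mem_roots hf0,
        IsRoot.def]
      by_cases hx : f.eval x = 0
      · exact Or.inr hx
      · left
        exact ZMod.pow_div_two_eq_neg_one_or_one p hx
    have h1 := card_le_card hcov
    have h2 := card_union_le (({x : ZMod p | (f.eval x) ^ (p / 2) = 1} : Finset (ZMod p)) ∪
        ({x : ZMod p | (f.eval x) ^ (p / 2) = -1} : Finset (ZMod p))) f.roots.toFinset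
    have h3 := card_union_le ({x : ZMod p | (f.eval x) ^ (p / 2) = 1} : Finset (ZMod p))
        ({x : ZMod p | (f.eval x) ^ (p / 2) = -1} : Finset (ZMod p))
    have h4 : #f.roots.toFinset ≤ m := (Multiset.toFinset_card_le _).trans ((card_roots' f).trans hf)
    rw [card_univ, ZMod.card] at h1
    have : p ≤ #{x : ZMod p | (f.eval x) ^ (p / 2) = 1} +
      #{x : ZMod p | (f.eval x) ^ (p / 2) = -1} + m := by omega
    have : (p : ℝ) ≤ (#{x : ZMod p | (f.eval x) ^ (p / 2) = 1} : ℝ) +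
      #{x : ZMod p | (f.eval x) ^ (p / 2) = -1} + m := by exact_mod_cast this
    linarith
  have hN1 := hN 1
  have hN2 := hN (-1)
  rw [hsum]
  have hu' : (0 : ℝ) < u := by exact_mod_cast hu
  have htot' := mul_le_mul_of_nonneg_right htot (by positivity : (0 : ℝ) ≤ 2 * u)
  have habs : ∀ x : ℝ, |x| * (2 * u) = |x * (2 * u)| := fun x => by
    rw [abs_mul, abs_of_pos (by positivity : (0 : ℝ) < 2 * u)]
  rw [habs, abs_le]
  constructor <;> nlinarith

open Polynomial in
/-- A Weil-type bound for quadratic character sums, proved by Stepanov's method. -/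
theorem quadraticChar_sum_le (p : ℕ) [Fact p.Prime] (hp2 : p ≠ 2) (f : (ZMod p)[X]) (m : ℕ)
    (hm : 1 ≤ m) (hf : f.natDegree ≤ m) (a : ZMod p) (hodd : Odd (f.rootMultiplicity a)) :
    |∑ x : ZMod p, (quadraticChar (ZMod p) (f.eval x) : ℝ)| ≤ 16 * m * √p := by
  have hp : p.Prime := Fact.out
  have hf0 : f ≠ 0 := by rintro rfl; simp at hodd
  have hs0 : 0 ≤ √(p : ℝ) := Real.sqrt_nonneg _
  have hsq : √(p : ℝ) * √p = p := Real.mul_self_sqrt (by positivity)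
  have hm' : (1 : ℝ) ≤ m := by exact_mod_cast hm
  by_cases hbig : (p : ℝ) ≤ 16 * m * √p
  · refine le_trans ?_ hbig
    refine (abs_sum_le_sum_abs _ _).trans ?_
    calc ∑ x : ZMod p, |(quadraticChar (ZMod p) (f.eval x) : ℝ)| ≤ ∑ x : ZMod p, (1 : ℝ) := by
          refine sum_le_sum fun x _ => ?_
          by_cases hx : f.eval x = 0
          · simp [hx]
          · rcases quadraticChar_dichotomy hx with h | h <;> simp [h]
      _ = p := by simp
  · push Not at hbig
    have hsp : 16 * (m : ℝ) < √p := by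
      by_contra h
      push Not at h
      have := mul_le_mul_of_nonneg_right h hs0
      linarith
    have hmp : m < p := by
      have : (m : ℝ) < p := by nlinarith
      exact_mod_cast this
    obtain ⟨c, hc⟩ : ∃ c, f.eval c ≠ 0 := by
      by_contra! hall
      have h1 : (univ : Finset (ZMod p)).card ≤ f.natDegree :=
        card_le_degree_of_subset_roots (p := f) (by
          intro x _
          rw [mem_roots hf0]
          exact hall x)
      rw [card_univ, ZMod.card] at h1
      omega
    have hsum : ∑ x : ZMod p, (quadraticChar (ZMod p) (f.eval x) : ℝ) =
        ∑ x : ZMod p, (quadraticChar (ZMod p) ((f.comp (X + C c)).eval x) : ℝ) := by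
      simp only [eval_comp, eval_add, eval_X, eval_C]
      exact (Equiv.sum_comp (Equiv.addRight c) (fun x => (quadraticChar (ZMod p) (f.eval x) : ℝ))).symm
    have hodd' : Odd ((f.comp (X + C c)).rootMultiplicity (a - c)) := by
      rw [rootMultiplicity_eq_rootMultiplicity] at hodd ⊢
      have : (f.comp (X + C c)).comp (X + C (a - c)) = f.comp (X + C a) := by
        rw [comp_assoc]
        simp only [add_comp, X_comp, C_comp]
        rw [add_assoc, ← C_add, sub_add_cancel]
      rwa [this]
    have hdeg' : (f.comp (X + C c)).natDegree ≤ m := by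
      rw [natDegree_comp]; simpa using hf
    have hcoef : (f.comp (X + C c)).coeff 0 ≠ 0 := by
      rw [coeff_zero_eq_eval_zero]; simpa [eval_comp] using hc
    rw [hsum]
    set u := Nat.sqrt p / 2 with hu
    have h1 := Nat.sqrt_le' p
    have h2 := Nat.lt_succ_sqrt' p
    have hup : 4 * u ^ 2 ≤ p := by
      have : 2 * u ≤ Nat.sqrt p := by omega
      nlinarith
    have hlow : √(p : ℝ) ≤ 2 * u + 2 := by
      apply Real.sqrt_le_iff.2 ⟨by positivity, ?_⟩
      have : Nat.sqrt p + 1 ≤ 2 * u + 2 := by omega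
      have h3 : p ≤ (2 * u + 2) ^ 2 := by
        have := Nat.pow_le_pow_left this 2
        exact h2.le.trans this
      exact_mod_cast h3
    have hu7 : (7 : ℝ) ≤ u := by linarith
    have hule : 2 * (u : ℝ) ≤ √p := by
      apply Real.le_sqrt_of_sq_le
      have : (2 * u) ^ 2 ≤ p := by nlinarith
      exact_mod_cast this
    have key := quadraticChar_sum_le_of_coeff_zero_ne_zero p hp2 (f.comp (X + C c)) m u hdeg' _
      hodd' hcoef (by have : (1:ℝ) ≤ u := by linarith
                      exact_mod_cast this) hup (by
        have : 2 * ((m : ℝ) + 2 * u) ≤ p := by nlinarith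
        exact_mod_cast this)
    have hupos : (0 : ℝ) < 2 * u := by linarith
    rw [← mul_le_mul_iff_left₀ hupos]
    refine key.trans ?_
    generalize √(p : ℝ) = t at *
    rw [← hsq]
    have e1 : 0 ≤ (m : ℝ) * t * (2 * u + 2 - t) := mul_nonneg (by positivity) (by linarith)
    have e2 : 0 ≤ (m : ℝ) * t * (t - 16) := mul_nonneg (by positivity) (by linarith)
    have e3 : 0 ≤ (m : ℝ) * (t - 2 * u) := mul_nonneg (by positivity) (by linarith)
    have e4 : 0 ≤ ((m : ℝ) - 1) * (t * t) := mul_nonneg (by linarith) (by positivity)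
    have e5 : 0 ≤ (m : ℝ) * t := by positivity
    nlinarith

open Polynomial in
theorem quadraticChar_prod_sum_le {ι : Type*} [DecidableEq ι] (p : ℕ) [Fact p.Prime] (hp2 : p ≠ 2)
    (T : Finset ι) (b : ι → ZMod p) (a : ZMod p) (hodd : Odd #{i ∈ T | b i = a}) :
    |∑ y : ZMod p, ∏ i ∈ T, (quadraticChar (ZMod p) (y + b i) : ℝ)| ≤ 16 * #T * √p := by
  have hT : 1 ≤ #T := by
    refine le_trans hodd.pos (card_filter_le _ _)
  have hprod : (∏ i ∈ T, (X - C (-b i))) ≠ (0 : (ZMod p)[X]) :=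
    prod_ne_zero_iff.2 fun i _ => X_sub_C_ne_zero _
  have hdeg : (∏ i ∈ T, (X - C (-b i)) : (ZMod p)[X]).natDegree ≤ #T := by
    rw [natDegree_prod_of_monic _ _ fun i _ => monic_X_sub_C _]
    simp
  have hroot : (∏ i ∈ T, (X - C (-b i)) : (ZMod p)[X]).rootMultiplicity (-a) =
      #{i ∈ T | b i = a} := by
    rw [← count_roots, roots_prod _ _ hprod, Multiset.count_bind]
    simp only [roots_X_sub_C, Multiset.count_singleton, neg_inj]
    rw [card_filter]
    exact sum_congr rfl fun i _ => by simp [eq_comm]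
  have key := quadraticChar_sum_le p hp2 _ _ hT hdeg (-a) (hroot ▸ hodd)
  convert key using 4 with y
  rw [eval_prod, map_prod, Int.cast_prod]
  simp

theorem abs_prod_sub_prod_le {ι : Type*} (T : Finset ι) (f g : ι → ℝ) (hf : ∀ i ∈ T, |f i| ≤ 1)
    (hg : ∀ i ∈ T, |g i| ≤ 1) : |∏ i ∈ T, f i - ∏ i ∈ T, g i| ≤ ∑ i ∈ T, |f i - g i| := by
  classical
  induction T using Finset.induction_on with
  | empty => simp
  | insert a s ha ih =>
    rw [prod_insert ha, prod_insert ha, sum_insert ha]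
    have h1 := ih (fun i hi => hf i (mem_insert_of_mem hi)) (fun i hi => hg i (mem_insert_of_mem hi))
    have h2 : |∏ i ∈ s, g i| ≤ 1 := by
      rw [abs_prod]
      exact prod_le_one (fun _ _ => abs_nonneg _) fun i hi => hg i (mem_insert_of_mem hi)
    calc |f a * ∏ i ∈ s, f i - g a * ∏ i ∈ s, g i|
        = |(f a - g a) * ∏ i ∈ s, g i + f a * (∏ i ∈ s, f i - ∏ i ∈ s, g i)| := by ring_nf
      _ ≤ |f a - g a| * |∏ i ∈ s, g i| + |f a| * |∏ i ∈ s, f i - ∏ i ∈ s, g i| := by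
          rw [← abs_mul, ← abs_mul]; exact abs_add_le _ _
      _ ≤ |f a - g a| * 1 + 1 * |∏ i ∈ s, f i - ∏ i ∈ s, g i| := by
          gcongr
          exact hf a (mem_insert_self _ _)
      _ ≤ _ := by linarith

open Classical in
/-- The indicator function of the squares modulo `n`. -/
noncomputable def sqInd (n : ℕ) (x : ZMod n) : ℝ := if IsSquare x then 1 else 0

theorem sqInd_nonneg (n : ℕ) (x : ZMod n) : 0 ≤ sqInd n x := by
  unfold sqInd; split_ifs <;> norm_num

theorem sqInd_le_one (n : ℕ) (x : ZMod n) : sqInd n x ≤ 1 := by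
  unfold sqInd; split_ifs <;> norm_num

theorem sqInd_zero (p : ℕ) : sqInd p 0 = 1 := by simp [sqInd]

theorem sqInd_of_ne_zero (p : ℕ) [Fact p.Prime] (y : ZMod p) (hy : y ≠ 0) :
    sqInd p y = (1 + (quadraticChar (ZMod p) y : ℝ)) / 2 := by
  unfold sqInd
  split_ifs with h
  · rw [(quadraticChar_one_iff_isSquare hy).2 h]; norm_num
  · rw [quadraticChar_neg_one_iff_not_isSquare.2 h]; norm_num

/-- The density of the squares modulo an odd prime `p`. -/
noncomputable def sqDens (p : ℕ) : ℝ := (p + 1) / (2 * p)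

theorem sum_quadraticChar_real (p : ℕ) [Fact p.Prime] (hp2 : p ≠ 2) :
    ∑ y : ZMod p, (quadraticChar (ZMod p) y : ℝ) = 0 := by
  have := quadraticChar_sum_zero (F := ZMod p) (by rwa [ZMod.ringChar_zmod_n])
  exact_mod_cast this

theorem abs_quadraticChar_le_one (p : ℕ) [Fact p.Prime] (y : ZMod p) :
    |(quadraticChar (ZMod p) y : ℝ)| ≤ 1 := by
  by_cases hy : y = 0
  · simp [hy]
  · rcases quadraticChar_dichotomy hy with h | h <;> simp [h]

theorem sqInd_eq (p : ℕ) [Fact p.Prime] (y : ZMod p) :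
    sqInd p y = (1 + (quadraticChar (ZMod p) y : ℝ)) / 2 + if y = 0 then 1 / 2 else 0 := by
  split_ifs with h
  · subst h; simp [sqInd_zero]; norm_num
  · rw [sqInd_of_ne_zero p y h, add_zero]

theorem sum_sqInd (p : ℕ) [Fact p.Prime] (hp2 : p ≠ 2) :
    ∑ y : ZMod p, sqInd p y = (p + 1) / 2 := by
  simp only [sqInd_eq, sum_add_distrib, add_div, ← sum_div, sum_quadraticChar_real p hp2]
  simp [ZMod.card]

theorem abs_thin_average_sub_le_of_injOn (p : ℕ) [Fact p.Prime] (hp2 : p ≠ 2) (B : Finset ℕ)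
    (hB : Set.InjOn (fun i : ℕ => (i : ZMod p)) B) (c : ℝ) (hc0 : 0 ≤ c) (hc1 : c ≤ 1) :
    |∑ y : ZMod p, ∏ i ∈ B, (1 - c * sqInd p (y + i)) - p * (1 - c * sqDens p) ^ #B| ≤
      17 * #B * √p := by
  have hp : p.Prime := Fact.out
  have hp0 : (0 : ℝ) < p := by exact_mod_cast hp.pos
  have hp1 : (1 : ℝ) ≤ p := by exact_mod_cast hp.one_le
  have hs1 : 1 ≤ √(p : ℝ) := Real.one_le_sqrt.2 hp1
  set a : ℝ := 1 - c / 2 with ha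
  set b : ℝ := c / 2 with hb
  have ha0 : 0 ≤ a := by linarith
  have hb0 : 0 ≤ b := by linarith
  have hab : b + a = 1 := by ring
  have hchi := abs_quadraticChar_le_one p
  have hfac : ∀ y : ZMod p, |-(b * (quadraticChar (ZMod p) y : ℝ)) + a| ≤ 1 := by
    intro y
    have := abs_le.1 (hchi y)
    rw [abs_le]; constructor <;> nlinarith
  have h1 : |∑ y : ZMod p, ∏ i ∈ B, (1 - c * sqInd p (y + i)) -
      ∑ y : ZMod p, ∏ i ∈ B, (-(b * (quadraticChar (ZMod p) (y + i) : ℝ)) + a)| ≤ #B / 2 := by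
    rw [← sum_sub_distrib]
    refine (abs_sum_le_sum_abs _ _).trans ?_
    calc _ ≤ ∑ y : ZMod p, ∑ i ∈ B, (if y + (i : ZMod p) = 0 then (1 / 2 : ℝ) else 0) := by
          refine sum_le_sum fun y _ => (abs_prod_sub_prod_le _ _ _ ?_ fun i _ => hfac _).trans
            (sum_le_sum fun i _ => ?_)
          · intro i _
            have h1 := sqInd_nonneg p (y + i)
            have h2 := sqInd_le_one p (y + i)
            rw [abs_le]; constructor <;> nlinarith
          · rw [sqInd_eq]
            split_ifs with h
            · rw [h]; simp [ha]; rw [abs_le]; constructor <;> linarith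
            · rw [show (1 - c * ((1 + (quadraticChar (ZMod p) (y + i) : ℝ)) / 2 + 0) -
                (-(b * (quadraticChar (ZMod p) (y + i) : ℝ)) + a)) = 0 by rw [ha, hb]; ring]
              simp
      _ = ∑ i ∈ B, (1 / 2 : ℝ) := by
          rw [sum_comm]
          refine sum_congr rfl fun i _ => ?_
          simp_rw [← eq_neg_iff_add_eq_zero]
          rw [sum_ite_eq', if_pos (mem_univ _)]
      _ = #B / 2 := by simp; ring
  have h2 : |p * (1 - c * sqDens p) ^ #B - p * a ^ #B| ≤ #B / 2 := by
    rw [← mul_sub, abs_mul, abs_of_pos hp0]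
    have hd : sqDens p ≤ 1 := by
      unfold sqDens; rw [div_le_one (by positivity)]; linarith
    have hd0 : 0 ≤ sqDens p := by unfold sqDens; positivity
    have := abs_prod_sub_prod_le B (fun _ => 1 - c * sqDens p) (fun _ => a)
      (fun _ _ => by rw [abs_le]; constructor <;> nlinarith)
      (fun _ _ => by rw [abs_le]; constructor <;> linarith)
    simp only [prod_const, sum_const, nsmul_eq_mul] at this
    have h3 : |1 - c * sqDens p - a| = c / (2 * p) := by
      rw [abs_sub_comm]
      rw [show a - (1 - c * sqDens p) = c / (2 * p) by
        rw [ha, sqDens]; field_simp; ring]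
      exact abs_of_nonneg (by positivity)
    rw [h3] at this
    calc _ ≤ p * (#B * (c / (2 * p))) := by gcongr
      _ = #B * c / 2 := by field_simp
      _ ≤ #B * 1 / 2 := by gcongr
      _ = _ := by ring
  have h3 : |∑ y : ZMod p, ∏ i ∈ B, (-(b * (quadraticChar (ZMod p) (y + i) : ℝ)) + a) -
      p * a ^ #B| ≤ 16 * #B * √p := by
    have e1 : ∑ y : ZMod p, ∏ i ∈ B, (-(b * (quadraticChar (ZMod p) (y + i) : ℝ)) + a) =
        ∑ T ∈ B.powerset, (-b) ^ #T * a ^ #(B \ T) *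
          ∑ y : ZMod p, ∏ i ∈ T, (quadraticChar (ZMod p) (y + i) : ℝ) := by
      simp only [prod_add]
      rw [sum_comm]
      refine sum_congr rfl fun T _ => ?_
      rw [mul_sum]
      refine sum_congr rfl fun y _ => ?_
      rw [prod_const, ← prod_const, ← prod_const]
      simp only [← neg_mul, prod_mul_distrib]
      ring
    have e2 : (p : ℝ) * a ^ #B = ∑ T ∈ B.powerset, if T = ∅ then (p : ℝ) * a ^ #B else 0 := by
      rw [sum_ite_eq' B.powerset ∅]; simp
    rw [e1, e2, ← sum_sub_distrib]
    refine (abs_sum_le_sum_abs _ _).trans ?_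
    calc _ ≤ ∑ T ∈ B.powerset, (b ^ #T * a ^ #(B \ T)) * (16 * #B * √p) := by
          refine sum_le_sum fun T hT => ?_
          rw [mem_powerset] at hT
          split_ifs with h
          · subst h
            simp only [card_empty, pow_zero, sdiff_empty, one_mul, prod_empty, sum_const, card_univ,
              ZMod.card, nsmul_eq_mul, mul_one]
            rw [mul_comm, sub_self, abs_zero]
            exact mul_nonneg (pow_nonneg ha0 _)
              (mul_nonneg (mul_nonneg (by norm_num) (Nat.cast_nonneg _)) (Real.sqrt_nonneg _))
          · obtain ⟨j, hj⟩ := nonempty_iff_ne_empty.2 h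
            rw [sub_zero, abs_mul, abs_mul, abs_pow, abs_neg, abs_of_nonneg hb0,
              abs_of_nonneg (pow_nonneg ha0 _)]
            refine mul_le_mul_of_nonneg_left ?_ (by positivity)
            refine (quadraticChar_prod_sum_le p hp2 T (fun i => (i : ZMod p)) (j : ZMod p) ?_).trans ?_
            · rw [show ({i ∈ T | (i : ZMod p) = j} : Finset ℕ) = {j} by
                ext i
                simp only [mem_filter, mem_singleton]
                constructor
                · rintro ⟨hi, hij⟩
                  exact hB (hT hi) (hT hj) hij
                · rintro rfl
                  exact ⟨hj, rfl⟩]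
              simp
            · have := card_le_card hT
              gcongr
      _ = 16 * #B * √p := by
          rw [← sum_mul]
          have : ∑ T ∈ B.powerset, b ^ #T * a ^ #(B \ T) = 1 := by
            have := prod_add (fun _ => b) (fun _ => a) B
            simp only [prod_const, hab, one_pow] at this
            exact this.symm
          rw [this, one_mul]
  have hBs : (#B : ℝ) ≤ #B * √p := le_mul_of_one_le_right (by positivity) hs1
  have t1 := abs_le.1 h1
  have t2 := abs_le.1 h2
  have t3 := abs_le.1 h3
  rw [abs_le]
  constructor <;> linarith

/-- The normalised indicator function of the squares modulo `p`. -/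
noncomputable def psi (p : ℕ) (y : ZMod p) : ℝ := sqInd p y / sqDens p - 1

theorem psi_zero (p : ℕ) (hp : 0 < p) : psi p 0 = (p - 1) / (p + 1) := by
  have : (0 : ℝ) < p := by exact_mod_cast hp
  rw [psi, sqInd_zero, sqDens]; field_simp; ring

theorem abs_psi_le_one (p : ℕ) [Fact p.Prime] (y : ZMod p) : |psi p y| ≤ 1 := by
  have hp : (1 : ℝ) ≤ p := by exact_mod_cast (Fact.out : p.Prime).one_le
  have hd : 1 / 2 ≤ sqDens p := by
    unfold sqDens; rw [div_le_div_iff₀ (by norm_num) (by positivity)]; linarith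
  unfold psi sqInd
  split_ifs
  · have h1 : 1 / sqDens p ≤ 2 := by
      rw [div_le_iff₀ (by linarith)]; linarith
    have h2 : 0 ≤ 1 / sqDens p := by positivity
    rw [abs_le]; constructor <;> linarith
  · simp

theorem sum_abs_psi_sub_le (p : ℕ) [Fact p.Prime] (b : ZMod p) :
    ∑ y : ZMod p, |psi p (y + b) - (quadraticChar (ZMod p) (y + b) : ℝ)| ≤ 3 := by
  have hp : (1 : ℝ) ≤ p := by exact_mod_cast (Fact.out : p.Prime).one_le
  refine (Equiv.sum_comp (Equiv.addRight b)
    (fun y => |psi p y - (quadraticChar (ZMod p) y : ℝ)|)).trans_le ?_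
  calc _ ≤ ∑ y : ZMod p, (2 / (p + 1 : ℝ) + if y = 0 then 1 else 0) := by
        refine sum_le_sum fun y _ => ?_
        split_ifs with h
        · subst h
          rw [psi_zero p (Fact.out : p.Prime).pos]
          have h1 : ((p : ℝ) - 1) / (p + 1) ≤ 1 := by
            rw [div_le_one (by positivity)]; linarith
          have h2 : 0 ≤ ((p : ℝ) - 1) / (p + 1) := div_nonneg (by linarith) (by positivity)
          have h3 : 0 ≤ 2 / ((p : ℝ) + 1) := by positivity
          simp only [MulChar.map_zero, Int.cast_zero, sub_zero]
          rw [abs_of_nonneg h2]; linarith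
        · have hc := abs_le.1 (abs_quadraticChar_le_one p y)
          rw [psi, sqInd_of_ne_zero p y h, sqDens]
          rw [show (1 + (quadraticChar (ZMod p) y : ℝ)) / 2 / ((p + 1) / (2 * p)) - 1 -
            (quadraticChar (ZMod p) y : ℝ) = - ((1 + (quadraticChar (ZMod p) y : ℝ)) / (p + 1)) by
              field_simp; ring, abs_neg, abs_of_nonneg (div_nonneg (by linarith) (by positivity)),
              add_zero]
          gcongr
          linarith
    _ = p * (2 / (p + 1)) + 1 := by simp [sum_add_distrib, ZMod.card]
    _ ≤ 3 := by
        have : (p : ℝ) * (2 / (p + 1)) ≤ 2 := by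
          rw [← mul_div_assoc, div_le_iff₀ (by positivity)]; linarith
        linarith

theorem abs_sum_prod_psi_le (p : ℕ) [Fact p.Prime] (b : Fin 4 → ZMod p) :
    |∑ y : ZMod p, ∏ j, psi p (y + b j)| ≤ p := by
  refine (abs_sum_le_sum_abs _ _).trans ?_
  calc _ ≤ ∑ y : ZMod p, (1 : ℝ) := by
        refine sum_le_sum fun y _ => ?_
        rw [abs_prod]
        exact prod_le_one (fun _ _ => abs_nonneg _) fun i _ => abs_psi_le_one p _
    _ = p := by simp [ZMod.card]

theorem exists_odd_of_not_paired {α : Type*} [DecidableEq α] (b : Fin 4 → α)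
    (h12 : ¬ (b 0 = b 1 ∧ b 2 = b 3)) (h13 : ¬ (b 0 = b 2 ∧ b 1 = b 3))
    (h14 : ¬ (b 0 = b 3 ∧ b 1 = b 2)) : ∃ a, Odd #{i ∈ (univ : Finset (Fin 4)) | b i = a} := by
  by_contra! hne
  have h0 := hne (b 0)
  have h1 := hne (b 1)
  have h2 := hne (b 2)
  have h3 := hne (b 3)
  simp only [card_filter, Fin.sum_univ_four] at h0 h1 h2 h3
  by_cases e01 : b 0 = b 1 <;> by_cases e02 : b 0 = b 2 <;> by_cases e03 : b 0 = b 3 <;>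
    by_cases e12 : b 1 = b 2 <;> by_cases e13 : b 1 = b 3 <;> by_cases e23 : b 2 = b 3 <;>
    simp_all +decide [eq_comm]

theorem abs_sum_prod_psi_le_of_not_paired (p : ℕ) [Fact p.Prime] (hp2 : p ≠ 2)
    (b : Fin 4 → ZMod p)
    (h12 : ¬ (b 0 = b 1 ∧ b 2 = b 3)) (h13 : ¬ (b 0 = b 2 ∧ b 1 = b 3))
    (h14 : ¬ (b 0 = b 3 ∧ b 1 = b 2)) :
    |∑ y : ZMod p, ∏ j, psi p (y + b j)| ≤ 76 * √p := by
  have hs1 : 1 ≤ √(p : ℝ) := Real.one_le_sqrt.2 (by exact_mod_cast (Fact.out : p.Prime).one_le)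
  obtain ⟨a, ha⟩ := exists_odd_of_not_paired b h12 h13 h14
  have h1 := quadraticChar_prod_sum_le p hp2 univ b a ha
  have h2 : |∑ y : ZMod p, ∏ j, psi p (y + b j) -
      ∑ y : ZMod p, ∏ j, (quadraticChar (ZMod p) (y + b j) : ℝ)| ≤ 12 := by
    rw [← sum_sub_distrib]
    refine (abs_sum_le_sum_abs _ _).trans ?_
    calc _ ≤ ∑ y : ZMod p, ∑ j, |psi p (y + b j) - (quadraticChar (ZMod p) (y + b j) : ℝ)| :=
          sum_le_sum fun y _ => abs_prod_sub_prod_le _ _ _ (fun i _ => abs_psi_le_one p _)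
            fun i _ => abs_quadraticChar_le_one p _
      _ ≤ ∑ j : Fin 4, (3 : ℝ) := by
          rw [sum_comm]
          exact sum_le_sum fun j _ => sum_abs_psi_sub_le p _
      _ = 12 := by norm_num
  rw [card_univ, Fintype.card_fin] at h1
  push_cast at h1
  have t1 := abs_le.1 h1
  have t2 := abs_le.1 h2
  rw [abs_le]
  constructor <;> linarith

@[to_additive]
theorem prod_range_natCast {β : Type*} [CommMonoid β] (n : ℕ) [NeZero n] (f : ZMod n → β) :
    ∏ x ∈ range n, f x = ∏ y, f y := by
  refine prod_nbij' (fun x => (x : ZMod n)) ZMod.val (by simp)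
    (fun y _ => mem_range.2 (ZMod.val_lt y)) (fun x hx => ZMod.val_cast_of_lt (mem_range.1 hx))
    (fun y _ => ZMod.natCast_zmod_val y) (by simp)

theorem sum_range_mul_eq_sum_sum {β : Type*} [AddCommMonoid β] (a b : ℕ) [NeZero a] [NeZero b]
    (hab : a.Coprime b) (G : ZMod a → ZMod b → β) :
    ∑ x ∈ range (a * b), G x x = ∑ u, ∑ v, G u v := by
  have : NeZero (a * b) := ⟨mul_ne_zero (NeZero.ne a) (NeZero.ne b)⟩
  have h := sum_range_natCast (a * b)
    (fun x => G (ZMod.chineseRemainder hab x).1 (ZMod.chineseRemainder hab x).2)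
  simp only [map_natCast, Prod.fst_natCast, Prod.snd_natCast] at h
  rw [h, ← Fintype.sum_prod_type' (f := G)]
  exact Equiv.sum_comp (ZMod.chineseRemainder hab).toEquiv (fun y => G y.1 y.2)

theorem isSquare_natCast_mul_iff (a b : ℕ) (hab : a.Coprime b) (n : ℕ) :
    IsSquare (n : ZMod (a * b)) ↔ IsSquare (n : ZMod a) ∧ IsSquare (n : ZMod b) := by
  set e := ZMod.chineseRemainder hab with he
  have hn : e (n : ZMod (a * b)) = ((n : ZMod a), (n : ZMod b)) := by
    rw [map_natCast]; rfl
  constructor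
  · rintro ⟨r, hr⟩
    rw [hr, map_mul] at hn
    exact ⟨⟨(e r).1, (congrArg Prod.fst hn).symm⟩, ⟨(e r).2, (congrArg Prod.snd hn).symm⟩⟩
  · rintro ⟨⟨r, hr⟩, ⟨s, hs⟩⟩
    refine ⟨e.symm (r, s), e.injective ?_⟩
    rw [map_mul, e.apply_symm_apply, hn, hr, hs]
    rfl

theorem sqInd_mul (a b : ℕ) (hab : a.Coprime b) (n : ℕ) :
    sqInd (a * b) n = sqInd a n * sqInd b n := by
  unfold sqInd
  rw [isSquare_natCast_mul_iff a b hab]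
  by_cases h1 : IsSquare (n : ZMod a) <;> by_cases h2 : IsSquare (n : ZMod b) <;> simp [h1, h2]

/-- The average over `x` modulo `n` of `∏ (1 - c * sqInd n (x + i))`, `1 ≤ i ≤ k`. -/
noncomputable def thinAvg (n : ℕ) (c : ℝ) (k : ℕ) : ℝ :=
  (∑ x ∈ range n, ∏ i ∈ Icc 1 k, (1 - c * sqInd n ((x + i : ℕ) : ZMod n))) / n

theorem one_sub_mul_sqInd_mem (n : ℕ) (x : ZMod n) (c : ℝ) (hc0 : 0 ≤ c) (hc1 : c ≤ 1) :
    0 ≤ 1 - c * sqInd n x ∧ 1 - c * sqInd n x ≤ 1 := by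
  have h1 := sqInd_nonneg n x
  have h2 := sqInd_le_one n x
  constructor <;> nlinarith

theorem thinAvg_nonneg (n : ℕ) (c : ℝ) (k : ℕ) (hc0 : 0 ≤ c) (hc1 : c ≤ 1) :
    0 ≤ thinAvg n c k :=
  div_nonneg (sum_nonneg fun _ _ => prod_nonneg fun _ _ =>
    (one_sub_mul_sqInd_mem n _ c hc0 hc1).1) (Nat.cast_nonneg _)

theorem thinAvg_le_one (n : ℕ) (c : ℝ) (k : ℕ) (hc0 : 0 ≤ c) (hc1 : c ≤ 1) :
    thinAvg n c k ≤ 1 := by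
  refine div_le_one_of_le₀ ?_ (Nat.cast_nonneg _)
  calc _ ≤ ∑ x ∈ range n, (1 : ℝ) := sum_le_sum fun _ _ => prod_le_one
        (fun _ _ => (one_sub_mul_sqInd_mem n _ c hc0 hc1).1)
        fun _ _ => (one_sub_mul_sqInd_mem n _ c hc0 hc1).2
    _ = n := by simp

theorem sqDens_pos (p : ℕ) (hp : 0 < p) : 0 < sqDens p := by
  have : (0 : ℝ) < p := by exact_mod_cast hp
  unfold sqDens; positivity

theorem sqDens_le_one (p : ℕ) : sqDens p ≤ 1 := by
  rcases Nat.eq_zero_or_pos p with rfl | hp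
  · simp [sqDens]
  · have : (1 : ℝ) ≤ p := by exact_mod_cast hp
    unfold sqDens; rw [div_le_one (by positivity)]; linarith

theorem abs_thinAvg_mul_prime_sub_le (a p : ℕ) (ha : a ≠ 0) [Fact p.Prime] (hp2 : p ≠ 2)
    (hap : a.Coprime p) (c : ℝ) (hc0 : 0 ≤ c) (hc1 : c ≤ 1) (k : ℕ) :
    |thinAvg (a * p) c k - thinAvg a (c * sqDens p) k| ≤ 17 * (k + 1) / √p := by
  classical
  have hp : p.Prime := Fact.out
  have : NeZero a := ⟨ha⟩
  have hp0 : (0 : ℝ) < p := by exact_mod_cast hp.pos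
  have ha0 : (0 : ℝ) < a := by exact_mod_cast Nat.pos_of_ne_zero ha
  have hs0 : 0 < √(p : ℝ) := Real.sqrt_pos.2 hp0
  have hsq : √(p : ℝ) * √p = p := Real.mul_self_sqrt hp0.le
  have hd0 := (sqDens_pos p hp.pos).le
  have hd1 := sqDens_le_one p
  have hcd0 : 0 ≤ c * sqDens p := by positivity
  have hcd1 : c * sqDens p ≤ 1 := by nlinarith
  rcases lt_or_ge k p with hkp | hkp
  · have hB : ∀ u : ZMod a, |∑ v : ZMod p, ∏ i ∈ Icc 1 k, (1 - c * (sqInd a (u + (i : ℕ)) *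
        sqInd p (v + (i : ℕ)))) - p * ∏ i ∈ Icc 1 k, (1 - c * sqDens p * sqInd a (u + (i : ℕ)))| ≤
        17 * k * √p := by
      intro u
      set B := {i ∈ Icc 1 k | IsSquare (u + ((i : ℕ) : ZMod a))} with hBdef
      have hBk : #B ≤ k := (card_filter_le _ _).trans (by simp)
      have hinj : Set.InjOn (fun i : ℕ => (i : ZMod p)) B := by
        intro i hi j hj hij
        have hi' := (mem_Icc.1 (mem_filter.1 (mem_coe.1 hi)).1)
        have hj' := (mem_Icc.1 (mem_filter.1 (mem_coe.1 hj)).1)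
        have := congrArg ZMod.val hij
        simpa only [ZMod.val_cast_of_lt (hi'.2.trans_lt hkp),
          ZMod.val_cast_of_lt (hj'.2.trans_lt hkp)] using this
      have key := abs_thin_average_sub_le_of_injOn p hp2 B hinj c hc0 hc1
      have e1 : ∀ v : ZMod p, ∏ i ∈ Icc 1 k, (1 - c * (sqInd a (u + (i : ℕ)) *
          sqInd p (v + (i : ℕ)))) = ∏ i ∈ B, (1 - c * sqInd p (v + (i : ℕ))) := by
        intro v
        rw [hBdef, prod_filter]
        refine prod_congr rfl fun i _ => ?_
        by_cases h : IsSquare (u + (i : ZMod a)) <;> simp [sqInd, h]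
      have e2 : ∏ i ∈ Icc 1 k, (1 - c * sqDens p * sqInd a (u + (i : ℕ))) =
          (1 - c * sqDens p) ^ #B := by
        rw [← prod_const, hBdef, prod_filter]
        refine prod_congr rfl fun i _ => ?_
        by_cases h : IsSquare (u + (i : ZMod a)) <;> simp [sqInd, h]
      simp only [e1, e2]
      refine key.trans ?_
      gcongr
    have e3 : thinAvg (a * p) c k = (∑ u : ZMod a, ∑ v : ZMod p, ∏ i ∈ Icc 1 k,
        (1 - c * (sqInd a (u + (i : ℕ)) * sqInd p (v + (i : ℕ))))) / (a * p) := by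
      unfold thinAvg
      rw [← sum_range_mul_eq_sum_sum a p hap (fun u v => ∏ i ∈ Icc 1 k,
        (1 - c * (sqInd a (u + (i : ℕ)) * sqInd p (v + (i : ℕ)))))]
      simp only [sqInd_mul a p hap]
      push_cast
      rfl
    have e4 : thinAvg a (c * sqDens p) k = (∑ u : ZMod a, p * ∏ i ∈ Icc 1 k,
        (1 - c * sqDens p * sqInd a (u + (i : ℕ)))) / (a * p) := by
      unfold thinAvg
      rw [← mul_sum, ← sum_range_natCast a (fun u => ∏ i ∈ Icc 1 k,
        (1 - c * sqDens p * sqInd a (u + (i : ℕ)))), mul_comm (a : ℝ), mul_div_mul_left _ _ hp0.ne']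
      simp only [Nat.cast_add]
    rw [e3, e4, ← sub_div, ← sum_sub_distrib, abs_div, abs_of_pos (by positivity : (0 : ℝ) < a * p),
      div_le_div_iff₀ (by positivity) hs0]
    calc _ ≤ (∑ u : ZMod a, 17 * (k : ℝ) * √p) * √p := by
          gcongr
          exact (abs_sum_le_sum_abs _ _).trans (sum_le_sum fun u _ => hB u)
      _ = 17 * k * (a * (√p * √p)) := by
          rw [sum_const, card_univ, ZMod.card, nsmul_eq_mul]; generalize √(p : ℝ) = t; ring
      _ ≤ 17 * (k + 1) * (a * p) := by
          rw [hsq]; gcongr; linarith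
  · have h1 := thinAvg_nonneg (a * p) c k hc0 hc1
    have h2 := thinAvg_le_one (a * p) c k hc0 hc1
    have h3 := thinAvg_nonneg a _ k hcd0 hcd1
    have h4 := thinAvg_le_one a _ k hcd0 hcd1
    have h5 : (1 : ℝ) ≤ 17 * (k + 1) / √p := by
      rw [le_div_iff₀ hs0]
      have : (p : ℝ) ≤ k := by exact_mod_cast hkp
      have h6 : 1 ≤ √(p : ℝ) := Real.one_le_sqrt.2 (by exact_mod_cast hp.one_le)
      nlinarith
    rw [abs_le]; constructor <;> linarith

theorem abs_thinAvg_mul_prod_sub_le (A : ℕ) (hA : A ≠ 0) (k : ℕ) (P : Finset ℕ)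
    (hP : ∀ p ∈ P, p.Prime ∧ p ≠ 2 ∧ A.Coprime p) (c : ℝ) (hc0 : 0 ≤ c) (hc1 : c ≤ 1) :
    |thinAvg (A * ∏ p ∈ P, p) c k - thinAvg A (c * ∏ p ∈ P, sqDens p) k| ≤
      ∑ p ∈ P, 17 * (k + 1) / √p := by
  induction P using Finset.induction_on generalizing c with
  | empty => simp
  | insert p s hps ih =>
    obtain ⟨hp, hp2, hAp⟩ := hP p (mem_insert_self _ _)
    have hs : ∀ q ∈ s, q.Prime ∧ q ≠ 2 ∧ A.Coprime q := fun q hq => hP q (mem_insert_of_mem hq)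
    have : Fact p.Prime := ⟨hp⟩
    have hd0 := (sqDens_pos p hp.pos).le
    have hd1 := sqDens_le_one p
    have h1 := ih hs (c * sqDens p) (by positivity) (by nlinarith)
    have hcop : (A * ∏ q ∈ s, q).Coprime p := by
      refine Nat.Coprime.mul_left hAp (Nat.Coprime.prod_left fun q hq => ?_)
      exact (Nat.coprime_primes (hs q hq).1 hp).2 (by rintro rfl; exact hps hq)
    have hne : A * ∏ q ∈ s, q ≠ 0 :=
      mul_ne_zero hA (prod_ne_zero_iff.2 fun q hq => (hs q hq).1.ne_zero)
    have h2 := abs_thinAvg_mul_prime_sub_le _ p hne hp2 hcop c hc0 hc1 k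
    rw [prod_insert hps, prod_insert hps, sum_insert hps, mul_comm p, ← mul_assoc, ← mul_assoc]
    refine (abs_sub_le _ _ _).trans (add_le_add h2 h1)

theorem mem_QR_iff (M : ℕ) (hM : M ≠ 0) (x : ZMod M) : x ∈ QR M ↔ IsSquare x := by
  have : NeZero M := ⟨hM⟩
  unfold QR
  rw [mem_image]
  constructor
  · rintro ⟨a, -, rfl⟩
    exact ⟨a, sq _⟩
  · rintro ⟨r, rfl⟩
    exact ⟨r.val, mem_range.2 (ZMod.val_lt r), by rw [ZMod.natCast_zmod_val, sq]⟩

/-- The number of `x` modulo `M` such that none of `x + 1, ..., x + k` lies in `U`. -/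
noncomputable def gapCount (M : ℕ) [NeZero M] (U : Finset (ZMod M)) (k : ℕ) : ℕ :=
  #{x : ZMod M | ∀ i ∈ Icc 1 k, x + ((i : ℕ) : ZMod M) ∉ U}

theorem gapCount_zero (M : ℕ) [NeZero M] (U : Finset (ZMod M)) : gapCount M U 0 = M := by
  simp [gapCount, ZMod.card]

theorem gapCount_self (M : ℕ) [NeZero M] (U : Finset (ZMod M)) (hU : U.Nonempty) :
    gapCount M U M = 0 := by
  obtain ⟨u, hu⟩ := hU
  unfold gapCount
  rw [card_eq_zero, filter_eq_empty_iff]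
  intro x _ h
  rcases Nat.eq_zero_or_pos (u - x).val with h0 | h0
  · apply h M (mem_Icc.2 ⟨NeZero.one_le, le_rfl⟩)
    rw [ZMod.val_eq_zero] at h0
    rw [sub_eq_zero] at h0
    simpa [← h0] using hu
  · apply h (u - x).val (mem_Icc.2 ⟨h0, (ZMod.val_lt _).le⟩)
    simpa using hu

theorem lt_cycGap_iff (M : ℕ) [NeZero M] (U : Finset (ZMod M)) (hU : U.Nonempty) (x : ZMod M)
    (k : ℕ) : k < cycGap M U x ↔ ∀ i ∈ Icc 1 k, x + ((i : ℕ) : ZMod M) ∉ U := by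
  unfold cycGap
  have hne : {k : ℕ | 0 < k ∧ x + (k : ZMod M) ∈ U}.Nonempty := by
    obtain ⟨u, hu⟩ := hU
    refine ⟨(u - x).val + M, by have := NeZero.pos M; omega, ?_⟩
    simpa using hu
  constructor
  · intro h i hi hmem
    have := Nat.sInf_le (s := {k : ℕ | 0 < k ∧ x + (k : ZMod M) ∈ U}) ⟨(mem_Icc.1 hi).1, hmem⟩
    have := (mem_Icc.1 hi).2
    omega
  · intro h
    by_contra! hle
    have := Nat.sInf_mem hne
    exact h _ (mem_Icc.2 ⟨this.1, hle⟩) this.2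

theorem card_filter_lt_cycGap (M : ℕ) [NeZero M] (U : Finset (ZMod M)) (hU : U.Nonempty) (k : ℕ) :
    #{u ∈ U | k < cycGap M U u} + gapCount M U (k + 1) = gapCount M U k := by
  simp only [lt_cycGap_iff M U hU]
  have h1 : gapCount M U (k + 1) =
      #{x ∈ {x : ZMod M | ∀ i ∈ Icc 1 k, x + ((i : ℕ) : ZMod M) ∉ U} | x ∉ U} := by
    unfold gapCount
    refine card_bij (fun x _ => x + 1) ?_ (fun x _ y _ h => add_right_cancel h) ?_
    · intro x hx
      simp only [mem_filter, mem_univ, true_and] at hx ⊢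
      refine ⟨fun i hi => ?_, by simpa using hx 1 (by simp)⟩
      have := hx (i + 1) (by rw [mem_Icc] at hi ⊢; omega)
      rwa [Nat.cast_add, Nat.cast_one, ← add_assoc, add_right_comm] at this
    · intro y hy
      simp only [mem_filter, mem_univ, true_and] at hy
      refine ⟨y - 1, ?_, sub_add_cancel _ _⟩
      simp only [mem_filter, mem_univ, true_and]
      intro i hi
      rw [mem_Icc] at hi
      rcases Nat.lt_or_ge 1 i with h | h
      · have := hy.1 (i - 1) (by rw [mem_Icc]; omega)
        rwa [Nat.cast_sub hi.1, Nat.cast_one, add_sub, add_sub_right_comm] at this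
      · have : i = 1 := by omega
        subst this
        simpa using hy.2
  have h2 : #{u ∈ U | ∀ i ∈ Icc 1 k, u + ((i : ℕ) : ZMod M) ∉ U} =
      #{x ∈ {x : ZMod M | ∀ i ∈ Icc 1 k, x + ((i : ℕ) : ZMod M) ∉ U} | x ∈ U} := by
    congr 1
    ext x
    simp [and_comm]
  rw [h1, h2]
  exact card_filter_add_card_filter_not _

theorem cycGap_le (M : ℕ) [NeZero M] (U : Finset (ZMod M)) (u : ZMod M) (hu : u ∈ U) :
    cycGap M U u ≤ M :=
  Nat.sInf_le ⟨NeZero.pos M, by simpa using hu⟩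

theorem stoch_eq (M : ℕ) [NeZero M] (U : Finset (ZMod M)) (hU : U.Nonempty) :
    stoch M U = M + 2 * ∑ k ∈ Icc 1 M, gapCount M U k := by
  have h1 : stoch M U = ∑ k ∈ range M, (2 * k + 1) * #{u ∈ U | k < cycGap M U u} := by
    unfold stoch
    simp only [card_filter, mul_sum]
    rw [sum_comm]
    refine sum_congr rfl fun u hu => ?_
    have hle := cycGap_le M U u hu
    simp only [mul_ite, mul_one, mul_zero]
    rw [← sum_filter]
    have : {k ∈ range M | k < cycGap M U u} = range (cycGap M U u) := by
      ext k
      simp only [mem_filter, mem_range]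
      omega
    rw [this, Finset.sum_add_distrib, ← mul_sum]
    have := Finset.sum_range_id_mul_two (cycGap M U u)
    simp only [sum_const, card_range, smul_eq_mul, mul_one]
    rcases Nat.eq_zero_or_pos (cycGap M U u) with h | h
    · simp [h]
    · obtain ⟨g, hg⟩ : ∃ g, cycGap M U u = g + 1 := ⟨_, (Nat.succ_pred_eq_of_pos h).symm⟩
      rw [hg] at this ⊢
      simp only [Nat.add_sub_cancel] at this
      nlinarith
  have h2 : ∀ n, ∑ k ∈ range n, (2 * k + 1) * #{u ∈ U | k < cycGap M U u} +
      (2 * n + 1) * gapCount M U n = M + 2 * ∑ k ∈ Icc 1 n, gapCount M U k := by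
    intro n
    induction n with
    | zero => simp [gapCount_zero]
    | succ n ih =>
      rw [sum_range_succ, sum_Icc_succ_top (by omega)]
      have := card_filter_lt_cycGap M U hU n
      nlinarith
  have := h2 M
  rw [gapCount_self M U hU] at this
  rw [h1]
  omega

theorem gapCount_QR (M : ℕ) [NeZero M] (k : ℕ) :
    (gapCount M (QR M) k : ℝ) = M * thinAvg M 1 k := by
  have hM0 : (M : ℝ) ≠ 0 := by exact_mod_cast NeZero.ne M
  unfold thinAvg gapCount
  rw [mul_div_cancel₀ _ hM0, card_filter]
  push_cast
  rw [sum_range_natCast M (fun x => ∏ i ∈ Icc 1 k, (1 - 1 * sqInd M (x + (i : ℕ))))]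
  refine sum_congr rfl fun x _ => ?_
  simp only [mem_QR_iff M (NeZero.ne M)]
  split_ifs with h
  · rw [prod_eq_one]
    intro i hi
    simp [sqInd, h i hi]
  · push Not at h
    obtain ⟨i, hi, hs⟩ := h
    rw [prod_eq_zero hi]
    simp [sqInd, hs]

theorem stoch_QR_eq (M : ℕ) (hM : M ≠ 0) :
    (stoch M (QR M) : ℝ) = M * (1 + 2 * ∑ k ∈ Icc 1 M, thinAvg M 1 k) := by
  have : NeZero M := ⟨hM⟩
  rw [stoch_eq M _ ⟨0, (mem_QR_iff M hM 0).2 (by simp)⟩]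
  push_cast
  simp only [gapCount_QR, ← mul_sum]
  ring

theorem card_QR_eq_sum (A : ℕ) [NeZero A] : (#(QR A) : ℝ) = ∑ y : ZMod A, sqInd A y := by
  classical
  have h : QR A = ({y : ZMod A | IsSquare y} : Finset (ZMod A)) := by
    ext y; simp [mem_QR_iff A (NeZero.ne A)]
  rw [h, card_filter]
  push_cast
  exact sum_congr rfl fun y _ => by by_cases h : IsSquare y <;> simp [sqInd, h]

/-- The probability that all of the squares among `x + 1, ..., x + k` are removed, when each is
kept independently with probability `d`. -/
noncomputable def thinProd (A : ℕ) (d : ℝ) (x : ZMod A) (k : ℕ) : ℝ :=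
  ∏ i ∈ Icc 1 k, (1 - d * sqInd A (x + (i : ℕ)))

theorem thinAvg_eq (A : ℕ) [NeZero A] (d : ℝ) (k : ℕ) :
    thinAvg A d k = (∑ x : ZMod A, thinProd A d x k) / A := by
  unfold thinAvg thinProd
  rw [← sum_range_natCast A (fun x => ∏ i ∈ Icc 1 k, (1 - d * sqInd A (x + (i : ℕ))))]
  push_cast
  rfl

theorem thinProd_eq_range (A : ℕ) (d : ℝ) (x : ZMod A) (k : ℕ) :
    thinProd A d x k = ∏ i ∈ range k, (1 - d * sqInd A (x + (i : ℕ) + 1)) := by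
  unfold thinProd
  induction k with
  | zero => simp
  | succ k ih =>
    rw [prod_Icc_succ_top (by omega), ih, prod_range_succ]
    push_cast
    rw [add_assoc x]

theorem thinProd_add (A : ℕ) (d : ℝ) (x : ZMod A) (k j : ℕ) :
    thinProd A d x (k + j) = thinProd A d x k * thinProd A d (x + k) j := by
  simp only [thinProd_eq_range]
  rw [prod_range_add]
  congr 1
  refine prod_congr rfl fun i _ => ?_
  push_cast
  ring_nf

theorem thinProd_eq_pow (A : ℕ) (d : ℝ) (x : ZMod A) (k : ℕ) :
    ∃ r : ℕ, thinProd A d x k = (1 - d) ^ r := by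
  classical
  refine ⟨#{i ∈ Icc 1 k | IsSquare (x + ((i : ℕ) : ZMod A))}, ?_⟩
  rw [← prod_const, prod_filter]
  refine prod_congr rfl fun i _ => ?_
  by_cases h : IsSquare (x + (i : ZMod A)) <;> simp [sqInd, h]

theorem thinProd_self (A : ℕ) [NeZero A] (d : ℝ) (x : ZMod A) :
    thinProd A d x A = (1 - d) ^ #(QR A) := by
  classical
  rw [thinProd_eq_range, prod_range_natCast A (fun y => 1 - d * sqInd A (x + y + 1))]
  have h := Equiv.prod_comp ((Equiv.addLeft x).trans (Equiv.addRight 1))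
    (fun y => 1 - d * sqInd A y)
  simp only [Equiv.trans_apply, Equiv.coe_addLeft, Equiv.coe_addRight] at h
  have h2 : QR A = ({y : ZMod A | IsSquare y} : Finset (ZMod A)) := by
    ext y; simp [mem_QR_iff A (NeZero.ne A)]
  rw [h, ← prod_const, h2, prod_filter]
  refine prod_congr rfl fun y _ => ?_
  by_cases h : IsSquare y <;> simp [sqInd, h]

theorem thinAvg_add_self (A : ℕ) [NeZero A] (d : ℝ) (k : ℕ) :
    thinAvg A d (k + A) = (1 - d) ^ #(QR A) * thinAvg A d k := by
  simp only [thinAvg_eq, thinProd_add, thinProd_self, ← sum_mul]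
  ring

theorem thinAvg_self (A : ℕ) [NeZero A] (d : ℝ) :
    thinAvg A d A = (1 - d) ^ #(QR A) := by
  have : (A : ℝ) ≠ 0 := by exact_mod_cast NeZero.ne A
  simp only [thinAvg_eq, thinProd_self]
  simp [ZMod.card, this]

theorem sum_thinAvg_mul (A : ℕ) [NeZero A] (d : ℝ) (n : ℕ) :
    (1 - (1 - d) ^ #(QR A)) * ∑ k ∈ Icc 1 (A * n), thinAvg A d k =
      (1 - ((1 - d) ^ #(QR A)) ^ n) * ∑ k ∈ Icc 1 A, thinAvg A d k := by
  set Q := (1 - d) ^ #(QR A) with hQ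
  have hk : ∀ n k, thinAvg A d (k + A * n) = Q ^ n * thinAvg A d k := by
    intro n
    induction n with
    | zero => simp
    | succ n ih =>
      intro k
      rw [mul_add, mul_one, ← add_assoc, thinAvg_add_self, ih, pow_succ]
      ring
  induction n with
  | zero => simp
  | succ n ih =>
    have h1 : ∑ k ∈ Icc 1 (A * (n + 1)), thinAvg A d k =
        ∑ k ∈ Icc 1 (A * n), thinAvg A d k + Q ^ n * ∑ k ∈ Icc 1 A, thinAvg A d k := by
      have e : ∀ N, Icc 1 N = Ico 1 (N + 1) := fun N => rfl
      rw [e, e, e, mul_sum]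
      have h2 : ∑ k ∈ Ico 1 (A + 1), Q ^ n * thinAvg A d k =
          ∑ k ∈ Ico (A * n + 1) (A * (n + 1) + 1), thinAvg A d k := by
        simp only [← hk]
        rw [sum_Ico_add' (fun k => thinAvg A d k)]
        congr 2 <;> ring
      rw [h2, sum_Ico_consecutive _ (by omega) (by nlinarith)]
    rw [h1, mul_add, ih, pow_succ]
    ring

theorem one_sub_pow_le (d : ℝ) (hd1 : d ≤ 1) (hd0 : 0 ≤ d) (h : ℕ) :
    (1 - d) ^ h ≤ 1 - h * d + h * (h - 1) / 2 * d ^ 2 := by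
  induction h with
  | zero => simp
  | succ h ih =>
    have h1 := mul_le_mul_of_nonneg_right ih (by linarith : 0 ≤ 1 - d)
    have h2 : (0 : ℝ) ≤ h * (h - 1) / 2 := by
      rcases Nat.eq_zero_or_pos h with rfl | h0
      · simp
      · have : (1 : ℝ) ≤ h := by exact_mod_cast h0
        have : (0 : ℝ) ≤ h - 1 := by linarith
        positivity
    rw [pow_succ]
    push_cast
    nlinarith [mul_nonneg h2 (pow_nonneg hd0 3)]

theorem le_one_sub_pow (d : ℝ) (hd1 : d ≤ 1) (hd0 : 0 ≤ d) (h : ℕ) :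
    1 - h * d + h * (h - 1) / 2 * d ^ 2 - h * (h - 1) * (h - 2) / 6 * d ^ 3 ≤ (1 - d) ^ h := by
  induction h with
  | zero => simp
  | succ h ih =>
    have h1 := mul_le_mul_of_nonneg_right ih (by linarith : 0 ≤ 1 - d)
    have h2 : (0 : ℝ) ≤ h * (h - 1) * (h - 2) / 6 := by
      rcases Nat.eq_zero_or_pos h with rfl | h0
      · simp
      · have h1 : (1 : ℝ) ≤ h := by exact_mod_cast h0
        rcases Nat.eq_or_lt_of_le (Nat.succ_le_of_lt h0) with h3 | h3
        · rw [← h3]; simp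
        · have h4 : (2 : ℝ) ≤ h := by exact_mod_cast h3
          have h5 : (0 : ℝ) ≤ h - 1 := by linarith
          have h6 : (0 : ℝ) ≤ h - 2 := by linarith
          positivity
    rw [pow_succ (1 - d) h]
    push_cast
    nlinarith [mul_nonneg h2 (pow_nonneg hd0 4)]

theorem one_sub_mul_le_pow (d : ℝ) (hd1 : d ≤ 1) (h : ℕ) : 1 - h * d ≤ (1 - d) ^ h := by
  have := one_add_mul_le_pow (a := -d) (by linarith) h
  rw [← sub_eq_add_neg] at this
  linarith

theorem pow_add_pow_bounds (d : ℝ) (hd1 : d ≤ 1) (hd0 : 0 ≤ d) (r s : ℕ) :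
    2 - (r + s : ℕ) * d ≤ (1 - d) ^ r + (1 - d) ^ s ∧
      (1 - d) ^ r + (1 - d) ^ s ≤ 2 - (r + s : ℕ) * d + ((r + s : ℕ) * d) ^ 2 := by
  have h1 := one_sub_mul_le_pow d hd1 r
  have h2 := one_sub_mul_le_pow d hd1 s
  have h3 := one_sub_pow_le d hd1 hd0 r
  have h4 := one_sub_pow_le d hd1 hd0 s
  push_cast
  refine ⟨by linarith, ?_⟩
  have hr : (0 : ℝ) ≤ r := Nat.cast_nonneg _
  have hs : (0 : ℝ) ≤ s := Nat.cast_nonneg _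
  have h5 : 0 ≤ d ^ 2 * (r + s + (r * r + s * s) + 4 * r * s : ℝ) := by positivity
  nlinarith

theorem thinAvg_symm_bounds (A : ℕ) [NeZero A] (d : ℝ) (hd1 : d < 1) (hd0 : 0 < d) (k : ℕ)
    (hk : k ≤ A) :
    2 - #(QR A) * d ≤ thinAvg A d k + thinAvg A d (A - k) ∧
      thinAvg A d k + thinAvg A d (A - k) ≤ 2 - #(QR A) * d + (#(QR A) * d) ^ 2 := by
  have hA0 : (0 : ℝ) < A := by exact_mod_cast NeZero.pos A
  have e1 : thinAvg A d (A - k) = (∑ x : ZMod A, thinProd A d (x + k) (A - k)) / A := by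
    rw [thinAvg_eq]
    congr 1
    exact (Equiv.sum_comp (Equiv.addRight (k : ZMod A)) (fun x => thinProd A d x (A - k))).symm
  have e2 : ∀ x : ZMod A,
      2 - #(QR A) * d ≤ thinProd A d x k + thinProd A d (x + k) (A - k) ∧
      thinProd A d x k + thinProd A d (x + k) (A - k) ≤
        2 - #(QR A) * d + (#(QR A) * d) ^ 2 := by
    intro x
    have h1 := thinProd_add A d x k (A - k)
    rw [Nat.add_sub_cancel' hk, thinProd_self] at h1
    obtain ⟨r, hr⟩ := thinProd_eq_pow A d x k
    obtain ⟨s, hs⟩ := thinProd_eq_pow A d (x + k) (A - k)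
    rw [hr, hs, ← pow_add] at h1
    have h2 : #(QR A) = r + s :=
      pow_right_injective₀ (by linarith) (by linarith) h1
    rw [hr, hs, h2]
    exact pow_add_pow_bounds d hd1.le hd0.le r s
  rw [e1, thinAvg_eq, ← add_div, ← sum_add_distrib, le_div_iff₀ hA0, div_le_iff₀ hA0]
  constructor
  · calc _ = ∑ x : ZMod A, (2 - #(QR A) * d) := by simp [ZMod.card]; ring
      _ ≤ _ := sum_le_sum fun x _ => (e2 x).1
  · calc _ ≤ ∑ x : ZMod A, (2 - #(QR A) * d + (#(QR A) * d) ^ 2) :=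
          sum_le_sum fun x _ => (e2 x).2
      _ = _ := by simp [ZMod.card]; ring

theorem abs_two_mul_sum_thinAvg_sub_le (A : ℕ) [NeZero A] (d : ℝ) (hd1 : d < 1) (hd0 : 0 < d) :
    |2 * ∑ k ∈ Icc 1 A, thinAvg A d k - (A * (2 - #(QR A) * d) - #(QR A) * d)| ≤
      (A + 1) * (#(QR A) * d) ^ 2 := by
  have hA : 0 < A := NeZero.pos A
  set y : ℝ := #(QR A) * d with hy
  have e1 : ∑ k ∈ Icc 1 A, thinAvg A d k = ∑ k ∈ Ico 1 A, thinAvg A d k + (1 - d) ^ #(QR A) := by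
    rw [show Icc 1 A = Ico 1 (A + 1) from rfl, sum_Ico_succ_top hA, thinAvg_self]
  have e2 : 2 * ∑ k ∈ Ico 1 A, thinAvg A d k =
      ∑ k ∈ Ico 1 A, (thinAvg A d k + thinAvg A d (A - k)) := by
    rw [sum_add_distrib, two_mul]
    congr 1
    have := sum_Ico_reflect (fun k => thinAvg A d k) 1 (show A ≤ A + 1 by omega)
    rw [Nat.add_sub_cancel_left, Nat.add_sub_cancel] at this
    exact this.symm
  have h1 : ((A : ℝ) - 1) * (2 - y) ≤ 2 * ∑ k ∈ Ico 1 A, thinAvg A d k := by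
    rw [e2]
    calc _ = ∑ k ∈ Ico 1 A, (2 - y) := by
          rw [sum_const, Nat.card_Ico, nsmul_eq_mul, Nat.cast_sub hA, Nat.cast_one]
      _ ≤ _ := sum_le_sum fun k hk =>
          (thinAvg_symm_bounds A d hd1 hd0 k (mem_Ico.1 hk).2.le).1
  have h2 : 2 * ∑ k ∈ Ico 1 A, thinAvg A d k ≤ ((A : ℝ) - 1) * (2 - y + y ^ 2) := by
    rw [e2]
    calc _ ≤ ∑ k ∈ Ico 1 A, (2 - y + y ^ 2) := sum_le_sum fun k hk =>
          (thinAvg_symm_bounds A d hd1 hd0 k (mem_Ico.1 hk).2.le).2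
      _ = _ := by
          rw [sum_const, Nat.card_Ico, nsmul_eq_mul, Nat.cast_sub hA, Nat.cast_one]
  have h3 := one_sub_mul_le_pow d hd1.le #(QR A)
  have h4 := one_sub_pow_le d hd1.le hd0.le #(QR A)
  have h5 : (1 - d) ^ #(QR A) ≤ 1 - y + y ^ 2 / 2 := by
    refine h4.trans ?_
    have h6 : 0 ≤ (#(QR A) : ℝ) * d ^ 2 := by positivity
    rw [hy]
    nlinarith
  rw [e1, mul_add, abs_le]
  rw [← hy] at h3
  constructor <;> nlinarith [sq_nonneg y, mul_nonneg (Nat.cast_nonneg (α := ℝ) A) (sq_nonneg y)]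

theorem abs_model_sub_le (A : ℕ) [NeZero A] (d : ℝ) (hd1 : d < 1) (hd0 : 0 < d)
    (hd : #(QR A) * d ≤ 1 / 2) :
    |1 + 2 * (∑ k ∈ Icc 1 A, thinAvg A d k) / (1 - (1 - d) ^ #(QR A)) -
      A / #(QR A) * (2 / d - 1)| ≤ 5 * A * (#(QR A) * d) ∧
    3 / 4 * (#(QR A) * d) ≤ 1 - (1 - d) ^ #(QR A) := by
  have hA : (1 : ℝ) ≤ A := by exact_mod_cast NeZero.pos A
  have hh : (1 : ℝ) ≤ #(QR A) := by
    have : 0 < #(QR A) := card_pos.2 ⟨0, (mem_QR_iff A (NeZero.ne A) 0).2 (by simp)⟩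
    exact_mod_cast this
  have h1 := abs_le.1 (abs_two_mul_sum_thinAvg_sub_le A d hd1 hd0)
  have h2 := one_sub_mul_le_pow d hd1.le #(QR A)
  have h3 := one_sub_pow_le d hd1.le hd0.le #(QR A)
  have h4 := le_one_sub_pow d hd1.le hd0.le #(QR A)
  generalize (#(QR A) : ℝ) = h at *
  generalize (1 - d) ^ #(QR A) = Q at *
  generalize 2 * ∑ k ∈ Icc 1 A, thinAvg A d k = W at *
  generalize (A : ℝ) = a at *
  obtain ⟨D, rfl⟩ : ∃ D, Q = 1 - D := ⟨1 - Q, by ring⟩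
  rw [sub_sub_cancel]
  obtain ⟨y, hy⟩ : ∃ y, y = h * d := ⟨_, rfl⟩
  have hy0 : 0 < y := by rw [hy]; positivity
  have hD1 : D ≤ y := by rw [hy]; linarith
  have hD2 : y - y ^ 2 / 2 ≤ D := by
    have : 0 ≤ h * d ^ 2 := by positivity
    rw [hy]; nlinarith
  have hD3 : 3 / 4 * y ≤ D := by rw [← hy] at hd; nlinarith
  have hD0 : 0 < D := by linarith
  rw [← hy] at hd h1 ⊢
  refine ⟨?_, hD3⟩
  have hmain : |(2 - y) * y - (2 - d) * D| ≤ 5 / 6 * y ^ 3 := by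
    have hyd : d ≤ y := by rw [hy]; nlinarith
    have k0 : 0 ≤ h * (h - 1) / 2 * d ^ 3 :=
      mul_nonneg (div_nonneg (mul_nonneg (by linarith) (by linarith)) (by norm_num)) (by positivity)
    have k1 : h * (h - 1) / 2 * d ^ 3 ≤ y ^ 3 / 2 := by
      rw [hy, mul_pow]
      have : h * (h - 1) ≤ h ^ 3 := by nlinarith [sq_nonneg (h - 1)]
      have := mul_le_mul_of_nonneg_right this (by positivity : 0 ≤ d ^ 3)
      linarith
    have k2 : h * (h - 1) * (h - 2) / 6 * d ^ 3 ≤ y ^ 3 / 6 := by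
      rw [hy, mul_pow]
      have : h * (h - 1) * (h - 2) ≤ h ^ 3 := by nlinarith [sq_nonneg (h - 1)]
      have := mul_le_mul_of_nonneg_right this (by positivity : 0 ≤ d ^ 3)
      linarith
    obtain ⟨θ, hθ⟩ : ∃ θ, D = y - h * (h - 1) / 2 * d ^ 2 + θ :=
      ⟨D - (y - h * (h - 1) / 2 * d ^ 2), by ring⟩
    have k3 : 0 ≤ θ := by rw [hy] at hθ; linarith
    have k4 : θ ≤ y ^ 3 / 6 := by
      have : θ ≤ h * (h - 1) * (h - 2) / 6 * d ^ 3 := by rw [hy] at hθ; linarith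
      linarith
    have k5 : (2 - y) * y - (2 - d) * D = -(h * (h - 1) / 2 * d ^ 3) - (2 - d) * θ := by
      rw [hθ, hy]; ring
    rw [k5, abs_le]
    have k6 : (2 - d) * θ ≤ 2 * θ := by nlinarith
    have k7 : 0 ≤ (2 - d) * θ := mul_nonneg (by linarith) k3
    have k8 : 0 ≤ y ^ 3 := by positivity
    constructor <;> linarith
  have key : 1 + W / D - a / h * (2 / d - 1) =
      (W - (a * (2 - y) - y)) / D + (D - y) / D + a * ((2 - y) * y - (2 - d) * D) / (D * y) := by
    rw [show a / h * (2 / d - 1) = a * (2 - d) / y by rw [hy]; field_simp]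
    field_simp
    ring
  rw [key]
  have b1 : |(W - (a * (2 - y) - y)) / D| ≤ 4 / 3 * (a + 1) * y := by
    rw [abs_div, abs_of_pos hD0, div_le_iff₀ hD0]
    refine (abs_le.2 h1).trans ?_
    have := mul_le_mul_of_nonneg_left hD3 (by positivity : 0 ≤ 4 / 3 * (a + 1) * y)
    nlinarith
  have b2 : |(D - y) / D| ≤ 2 / 3 * y := by
    rw [abs_div, abs_of_pos hD0, div_le_iff₀ hD0, abs_le]
    constructor <;> nlinarith
  have b3 : |a * ((2 - y) * y - (2 - d) * D) / (D * y)| ≤ 10 / 9 * a * y := by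
    rw [abs_div, abs_of_pos (mul_pos hD0 hy0), div_le_iff₀ (mul_pos hD0 hy0), abs_mul,
      abs_of_pos (by linarith : 0 < a)]
    calc _ ≤ a * (5 / 6 * y ^ 3) := by gcongr
      _ = 10 / 9 * a * y * (3 / 4 * y * y) := by ring
      _ ≤ _ := by gcongr
  have := abs_add_three ((W - (a * (2 - y) - y)) / D) ((D - y) / D)
    (a * ((2 - y) * y - (2 - d) * D) / (D * y))
  nlinarith

/-- The model sum, truncated at a multiple of the period. -/
theorem abs_model_truncated_sub_le (A : ℕ) [NeZero A] (d : ℝ) (hd1 : d < 1) (hd0 : 0 < d)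
    (hd : #(QR A) * d ≤ 1 / 2) (n : ℕ) :
    |1 + 2 * ∑ k ∈ Icc 1 (A * n), thinAvg A d k - A / #(QR A) * (2 / d - 1)| ≤
      5 * A * (#(QR A) * d) + 3 * A * (1 - d) ^ n / d := by
  obtain ⟨h1, h2⟩ := abs_model_sub_le A d hd1 hd0 hd
  have h3 := sum_thinAvg_mul A d n
  have hA : (1 : ℝ) ≤ A := by exact_mod_cast NeZero.pos A
  have hpos : 0 < #(QR A) := card_pos.2 ⟨0, (mem_QR_iff A (NeZero.ne A) 0).2 (by simp)⟩
  have hh : (1 : ℝ) ≤ #(QR A) := by exact_mod_cast hpos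
  have hQ : ((1 - d) ^ #(QR A)) ^ n ≤ (1 - d) ^ n := by
    refine pow_le_pow_left₀ (pow_nonneg (by linarith) _) ?_ n
    exact pow_le_of_le_one (by linarith) (by linarith) hpos.ne'
  have hQ0 : 0 ≤ ((1 - d) ^ #(QR A)) ^ n := pow_nonneg (pow_nonneg (by linarith) _) _
  have hW0 : 0 ≤ ∑ k ∈ Icc 1 A, thinAvg A d k :=
    sum_nonneg fun k _ => thinAvg_nonneg A d k hd0.le hd1.le
  have hW1 : ∑ k ∈ Icc 1 A, thinAvg A d k ≤ A := by
    calc _ ≤ ∑ k ∈ Icc 1 A, (1 : ℝ) := sum_le_sum fun k _ => thinAvg_le_one A d k hd0.le hd1.le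
      _ = A := by simp
  have hdh : d ≤ #(QR A) * d := by nlinarith
  set D := 1 - (1 - d) ^ #(QR A) with hD
  set W := ∑ k ∈ Icc 1 A, thinAvg A d k
  have hD0 : 0 < D := by nlinarith
  have e : ∑ k ∈ Icc 1 (A * n), thinAvg A d k = W / D - ((1 - d) ^ #(QR A)) ^ n * W / D := by
    field_simp
    linarith
  have h4 : ((1 - d) ^ #(QR A)) ^ n * W / D ≤ 4 / 3 * (A * (1 - d) ^ n / d) := by
    rw [div_le_iff₀ hD0]
    calc _ ≤ (1 - d) ^ n * A := by gcongr
      _ = 4 / 3 * (A * (1 - d) ^ n / d) * (3 / 4 * d) := by field_simp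
      _ ≤ _ := by
          have : 0 ≤ (1 - d) ^ n := pow_nonneg (by linarith) n
          gcongr
          linarith
  have h5 : 0 ≤ ((1 - d) ^ #(QR A)) ^ n * W / D := by positivity
  have h6 : 3 * A * (1 - d) ^ n / d = 3 * (A * (1 - d) ^ n / d) := by ring
  rw [e, h6]
  rw [mul_div_assoc] at h1
  have h7 := abs_le.1 h1
  rw [abs_le]
  constructor <;> linarith

theorem card_le_of_pairwise_modEq (n H : ℕ) (S : Finset ℕ) (hS : S ⊆ range H)
    (hmod : ∀ x ∈ S, ∀ y ∈ S, x ≡ y [MOD n]) : (#S : ℝ) ≤ H / n + 1 := by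
  have h : #S ≤ H / n + 1 := by
    rw [← card_range (H / n + 1)]
    refine card_le_card_of_injOn (fun x => x / n) (fun x hx => ?_) fun x hx y hy hxy => ?_
    · have := mem_range.1 (hS hx)
      rw [mem_coe, mem_range, Nat.lt_succ_iff]
      exact Nat.div_le_div_right this.le
    · have h1 := hmod x hx y hy
      simp only at hxy
      rw [← Nat.div_add_mod x n, ← Nat.div_add_mod y n, hxy, h1]
  calc (#S : ℝ) ≤ ((H / n : ℕ) : ℝ) + 1 := by exact_mod_cast h
    _ ≤ _ := by gcongr; exact Nat.cast_div_le

/-- The congruence conditions attached to the three ways of pairing four indices. -/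
def PairedMod (f₁ f₂ f₃ : ℕ) (b : ℕ × ℕ × ℕ × ℕ) : Prop :=
  (b.1 ≡ b.2.1 [MOD f₁] ∧ b.2.2.1 ≡ b.2.2.2 [MOD f₁]) ∧
  (b.1 ≡ b.2.2.1 [MOD f₂] ∧ b.2.1 ≡ b.2.2.2 [MOD f₂]) ∧
  (b.1 ≡ b.2.2.2 [MOD f₃] ∧ b.2.1 ≡ b.2.2.1 [MOD f₃])

instance (f₁ f₂ f₃ : ℕ) : DecidablePred (PairedMod f₁ f₂ f₃) := fun b => by
  unfold PairedMod; infer_instance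

/-- The cube `[0, H)^4`. -/
def cube (H : ℕ) : Finset (ℕ × ℕ × ℕ × ℕ) := range H ×ˢ range H ×ˢ range H ×ˢ range H

theorem card_filter_cube_le (f₁ f₂ f₃ H : ℕ) (h12 : f₁.Coprime f₂) (h13 : f₁.Coprime f₃)
    (h23 : f₂.Coprime f₃) :
    (#{b ∈ cube H | PairedMod f₁ f₂ f₃ b} : ℝ) ≤
      H * ((H / f₁ + 1) * ((H / (f₂ * f₃ : ℕ) + 1) * (H / (f₁ * f₂ * f₃ : ℕ) + 1))) := by
  have e0 : (#{b ∈ cube H | PairedMod f₁ f₂ f₃ b} : ℝ) ≤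
      ∑ b₀ ∈ range H, ∑ b₁ ∈ range H with b₀ ≡ b₁ [MOD f₁],
        ∑ b₂ ∈ range H with b₀ ≡ b₂ [MOD f₂] ∧ b₁ ≡ b₂ [MOD f₃],
          ∑ b₃ ∈ range H with b₂ ≡ b₃ [MOD f₁] ∧ b₁ ≡ b₃ [MOD f₂] ∧ b₀ ≡ b₃ [MOD f₃], (1 : ℝ) := by
    rw [card_filter]
    push_cast
    simp only [cube, sum_product, sum_filter]
    refine le_of_eq (sum_congr rfl fun b₀ _ => sum_congr rfl fun b₁ _ => ?_)
    unfold PairedMod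
    split_ifs with h1
    · refine sum_congr rfl fun b₂ _ => ?_
      split_ifs with h2
      · refine sum_congr rfl fun b₃ _ => ?_
        simp only at *
        congr 1
        apply propext
        tauto
      · refine sum_eq_zero fun b₃ _ => if_neg ?_
        simp only at *
        tauto
    · refine sum_eq_zero fun b₂ _ => sum_eq_zero fun b₃ _ => if_neg ?_
      simp only at *
      tauto
  refine e0.trans ?_
  have p1 : ∀ b₀, (#{b₁ ∈ range H | b₀ ≡ b₁ [MOD f₁]} : ℝ) ≤ H / f₁ + 1 := fun b₀ =>
    card_le_of_pairwise_modEq _ _ _ (filter_subset _ _) fun x hx y hy =>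
      (mem_filter.1 hx).2.symm.trans (mem_filter.1 hy).2
  have p2 : ∀ b₀ b₁, (#{b₂ ∈ range H | b₀ ≡ b₂ [MOD f₂] ∧ b₁ ≡ b₂ [MOD f₃]} : ℝ) ≤
      H / (f₂ * f₃ : ℕ) + 1 := fun b₀ b₁ =>
    card_le_of_pairwise_modEq _ _ _ (filter_subset _ _) fun x hx y hy =>
      (Nat.modEq_and_modEq_iff_modEq_mul h23).1
        ⟨(mem_filter.1 hx).2.1.symm.trans (mem_filter.1 hy).2.1,
          (mem_filter.1 hx).2.2.symm.trans (mem_filter.1 hy).2.2⟩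
  have p3 : ∀ b₀ b₁ b₂, (#{b₃ ∈ range H | b₂ ≡ b₃ [MOD f₁] ∧ b₁ ≡ b₃ [MOD f₂] ∧
      b₀ ≡ b₃ [MOD f₃]} : ℝ) ≤ H / (f₁ * f₂ * f₃ : ℕ) + 1 := fun b₀ b₁ b₂ =>
    card_le_of_pairwise_modEq _ _ _ (filter_subset _ _) fun x hx y hy =>
      (Nat.modEq_and_modEq_iff_modEq_mul (Nat.Coprime.mul_left h13 h23)).1
        ⟨(Nat.modEq_and_modEq_iff_modEq_mul h12).1
          ⟨(mem_filter.1 hx).2.1.symm.trans (mem_filter.1 hy).2.1,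
          (mem_filter.1 hx).2.2.1.symm.trans (mem_filter.1 hy).2.2.1⟩,
          (mem_filter.1 hx).2.2.2.symm.trans (mem_filter.1 hy).2.2.2⟩
  have bound : ∀ (S : Finset ℕ) (g : ℕ → ℝ) (u v : ℝ), (#S : ℝ) ≤ u → 0 ≤ v →
      (∀ x, g x ≤ v) → ∑ x ∈ S, g x ≤ u * v := by
    intro S g u v hS hv hg
    calc _ ≤ ∑ x ∈ S, v := sum_le_sum fun x _ => hg x
      _ = #S * v := by simp
      _ ≤ _ := by gcongr
  refine bound _ _ _ _ (by simp) (by positivity) fun b₀ => ?_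
  refine bound _ _ _ _ (p1 b₀) (by positivity) fun b₁ => ?_
  refine bound _ _ _ _ (p2 b₀ b₁) (by positivity) fun b₂ => ?_
  rw [sum_const, nsmul_eq_mul, mul_one]
  exact p3 b₀ b₁ b₂

theorem card_filter_cube_le_of_pos (f₁ f₂ f₃ H : ℕ) (hf₁ : 0 < f₁) (hf₂ : 0 < f₂) (hf₃ : 0 < f₃)
    (hH : 0 < H) (h12 : f₁.Coprime f₂) (h13 : f₁.Coprime f₃) (h23 : f₂.Coprime f₃) :
    (#{b ∈ cube H | PairedMod f₁ f₂ f₃ b} : ℝ) ≤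
      8 * ((H : ℝ) ^ 2 + (H : ℝ) ^ 4 / √(f₁ * f₂ * f₃ : ℕ)) := by
  refine (card_filter_cube_le f₁ f₂ f₃ H h12 h13 h23).trans ?_
  have hH1 : (1 : ℝ) ≤ H := by exact_mod_cast hH
  obtain ⟨u, hu⟩ : ∃ u : ℝ, u = 1 / f₁ := ⟨_, rfl⟩
  obtain ⟨v, hv⟩ : ∃ v : ℝ, v = 1 / (f₂ * f₃ : ℕ) := ⟨_, rfl⟩
  have hu1 : (1 : ℝ) ≤ f₁ := by exact_mod_cast hf₁
  have hv1 : (1 : ℝ) ≤ (f₂ * f₃ : ℕ) := by exact_mod_cast Nat.mul_pos hf₂ hf₃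
  have hu0 : 0 < u := by rw [hu]; positivity
  have hv0 : 0 < v := by rw [hv]; positivity
  have hu2 : u ≤ 1 := by rw [hu, div_le_one (by linarith)]; exact hu1
  have hv2 : v ≤ 1 := by rw [hv, div_le_one (by linarith)]; exact hv1
  have e1 : (H : ℝ) / f₁ = H * u := by rw [hu]; ring
  have e2 : (H : ℝ) / (f₂ * f₃ : ℕ) = H * v := by rw [hv]; ring
  have e3 : (H : ℝ) / (f₁ * f₂ * f₃ : ℕ) = H * (u * v) := by
    rw [hu, hv]; push_cast; field_simp
  set w := 1 / √((f₁ * f₂ * f₃ : ℕ) : ℝ) with hw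
  have hw0 : 0 ≤ w := by positivity
  have hwuv : w ^ 2 = u * v := by
    rw [hw, div_pow, one_pow, Real.sq_sqrt (by positivity), hu, hv]
    push_cast; field_simp
  have hw1 : w ≤ 1 := by nlinarith
  have e4 : (H : ℝ) ^ 4 / √((f₁ * f₂ * f₃ : ℕ) : ℝ) = H ^ 4 * w := by rw [hw]; ring
  rw [e1, e2, e3, e4, ← hwuv]
  generalize (H : ℝ) = h at *
  have hww : w ^ 2 ≤ w := by nlinarith
  have h12 : h ≤ h ^ 2 := by nlinarith
  have h34 : h ^ 3 ≤ h ^ 4 := by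
    have : 0 ≤ h ^ 3 * (h - 1) := mul_nonneg (by positivity) (by linarith)
    nlinarith
  have hexp : h * ((h * u + 1) * ((h * v + 1) * (h * w ^ 2 + 1))) =
      h ^ 4 * (u * v) * w ^ 2 + h ^ 3 * u * w ^ 2 + h ^ 3 * v * w ^ 2 + h ^ 2 * w ^ 2 +
        h ^ 3 * (u * v) + h ^ 2 * u + h ^ 2 * v + h := by ring
  rw [hexp, ← hwuv]
  have q0 : 0 ≤ h := by linarith
  have q1 : h ^ 4 * w ^ 2 * w ^ 2 ≤ h ^ 4 * w * 1 := by
    have : w ^ 2 ≤ 1 := by linarith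
    gcongr
  have q2 : h ^ 3 * u * w ^ 2 ≤ h ^ 4 * 1 * w := by gcongr
  have q3 : h ^ 3 * v * w ^ 2 ≤ h ^ 4 * 1 * w := by gcongr
  have q4 : h ^ 2 * w ^ 2 ≤ h ^ 2 * 1 := by
    have : w ^ 2 ≤ 1 := by linarith
    gcongr
  have q5 : h ^ 3 * w ^ 2 ≤ h ^ 4 * w := by gcongr
  have q6 : h ^ 2 * u ≤ h ^ 2 * 1 := by gcongr
  have q7 : h ^ 2 * v ≤ h ^ 2 * 1 := by gcongr
  have q8 : 0 ≤ h ^ 4 * w := by positivity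
  have q9 : 0 ≤ h ^ 2 := by positivity
  linarith

open Classical in
/-- A bound for the normalised correlation of `psi p` along four shifts. -/
noncomputable def pairWeight (p : ℕ) (b : ℕ × ℕ × ℕ × ℕ) : ℝ :=
  76 / √p + ((if PairedMod p 1 1 b then 1 else 0) + (if PairedMod 1 p 1 b then 1 else 0) +
    (if PairedMod 1 1 p b then 1 else 0))

theorem pairedMod_mul_fst (f₁ f₂ f₃ p : ℕ) (h : f₁.Coprime p) (b : ℕ × ℕ × ℕ × ℕ) :
    PairedMod (f₁ * p) f₂ f₃ b ↔ PairedMod f₁ f₂ f₃ b ∧ PairedMod p 1 1 b := by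
  simp only [PairedMod, Nat.modEq_one, ← Nat.modEq_and_modEq_iff_modEq_mul h]
  tauto

theorem pairedMod_mul_snd (f₁ f₂ f₃ p : ℕ) (h : f₂.Coprime p) (b : ℕ × ℕ × ℕ × ℕ) :
    PairedMod f₁ (f₂ * p) f₃ b ↔ PairedMod f₁ f₂ f₃ b ∧ PairedMod 1 p 1 b := by
  simp only [PairedMod, Nat.modEq_one, ← Nat.modEq_and_modEq_iff_modEq_mul h]
  tauto

theorem pairedMod_mul_thd (f₁ f₂ f₃ p : ℕ) (h : f₃.Coprime p) (b : ℕ × ℕ × ℕ × ℕ) :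
    PairedMod f₁ f₂ (f₃ * p) b ↔ PairedMod f₁ f₂ f₃ b ∧ PairedMod 1 1 p b := by
  simp only [PairedMod, Nat.modEq_one, ← Nat.modEq_and_modEq_iff_modEq_mul h]
  tauto

theorem sum_prod_pairWeight_le (E : Finset ℕ) (hE : ∀ p ∈ E, p.Prime) (H : ℕ) (hH : 0 < H)
    (f₁ f₂ f₃ : ℕ) (hf₁ : 0 < f₁) (hf₂ : 0 < f₂) (hf₃ : 0 < f₃)
    (h12 : f₁.Coprime f₂) (h13 : f₁.Coprime f₃) (h23 : f₂.Coprime f₃)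
    (hc₁ : ∀ p ∈ E, f₁.Coprime p) (hc₂ : ∀ p ∈ E, f₂.Coprime p) (hc₃ : ∀ p ∈ E, f₃.Coprime p) :
    ∑ b ∈ cube H with PairedMod f₁ f₂ f₃ b, ∏ p ∈ E, pairWeight p b ≤
      79 ^ #E * (8 * ((H : ℝ) ^ 2 + (H : ℝ) ^ 4 / √((∏ p ∈ E, p) * (f₁ * f₂ * f₃) : ℕ))) := by
  induction E using Finset.induction_on generalizing f₁ f₂ f₃ with
  | empty =>
    simpa using card_filter_cube_le_of_pos f₁ f₂ f₃ H hf₁ hf₂ hf₃ hH h12 h13 h23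
  | insert p s hps ih =>
    have hp := hE p (mem_insert_self _ _)
    have hs : ∀ q ∈ s, q.Prime := fun q hq => hE q (mem_insert_of_mem hq)
    have hpq : ∀ q ∈ s, p.Coprime q := fun q hq =>
      (Nat.coprime_primes hp (hs q hq)).2 (by rintro rfl; exact hps hq)
    have c₁ : ∀ q ∈ s, f₁.Coprime q := fun q hq => hc₁ q (mem_insert_of_mem hq)
    have c₂ : ∀ q ∈ s, f₂.Coprime q := fun q hq => hc₂ q (mem_insert_of_mem hq)
    have c₃ : ∀ q ∈ s, f₃.Coprime q := fun q hq => hc₃ q (mem_insert_of_mem hq)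
    have d₁ := hc₁ p (mem_insert_self _ _)
    have d₂ := hc₂ p (mem_insert_self _ _)
    have d₃ := hc₃ p (mem_insert_self _ _)
    have i0 := ih hs f₁ f₂ f₃ hf₁ hf₂ hf₃ h12 h13 h23 c₁ c₂ c₃
    have i1 := ih hs (f₁ * p) f₂ f₃ (Nat.mul_pos hf₁ hp.pos) hf₂ hf₃
      (h12.mul_left d₂.symm) (h13.mul_left d₃.symm) h23
      (fun q hq => (c₁ q hq).mul_left (hpq q hq)) c₂ c₃
    have i2 := ih hs f₁ (f₂ * p) f₃ hf₁ (Nat.mul_pos hf₂ hp.pos) hf₃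
      (h12.mul_right d₁) h13 (h23.mul_left d₃.symm)
      c₁ (fun q hq => (c₂ q hq).mul_left (hpq q hq)) c₃
    have i3 := ih hs f₁ f₂ (f₃ * p) hf₁ hf₂ (Nat.mul_pos hf₃ hp.pos)
      h12 (h13.mul_right d₁) (h23.mul_right d₂)
      c₁ c₂ (fun q hq => (c₃ q hq).mul_left (hpq q hq))
    rw [show (∏ q ∈ s, q) * (f₁ * p * f₂ * f₃) = p * (∏ q ∈ s, q) * (f₁ * f₂ * f₃) by ring] at i1
    rw [show (∏ q ∈ s, q) * (f₁ * (f₂ * p) * f₃) = p * (∏ q ∈ s, q) * (f₁ * f₂ * f₃) by ring] at i2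
    rw [show (∏ q ∈ s, q) * (f₁ * f₂ * (f₃ * p)) = p * (∏ q ∈ s, q) * (f₁ * f₂ * f₃) by ring] at i3
    have split : ∑ b ∈ cube H with PairedMod f₁ f₂ f₃ b, ∏ q ∈ insert p s, pairWeight q b =
        76 / √p * ∑ b ∈ cube H with PairedMod f₁ f₂ f₃ b, ∏ q ∈ s, pairWeight q b +
        (∑ b ∈ cube H with PairedMod (f₁ * p) f₂ f₃ b, ∏ q ∈ s, pairWeight q b +
        ∑ b ∈ cube H with PairedMod f₁ (f₂ * p) f₃ b, ∏ q ∈ s, pairWeight q b +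
        ∑ b ∈ cube H with PairedMod f₁ f₂ (f₃ * p) b, ∏ q ∈ s, pairWeight q b) := by
      simp only [pairedMod_mul_fst _ _ _ _ d₁, pairedMod_mul_snd _ _ _ _ d₂,
        pairedMod_mul_thd _ _ _ _ d₃, ← filter_filter]
      rw [sum_filter (fun b => PairedMod p 1 1 b), sum_filter (fun b => PairedMod 1 p 1 b),
        sum_filter (fun b => PairedMod 1 1 p b), mul_sum, ← sum_add_distrib, ← sum_add_distrib,
        ← sum_add_distrib]
      refine sum_congr rfl fun b _ => ?_
      rw [prod_insert hps]
      nth_rewrite 1 [pairWeight]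
      split_ifs <;> ring
    rw [split, prod_insert hps, card_insert_of_notMem hps]
    have hp0 : (0 : ℝ) < √p := Real.sqrt_pos.2 (by exact_mod_cast hp.pos)
    have hp1 : 1 ≤ √(p : ℝ) := Real.one_le_sqrt.2 (by exact_mod_cast hp.one_le)
    have hsq : √((p * (∏ q ∈ s, q) * (f₁ * f₂ * f₃) : ℕ) : ℝ) =
        √p * √((∏ q ∈ s, q) * (f₁ * f₂ * f₃) : ℕ) := by
      rw [← Real.sqrt_mul (by positivity), ← Nat.cast_mul, mul_assoc]
    rw [hsq] at i1 i2 i3 ⊢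
    have hr0 : 0 < √(((∏ q ∈ s, q) * (f₁ * f₂ * f₃) : ℕ) : ℝ) := by
      refine Real.sqrt_pos.2 (Nat.cast_pos.2 (Nat.mul_pos (prod_pos fun q hq => (hs q hq).pos) ?_))
      positivity
    have j0 : 76 / √(p : ℝ) * ∑ b ∈ cube H with PairedMod f₁ f₂ f₃ b, ∏ q ∈ s, pairWeight q b ≤
        76 * (79 ^ #s * (8 * ((H : ℝ) ^ 2 +
          (H : ℝ) ^ 4 / (√p * √((∏ q ∈ s, q) * (f₁ * f₂ * f₃) : ℕ))))) := by
      refine (mul_le_mul_of_nonneg_left i0 (by positivity)).trans ?_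
      rw [div_mul_eq_mul_div, div_le_iff₀ hp0]
      calc _ = 76 * (79 ^ #s * (8 * ((H : ℝ) ^ 2 * 1 +
          (H : ℝ) ^ 4 / √((∏ q ∈ s, q) * (f₁ * f₂ * f₃) : ℕ)))) := by rw [mul_one]
        _ ≤ 76 * (79 ^ #s * (8 * ((H : ℝ) ^ 2 * √p +
          (H : ℝ) ^ 4 / √((∏ q ∈ s, q) * (f₁ * f₂ * f₃) : ℕ)))) := by gcongr
        _ = _ := by field_simp
    refine (add_le_add j0 (add_le_add (add_le_add i1 i2) i3)).trans (le_of_eq ?_)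
    rw [pow_succ]
    ring

theorem sum_range_mul_of_periodic (a b : ℕ) [NeZero a] [NeZero b] (hab : a.Coprime b)
    (f g : ℕ → ℝ) (hf : Function.Periodic f a) (hg : Function.Periodic g b) :
    ∑ x ∈ range (a * b), f x * g x = (∑ x ∈ range a, f x) * ∑ x ∈ range b, g x := by
  have hf' : ∀ x : ℕ, f (ZMod.val (x : ZMod a)) = f x := fun x => by
    rw [ZMod.val_natCast, hf.map_mod_nat]
  have hg' : ∀ x : ℕ, g (ZMod.val (x : ZMod b)) = g x := fun x => by
    rw [ZMod.val_natCast, hg.map_mod_nat]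
  have h := sum_range_mul_eq_sum_sum a b hab (fun u v => f u.val * g v.val)
  have h1 := sum_range_natCast a (fun u => f u.val)
  have h2 := sum_range_natCast b (fun u => g u.val)
  simp only [hf', hg'] at h h1 h2
  rw [h, h1, h2, sum_mul_sum]

theorem sum_range_prod_of_periodic (E : Finset ℕ) (hE : ∀ p ∈ E, p.Prime) (g : ℕ → ℕ → ℝ)
    (hg : ∀ p, Function.Periodic (g p) p) :
    ∑ z ∈ range (∏ p ∈ E, p), ∏ p ∈ E, g p z = ∏ p ∈ E, ∑ y ∈ range p, g p y := by
  induction E using Finset.induction_on with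
  | empty => simp
  | insert p s hps ih =>
    have hp := hE p (mem_insert_self _ _)
    have hs : ∀ q ∈ s, q.Prime := fun q hq => hE q (mem_insert_of_mem hq)
    have : NeZero p := ⟨hp.ne_zero⟩
    have : NeZero (∏ q ∈ s, q) := ⟨prod_ne_zero_iff.2 fun q hq => (hs q hq).ne_zero⟩
    simp only [prod_insert hps]
    rw [sum_range_mul_of_periodic p _ _ (g p) (fun z => ∏ q ∈ s, g q z) (hg p), ih hs]
    · intro z
      refine prod_congr rfl fun q hq => ?_
      have := (hg q).nat_mul ((∏ r ∈ s, r) / q) z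
      rwa [Nat.cast_id, Nat.div_mul_cancel (dvd_prod_of_mem _ hq)] at this
    · exact Nat.Coprime.prod_right fun q hq =>
        (Nat.coprime_primes hp (hs q hq)).2 (by rintro rfl; exact hps hq)

/-- The product over `p ∈ E` of the normalised indicator functions of squares. -/
noncomputable def psiProd (E : Finset ℕ) (n : ℕ) : ℝ := ∏ p ∈ E, psi p (n : ZMod p)

theorem abs_sum_psi_four_le (p : ℕ) (hp : p.Prime) (hp2 : p ≠ 2) (A : ℕ) (hA : A.Coprime p)
    (b : ℕ × ℕ × ℕ × ℕ) :
    |∑ y ∈ range p, psi p ((y + A * b.1 : ℕ) : ZMod p) * psi p ((y + A * b.2.1 : ℕ) : ZMod p) *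
      psi p ((y + A * b.2.2.1 : ℕ) : ZMod p) * psi p ((y + A * b.2.2.2 : ℕ) : ZMod p)| ≤
      p * pairWeight p b := by
  have : Fact p.Prime := ⟨hp⟩
  have hp0 : (0 : ℝ) < p := by exact_mod_cast hp.pos
  have hs0 : 0 < √(p : ℝ) := Real.sqrt_pos.2 hp0
  set c : Fin 4 → ZMod p := ![A * b.1, A * b.2.1, A * b.2.2.1, A * b.2.2.2] with hc
  have e : ∑ y ∈ range p, psi p ((y + A * b.1 : ℕ) : ZMod p) *
      psi p ((y + A * b.2.1 : ℕ) : ZMod p) *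
      psi p ((y + A * b.2.2.1 : ℕ) : ZMod p) * psi p ((y + A * b.2.2.2 : ℕ) : ZMod p) =
      ∑ y : ZMod p, ∏ j, psi p (y + c j) := by
    rw [← sum_range_natCast p (fun y => ∏ j, psi p (y + c j))]
    refine sum_congr rfl fun y _ => ?_
    rw [Fin.prod_univ_four]
    simp [hc]
  have hcast : ∀ x y : ℕ, (A : ZMod p) * x = A * y ↔ x ≡ y [MOD p] := by
    intro x y
    rw [← Nat.cast_mul, ← Nat.cast_mul, ZMod.natCast_eq_natCast_iff]
    exact ⟨Nat.ModEq.cancel_left_of_coprime hA.symm, fun h => h.mul_left A⟩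
  rw [e]
  unfold pairWeight
  have hs : 0 ≤ 76 / √(p : ℝ) := by positivity
  by_cases h : PairedMod p 1 1 b ∨ PairedMod 1 p 1 b ∨ PairedMod 1 1 p b
  · refine (abs_sum_prod_psi_le p c).trans (le_mul_of_one_le_right hp0.le ?_)
    have : ∀ P : Prop, ∀ [Decidable P], (0 : ℝ) ≤ if P then 1 else 0 := by
      intro P _; split_ifs <;> norm_num
    rcases h with h | h | h
    · rw [if_pos h]; linarith [this (PairedMod 1 p 1 b), this (PairedMod 1 1 p b)]
    · rw [if_pos h]; linarith [this (PairedMod p 1 1 b), this (PairedMod 1 1 p b)]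
    · rw [if_pos h]; linarith [this (PairedMod p 1 1 b), this (PairedMod 1 p 1 b)]
  · push Not at h
    obtain ⟨h1, h2, h3⟩ := h
    rw [if_neg h1, if_neg h2, if_neg h3]
    simp only [PairedMod, Nat.modEq_one, and_true, true_and] at h1 h2 h3
    refine (abs_sum_prod_psi_le_of_not_paired p hp2 c ?_ ?_ ?_).trans (le_of_eq ?_)
    · rintro ⟨a1, a2⟩
      exact h1 ⟨(hcast _ _).1 a1, (hcast _ _).1 a2⟩
    · rintro ⟨a1, a2⟩
      exact h2 ⟨(hcast _ _).1 a1, (hcast _ _).1 a2⟩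
    · rintro ⟨a1, a2⟩
      exact h3 ⟨(hcast _ _).1 a1, (hcast _ _).1 a2⟩
    · have := Real.mul_self_sqrt hp0.le
      field_simp
      nlinarith

theorem sum_cube_eq_pow (H : ℕ) (f : ℕ → ℝ) :
    (∑ b ∈ range H, f b) ^ 4 = ∑ b ∈ cube H, f b.1 * f b.2.1 * f b.2.2.1 * f b.2.2.2 := by
  unfold cube
  simp only [sum_product, ← mul_sum, ← sum_mul]
  ring

/-- The fourth moment bound for short sums of `psiProd E` along a progression. -/
theorem sum_pow_four_le (E : Finset ℕ) (A : ℕ) (hE : ∀ p ∈ E, p.Prime ∧ p ≠ 2 ∧ A.Coprime p)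
    (H : ℕ) (hH : 0 < H) :
    ∑ z ∈ range (∏ p ∈ E, p), (∑ b ∈ range H, psiProd E (z + A * b)) ^ 4 ≤
      (∏ p ∈ E, p : ℕ) *
        (79 ^ #E * (8 * ((H : ℝ) ^ 2 + (H : ℝ) ^ 4 / √(∏ p ∈ E, p : ℕ)))) := by
  have hpr : ∀ p ∈ E, p.Prime := fun p hp => (hE p hp).1
  have key := sum_prod_pairWeight_le E hpr H hH 1 1 1
    one_pos one_pos one_pos (by simp) (by simp) (by simp) (by simp) (by simp) (by simp)
  have hfilter : (cube H).filter (PairedMod 1 1 1) = cube H := by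
    refine filter_true_of_mem fun b _ => ?_
    simp [PairedMod, Nat.modEq_one]
  rw [hfilter, mul_one, mul_one, mul_one] at key
  refine le_trans ?_ (mul_le_mul_of_nonneg_left key (Nat.cast_nonneg _))
  simp only [sum_cube_eq_pow]
  rw [sum_comm, mul_sum]
  refine sum_le_sum fun b _ => ?_
  simp only [psiProd, ← prod_mul_distrib]
  rw [sum_range_prod_of_periodic E hpr (fun p z => psi p ((z + A * b.1 : ℕ) : ZMod p) *
      psi p ((z + A * b.2.1 : ℕ) : ZMod p) *
      psi p ((z + A * b.2.2.1 : ℕ) : ZMod p) * psi p ((z + A * b.2.2.2 : ℕ) : ZMod p))]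
  · refine (le_abs_self _).trans ?_
    rw [abs_prod, Nat.cast_prod, ← prod_mul_distrib]
    exact prod_le_prod (fun _ _ => abs_nonneg _) fun p hp =>
      abs_sum_psi_four_le p (hE p hp).1 (hE p hp).2.1 A (hE p hp).2.2 b
  · intro p z
    simp

theorem abs_psiProd_le_one (E : Finset ℕ) (hE : ∀ p ∈ E, p.Prime) (n : ℕ) :
    |psiProd E n| ≤ 1 := by
  unfold psiProd
  rw [abs_prod]
  refine prod_le_one (fun _ _ => abs_nonneg _) fun p hp => ?_
  have : Fact p.Prime := ⟨hE p hp⟩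
  exact abs_psi_le_one p _

theorem psiProd_congr (E : Finset ℕ) (m n : ℕ) (h : m ≡ n [MOD ∏ p ∈ E, p]) :
    psiProd E m = psiProd E n := by
  unfold psiProd
  refine prod_congr rfl fun p hp => ?_
  rw [(ZMod.natCast_eq_natCast_iff _ _ _).2 (h.of_dvd (dvd_prod_of_mem _ hp))]

theorem psi_sq_mul (p : ℕ) [Fact p.Prime] (s y : ZMod p) (hs : s ≠ 0) :
    psi p (s ^ 2 * y) = psi p y := by
  have : IsSquare (s ^ 2 * y) ↔ IsSquare y := by
    constructor
    · rintro ⟨r, hr⟩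
      refine ⟨s⁻¹ * r, ?_⟩
      field_simp
      linear_combination hr
    · rintro ⟨r, rfl⟩
      exact ⟨s * r, by ring⟩
  by_cases h : IsSquare y <;> simp [psi, sqInd, this, h]

theorem psiProd_sq_mul (E : Finset ℕ) (hE : ∀ p ∈ E, p.Prime) (s n : ℕ)
    (hs : ∀ p ∈ E, s.Coprime p) : psiProd E (s ^ 2 * n) = psiProd E n := by
  unfold psiProd
  refine prod_congr rfl fun p hp => ?_
  have : Fact p.Prime := ⟨hE p hp⟩
  push_cast
  refine psi_sq_mul p _ _ ?_
  rw [Ne, ZMod.natCast_eq_zero_iff]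
  exact (hE p hp).coprime_iff_not_dvd.1 (hs p hp).symm

theorem abs_sum_sub_sum_shift_le (f : ℕ → ℝ) (hf : ∀ n, |f n| ≤ 1) (k r : ℕ) :
    |∑ t ∈ range k, f t - ∑ t ∈ range k, f (t + r)| ≤ 2 * r := by
  have h1 := sum_range_add f k r
  have h2 := sum_range_add f r k
  rw [add_comm r k] at h2
  have h3 : ∑ t ∈ range k, f (t + r) = ∑ t ∈ range k, f (r + t) := by simp only [add_comm]
  have h4 : ∀ g : ℕ → ℝ, (∀ n, |g n| ≤ 1) → |∑ t ∈ range r, g t| ≤ r := fun g hg =>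
    (abs_sum_le_sum_abs _ _).trans
      ((sum_le_sum fun t _ => hg t).trans (by simp))
  have h5 := abs_le.1 (h4 f hf)
  have h6 := abs_le.1 (h4 (fun t => f (k + t)) fun n => hf _)
  rw [h3, abs_le]
  constructor <;> linarith

theorem sum_abs_pow_four_le {ι : Type*} [DecidableEq ι] (I : Finset ι) (e : ℕ) (w : ι → ℕ)
    (hw : ∀ i ∈ I, w i ∈ range e) (F : ℕ → ℝ) :
    (∑ i ∈ I, |F (w i)|) ^ 4 ≤
      (#I : ℝ) ^ 2 * #{ij ∈ I ×ˢ I | w ij.1 = w ij.2} * ∑ z ∈ range e, F z ^ 4 := by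
  have h1 : (∑ i ∈ I, |F (w i)|) ^ 2 ≤ #I * ∑ i ∈ I, F (w i) ^ 2 := by
    simpa [sq_abs] using sq_sum_le_card_mul_sum_sq (s := I) (f := fun i => |F (w i)|)
  have h2 : ∑ i ∈ I, F (w i) ^ 2 = ∑ z ∈ range e, (#{i ∈ I | w i = z} : ℝ) * F z ^ 2 := by
    rw [← sum_fiberwise_of_maps_to hw]
    refine sum_congr rfl fun z _ => ?_
    rw [← nsmul_eq_mul, ← sum_const]
    exact sum_congr rfl fun i hi => by rw [(mem_filter.1 hi).2]
  have h3 : (∑ z ∈ range e, (#{i ∈ I | w i = z} : ℝ) * F z ^ 2) ^ 2 ≤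
      (∑ z ∈ range e, (#{i ∈ I | w i = z} : ℝ) ^ 2) * ∑ z ∈ range e, (F z ^ 2) ^ 2 :=
    sum_mul_sq_le_sq_mul_sq _ _ _
  have h4 : ∑ z ∈ range e, (#{i ∈ I | w i = z} : ℝ) ^ 2 = #{ij ∈ I ×ˢ I | w ij.1 = w ij.2} := by
    have hmap : ∀ ij ∈ {ij ∈ I ×ˢ I | w ij.1 = w ij.2}, w ij.1 ∈ range e := fun ij hij =>
      hw _ (mem_product.1 (mem_filter.1 hij).1).1
    rw [card_eq_sum_card_fiberwise hmap]
    push_cast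
    refine sum_congr rfl fun z _ => ?_
    rw [sq, ← Nat.cast_mul, ← card_product]
    congr 2
    ext ⟨i, j⟩
    simp only [mem_product, mem_filter]
    constructor
    · rintro ⟨⟨a, rfl⟩, b, h⟩
      exact ⟨⟨⟨a, b⟩, h.symm⟩, rfl⟩
    · rintro ⟨⟨⟨a, b⟩, h⟩, rfl⟩
      exact ⟨⟨a, rfl⟩, b, h.symm⟩
  have h5 : ∑ z ∈ range e, (F z ^ 2) ^ 2 = ∑ z ∈ range e, F z ^ 4 :=
    sum_congr rfl fun z _ => by ring
  rw [h4, h5, ← h2] at h3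
  calc (∑ i ∈ I, |F (w i)|) ^ 4 = ((∑ i ∈ I, |F (w i)|) ^ 2) ^ 2 := by ring
    _ ≤ (#I * ∑ i ∈ I, F (w i) ^ 2) ^ 2 := by gcongr
    _ = (#I : ℝ) ^ 2 * (∑ i ∈ I, F (w i) ^ 2) ^ 2 := by ring
    _ ≤ (#I : ℝ) ^ 2 * (#{ij ∈ I ×ˢ I | w ij.1 = w ij.2} * ∑ z ∈ range e, F z ^ 4) := by gcongr
    _ = _ := by ring

/-- Pairs `(t, u)` in a box for which `(x + A t) r²` and `(x + A u) s²` agree modulo `e`, when the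
modulus is large enough to force equalities of integers. -/
theorem card_collisions_le (S k e A x s r : ℕ) (hs : s ∈ Ioc (S ^ 2) (S ^ 2 + S))
    (hr : r ∈ Ioc (S ^ 2) (S ^ 2 + S)) (hsr : s ≠ r) (hA : A.Coprime e) (hS : 0 < S)
    (hke : 8 * S ^ 4 * k < e) :
    (#{tt ∈ range k ×ˢ range k | (x + A * tt.1) * r ^ 2 ≡ (x + A * tt.2) * s ^ 2 [MOD e]} : ℝ) ≤
      k / S ^ 2 + 1 := by
  rw [mem_Ioc] at hs hr
  set C := {tt ∈ range k ×ˢ range k | (x + A * tt.1) * r ^ 2 ≡ (x + A * tt.2) * s ^ 2 [MOD e]}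
    with hC
  have hSS : S ≤ S ^ 2 := Nat.le_self_pow (by norm_num) S
  have hs2 : s ^ 2 ≤ 4 * S ^ 4 := by
    calc s ^ 2 ≤ (2 * S ^ 2) ^ 2 := Nat.pow_le_pow_left (by omega) 2
      _ = 4 * S ^ 4 := by ring
  have hr2 : r ^ 2 ≤ 4 * S ^ 4 := by
    calc r ^ 2 ≤ (2 * S ^ 2) ^ 2 := Nat.pow_le_pow_left (by omega) 2
      _ = 4 * S ^ 4 := by ring
  have key : ∀ a ∈ C, ∀ b ∈ C, a.1 * r ^ 2 + b.2 * s ^ 2 = b.1 * r ^ 2 + a.2 * s ^ 2 := by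
    intro a ha b hb
    rw [hC, mem_filter, mem_product, mem_range, mem_range] at ha hb
    have h1 : A * (a.1 * r ^ 2 + b.2 * s ^ 2) ≡ A * (b.1 * r ^ 2 + a.2 * s ^ 2) [MOD e] := by
      have h2 := ha.2.add hb.2.symm
      have h3 : (x + A * a.1) * r ^ 2 + (x + A * b.2) * s ^ 2 =
          A * (a.1 * r ^ 2 + b.2 * s ^ 2) + x * (r ^ 2 + s ^ 2) := by ring
      have h4 : (x + A * a.2) * s ^ 2 + (x + A * b.1) * r ^ 2 =
          A * (b.1 * r ^ 2 + a.2 * s ^ 2) + x * (r ^ 2 + s ^ 2) := by ring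
      rw [h3, h4] at h2
      exact Nat.ModEq.add_right_cancel' _ h2
    have h5 := Nat.ModEq.cancel_left_of_coprime hA.symm h1
    have hb' : ∀ u v : ℕ, u < k → v < k → u * r ^ 2 + v * s ^ 2 < e := by
      intro u v hu hv
      have := Nat.mul_le_mul hu.le hr2
      have := Nat.mul_le_mul hv.le hs2
      nlinarith
    exact Nat.ModEq.eq_of_lt_of_lt h5 (hb' _ _ ha.1.1 hb.1.2) (hb' _ _ hb.1.1 ha.1.2)
  have hs0 : 0 < s := by omega
  set g := Nat.gcd s r with hg
  have hg0 : 0 < g := Nat.gcd_pos_of_pos_left _ hs0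
  obtain ⟨s', hs'⟩ := Nat.gcd_dvd_left s r
  obtain ⟨r', hr'⟩ := Nat.gcd_dvd_right s r
  rw [← hg] at hs' hr'
  have hcop : Nat.Coprime s' r' := by
    have h := Nat.coprime_div_gcd_div_gcd (m := s) (n := r) hg0
    rwa [← hg, Nat.div_eq_of_eq_mul_right hg0 hs', Nat.div_eq_of_eq_mul_right hg0 hr'] at h
  have hgS : g < S := by
    rcases lt_or_gt_of_ne hsr with h | h
    · have : g ∣ r - s := Nat.dvd_sub (Nat.gcd_dvd_right s r) (Nat.gcd_dvd_left s r)
      have := Nat.le_of_dvd (by omega) this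
      omega
    · have : g ∣ s - r := Nat.dvd_sub (Nat.gcd_dvd_left s r) (Nat.gcd_dvd_right s r)
      have := Nat.le_of_dvd (by omega) this
      omega
  have hs'S : S ≤ s' := by
    by_contra! h
    have : g * s' ≤ S * S := Nat.mul_le_mul hgS.le h.le
    rw [← hs'] at this
    nlinarith
  have hcard : #C = #(C.image Prod.fst) := by
    refine (card_image_of_injOn fun a ha b hb hab => ?_).symm
    have h := key a ha b hb
    rw [hab] at h
    have h2 : b.2 * s ^ 2 = a.2 * s ^ 2 := by omega
    have h3 := Nat.eq_of_mul_eq_mul_right (by positivity) h2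
    exact Prod.ext hab h3.symm
  have hsub : C.image Prod.fst ⊆ range k := by
    intro t ht
    obtain ⟨a, ha, rfl⟩ := mem_image.1 ht
    exact (mem_product.1 (mem_filter.1 ha).1).1
  rw [hcard]
  refine (card_le_of_pairwise_modEq (s' ^ 2) k _ hsub ?_).trans ?_
  · intro t ht t' ht'
    obtain ⟨a, ha, rfl⟩ := mem_image.1 ht
    obtain ⟨b, hb, rfl⟩ := mem_image.1 ht'
    have h := key a ha b hb
    have h1 : a.1 * r' ^ 2 + b.2 * s' ^ 2 = b.1 * r' ^ 2 + a.2 * s' ^ 2 := by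
      rw [hs', hr'] at h
      refine Nat.eq_of_mul_eq_mul_right (pow_pos hg0 2) ?_
      calc _ = a.1 * (g * r') ^ 2 + b.2 * (g * s') ^ 2 := by ring
        _ = _ := h
        _ = _ := by ring
    have h2 : a.1 * r' ^ 2 ≡ b.1 * r' ^ 2 [MOD s' ^ 2] := by
      have h3 : a.1 * r' ^ 2 + b.2 * s' ^ 2 ≡ a.1 * r' ^ 2 [MOD s' ^ 2] := by
        simp [Nat.ModEq]
      have h4 : b.1 * r' ^ 2 + a.2 * s' ^ 2 ≡ b.1 * r' ^ 2 [MOD s' ^ 2] := by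
        simp [Nat.ModEq]
      exact h3.symm.trans (h1 ▸ h4)
    exact Nat.ModEq.cancel_right_of_coprime (hcop.pow 2 2) h2
  · have : (S : ℝ) ≤ s' := by exact_mod_cast hs'S
    have hS' : (0 : ℝ) < S := by exact_mod_cast hS
    push_cast
    gcongr

theorem card_all_collisions_le (S k e A x : ℕ) (hA : A.Coprime e) (hS : 0 < S) (hSk : S ≤ k)
    (hke : 8 * S ^ 4 * k < e) (hcop : ∀ s ∈ Ioc (S ^ 2) (S ^ 2 + S), s.Coprime e)
    (w : ℕ × ℕ → ℕ)
    (hw : ∀ i ∈ Ioc (S ^ 2) (S ^ 2 + S) ×ˢ range k, i.1 ^ 2 * w i ≡ x + A * i.2 [MOD e]) :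
    (#{ij ∈ (Ioc (S ^ 2) (S ^ 2 + S) ×ˢ range k) ×ˢ (Ioc (S ^ 2) (S ^ 2 + S) ×ˢ range k) |
      w ij.1 = w ij.2} : ℝ) ≤ 3 * S * k := by
  set J := Ioc (S ^ 2) (S ^ 2 + S) with hJ
  have hJc : #J = S := by simp [hJ]
  have hS' : (0 : ℝ) < S := by exact_mod_cast hS
  have hke' : k ≤ e := by
    have : 1 ≤ S ^ 4 := Nat.one_le_pow _ _ hS
    nlinarith
  have h1 : #{ij ∈ (J ×ˢ range k) ×ˢ (J ×ˢ range k) | w ij.1 = w ij.2} ≤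
      ∑ sr ∈ J ×ˢ J, #{tt ∈ range k ×ˢ range k |
        (x + A * tt.1) * sr.2 ^ 2 ≡ (x + A * tt.2) * sr.1 ^ 2 [MOD e]} := by
    rw [← card_sigma]
    refine card_le_card_of_injOn (fun ij => ⟨(ij.1.1, ij.2.1), (ij.1.2, ij.2.2)⟩) ?_ ?_
    · intro ij hij
      simp only [mem_coe, mem_filter, mem_product] at hij
      simp only [coe_sigma, Set.mem_sigma_iff, mem_coe, mem_product, mem_filter]
      obtain ⟨⟨⟨a1, a2⟩, a3, a4⟩, a5⟩ := hij
      refine ⟨⟨a1, a3⟩, ⟨a2, a4⟩, ?_⟩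
      have b1 := (hw ij.1 (mem_product.2 ⟨a1, a2⟩)).mul_right (ij.2.1 ^ 2)
      have b2 := (hw ij.2 (mem_product.2 ⟨a3, a4⟩)).mul_right (ij.1.1 ^ 2)
      refine b1.symm.trans (Nat.ModEq.trans ?_ b2)
      rw [a5]
      have : ij.1.1 ^ 2 * w ij.2 * ij.2.1 ^ 2 = ij.2.1 ^ 2 * w ij.2 * ij.1.1 ^ 2 := by ring
      rw [this]
    · rintro ⟨⟨s, t⟩, s', t'⟩ _ ⟨⟨r, u⟩, r', u'⟩ _ h
      simp only [Sigma.mk.injEq, Prod.mk.injEq, heq_eq_eq] at h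
      simp [h]
  have h2 : ∀ sr ∈ J ×ˢ J, (#{tt ∈ range k ×ˢ range k |
      (x + A * tt.1) * sr.2 ^ 2 ≡ (x + A * tt.2) * sr.1 ^ 2 [MOD e]} : ℝ) ≤
      (if sr.1 = sr.2 then (k : ℝ) else 0) + (k / S ^ 2 + 1) := by
    intro sr hsr
    obtain ⟨hs, hr⟩ := mem_product.1 hsr
    split_ifs with h
    · refine le_add_of_le_of_nonneg ?_ (by positivity)
      rw [h]
      have hc2 : Nat.Coprime e (sr.2 ^ 2) := ((hcop _ hr).pow_left 2).symm
      have : #{tt ∈ range k ×ˢ range k |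
          (x + A * tt.1) * sr.2 ^ 2 ≡ (x + A * tt.2) * sr.2 ^ 2 [MOD e]} ≤ #(range k) := by
        refine card_le_card_of_injOn Prod.fst ?_ ?_
        · intro a ha
          exact (mem_product.1 (mem_filter.1 ha).1).1
        · intro a ha b hb hab
          have fin : ∀ c ∈ {tt ∈ range k ×ˢ range k |
              (x + A * tt.1) * sr.2 ^ 2 ≡ (x + A * tt.2) * sr.2 ^ 2 [MOD e]}, c.1 = c.2 := by
            intro c hc
            rw [mem_filter, mem_product, mem_range, mem_range] at hc
            have d1 := Nat.ModEq.cancel_right_of_coprime hc2 hc.2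
            have d2 := Nat.ModEq.add_left_cancel' _ d1
            have d3 := Nat.ModEq.cancel_left_of_coprime hA.symm d2
            exact Nat.ModEq.eq_of_lt_of_lt d3 (by omega) (by omega)
          exact Prod.ext hab (by rw [← fin a ha, ← fin b hb]; exact hab)
      rw [card_range] at this
      exact_mod_cast this
    · rw [zero_add]
      exact card_collisions_le S k e A x sr.1 sr.2 hs hr h hA hS hke
  have h3 : (#{ij ∈ (J ×ˢ range k) ×ˢ (J ×ˢ range k) | w ij.1 = w ij.2} : ℝ) ≤
      ∑ sr ∈ J ×ˢ J, ((if sr.1 = sr.2 then (k : ℝ) else 0) + (k / S ^ 2 + 1)) := by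
    refine (Nat.cast_le (α := ℝ).2 h1).trans ?_
    push_cast
    exact sum_le_sum h2
  refine h3.trans ?_
  rw [sum_add_distrib, sum_product]
  simp only [sum_ite_eq, sum_const, card_product, hJc]
  rw [sum_ite_of_true (fun _ h => h), sum_const, hJc, nsmul_eq_mul, nsmul_eq_mul]
  have hk : (S : ℝ) ≤ k := by exact_mod_cast hSk
  have hS1 : (1 : ℝ) ≤ S := by exact_mod_cast hS
  push_cast
  have : (S : ℝ) * S * (k / S ^ 2 + 1) = k + S * S := by field_simp
  rw [this]
  nlinarith

/-- Burgess amplification: a short sum of `psiProd E` along an arithmetic progression is controlled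
by the complete fourth moment of shorter sums. -/
theorem exists_abs_sum_psiProd_le (E : Finset ℕ) (A S k H x : ℕ)
    (hE : ∀ p ∈ E, p.Prime ∧ A.Coprime p ∧ 2 * S ^ 2 < p)
    (hS : 0 < S) (hSk : S ≤ k) (hH : 0 < H) (hke : 8 * S ^ 4 * k < ∏ p ∈ E, p) :
    ∃ X : ℝ, 0 ≤ X ∧
      |∑ t ∈ range k, psiProd E (x + A * t)| ≤ 8 * S ^ 4 * H + X / (S * H) ∧
      X ^ 4 ≤ 3 * S ^ 3 * k ^ 3 *
        ∑ z ∈ range (∏ p ∈ E, p), (∑ b ∈ range H, psiProd E (z + A * b)) ^ 4 := by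
  set e := ∏ p ∈ E, p with he
  have he0 : 0 < e := by omega
  have hAe : A.Coprime e := Nat.Coprime.prod_right fun p hp => (hE p hp).2.1
  have hSS : S ≤ S ^ 2 := Nat.le_self_pow (by norm_num) S
  have hcopp : ∀ s ∈ Ioc (S ^ 2) (S ^ 2 + S), ∀ p ∈ E, s.Coprime p := by
    intro s hs p hp
    rw [mem_Ioc] at hs
    refine ((hE p hp).1.coprime_iff_not_dvd.2 fun h => ?_).symm
    have := Nat.le_of_dvd (by omega) h
    have := (hE p hp).2.2
    omega
  have hcop : ∀ s ∈ Ioc (S ^ 2) (S ^ 2 + S), s.Coprime e := fun s hs =>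
    Nat.Coprime.prod_right (hcopp s hs)
  set J := Ioc (S ^ 2) (S ^ 2 + S) with hJ
  have hJc : #J = S := by simp [hJ]
  have hex : ∀ i : ℕ × ℕ, ∃ w : ℕ, w < e ∧ (i ∈ J ×ˢ range k → i.1 ^ 2 * w ≡ x + A * i.2 [MOD e]) := by
    intro i
    by_cases hi : i ∈ J ×ˢ range k
    · obtain ⟨v, hv⟩ := Nat.exists_mul_mod_eq_of_coprime (x + A * i.2)
        ((hcop _ (mem_product.1 hi).1).pow_left 2) he0.ne'
      exact ⟨v, hv.1, fun _ => hv.2⟩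
    · exact ⟨0, he0, fun h => absurd h hi⟩
  choose w hwe hw using hex
  set F : ℕ → ℝ := fun z => ∑ b ∈ range H, psiProd E (z + A * b) with hF
  refine ⟨∑ i ∈ J ×ˢ range k, |F (w i)|, sum_nonneg fun _ _ => abs_nonneg _, ?_, ?_⟩
  · set Y := ∑ t ∈ range k, psiProd E (x + A * t) with hY
    have h1 : ∀ s ∈ J, ∀ b ∈ range H,
        |Y - ∑ t ∈ range k, psiProd E (w (s, t) + A * b)| ≤ 8 * S ^ 4 * H := by
      intro s hs b hb
      have h2 := abs_sum_sub_sum_shift_le (fun t => psiProd E (x + A * t))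
        (fun n => abs_psiProd_le_one E (fun p hp => (hE p hp).1) _) k (s ^ 2 * b)
      have h3 : ∑ t ∈ range k, psiProd E (x + A * (t + s ^ 2 * b)) =
          ∑ t ∈ range k, psiProd E (w (s, t) + A * b) := by
        refine sum_congr rfl fun t ht => ?_
        rw [← psiProd_sq_mul E (fun p hp => (hE p hp).1) s (w (s, t) + A * b) (hcopp s hs)]
        refine psiProd_congr E _ _ ?_
        have h4 := (hw (s, t) (mem_product.2 ⟨hs, ht⟩)).add_right (s ^ 2 * (A * b))
        rw [← mul_add] at h4
        refine Nat.ModEq.trans ?_ h4.symm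
        have : x + A * (t + s ^ 2 * b) = x + A * t + s ^ 2 * (A * b) := by ring
        rw [this]
      rw [h3] at h2
      refine h2.trans ?_
      rw [hJ, mem_Ioc] at hs
      have h5 : s ^ 2 ≤ 4 * S ^ 4 := by
        calc s ^ 2 ≤ (2 * S ^ 2) ^ 2 := Nat.pow_le_pow_left (by omega) 2
          _ = 4 * S ^ 4 := by ring
      have h6 : 2 * (s ^ 2 * b) ≤ 8 * S ^ 4 * H := by
        have := Nat.mul_le_mul h5 (mem_range.1 hb).le
        linarith
      exact_mod_cast h6
    have h7 : ∑ s ∈ J, ∑ b ∈ range H, ∑ t ∈ range k, psiProd E (w (s, t) + A * b) =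
        ∑ i ∈ J ×ˢ range k, F (w i) := by
      rw [sum_product]
      exact sum_congr rfl fun s _ => sum_comm
    have h8 : |∑ s ∈ J, ∑ b ∈ range H, (Y - ∑ t ∈ range k, psiProd E (w (s, t) + A * b))| ≤
        S * (H * (8 * S ^ 4 * H)) := by
      refine (abs_sum_le_sum_abs _ _).trans ?_
      refine (sum_le_sum fun s hs => (abs_sum_le_sum_abs _ _).trans
        (sum_le_sum fun b hb => h1 s hs b hb)).trans ?_
      simp [hJc]
    simp only [sum_sub_distrib, sum_const, card_range, hJc, nsmul_eq_mul] at h8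
    rw [h7] at h8
    have h9 : |∑ i ∈ J ×ˢ range k, F (w i)| ≤ ∑ i ∈ J ×ˢ range k, |F (w i)| :=
      abs_sum_le_sum_abs _ _
    have hS' : (0 : ℝ) < S := by exact_mod_cast hS
    have hH' : (0 : ℝ) < H := by exact_mod_cast hH
    have h10 : S * H * |Y| ≤ S * H * (8 * S ^ 4 * H) + ∑ i ∈ J ×ˢ range k, |F (w i)| := by
      rw [← abs_of_pos (mul_pos hS' hH'), ← abs_mul, abs_of_pos (mul_pos hS' hH')]
      have := abs_sub_abs_le_abs_sub (S * (H * Y)) (∑ i ∈ J ×ˢ range k, F (w i))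
      rw [mul_assoc] at *
      linarith
    have h11 : 8 * S ^ 4 * H + (∑ i ∈ J ×ˢ range k, |F (w i)|) / (S * H) =
        (S * H * (8 * S ^ 4 * H) + ∑ i ∈ J ×ˢ range k, |F (w i)|) / (S * H) := by
      field_simp
    rw [h11, le_div_iff₀ (by positivity)]
    linarith
  · have h1 := sum_abs_pow_four_le (J ×ˢ range k) e w (fun i _ => mem_range.2 (hwe i)) F
    have h2 := card_all_collisions_le S k e A x hAe hS hSk hke hcop w hw
    refine h1.trans ?_
    rw [card_product, hJc, card_range]
    push_cast
    have h3 : (0 : ℝ) ≤ ∑ z ∈ range e, F z ^ 4 := sum_nonneg fun z _ => by positivity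
    calc _ ≤ ((S : ℝ) * k) ^ 2 * (3 * S * k) * ∑ z ∈ range e, F z ^ 4 := by gcongr
      _ = _ := by ring

theorem abs_sum_psiProd_le_of_large_modulus (E : Finset ℕ) (A L k x : ℕ)
    (hE : ∀ p ∈ E, p.Prime ∧ p ≠ 2 ∧ A.Coprime p ∧ 2 * L ^ 60 < p)
    (hL : 200000 ≤ L) (hEL : 2 ^ #E ≤ L) (hk : L ^ 260 ≤ k)
    (hke : 8 * L ^ 120 * k < ∏ p ∈ E, p) (hek : ∏ p ∈ E, p ≤ L ^ 34 * k ^ 2) :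
    |∑ t ∈ range k, psiProd E (x + A * t)| ≤ k / (4 * L) := by
  have hL0 : 0 < L := by omega
  have hLR : (200000 : ℝ) ≤ L := by exact_mod_cast hL
  have hLR0 : (0 : ℝ) < L := by linarith
  have hkR : (L : ℝ) ^ 260 ≤ k := by exact_mod_cast hk
  have hkR0 : (0 : ℝ) < k := lt_of_lt_of_le (by positivity) hkR
  set h : ℝ := k / (64 * L ^ 121) with hh
  have h1 : 1 ≤ h := by
    rw [hh, le_div_iff₀ (by positivity), one_mul]
    refine le_trans ?_ hkR
    have : (64 : ℝ) ≤ L ^ 139 := (by linarith : (64 : ℝ) ≤ L).trans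
      (le_self_pow₀ (by linarith) (by norm_num))
    calc (64 : ℝ) * L ^ 121 ≤ (L : ℝ) ^ 139 * L ^ 121 := by gcongr
      _ = (L : ℝ) ^ 260 := by ring
  set H := ⌊h⌋₊ with hH
  have hH1 : 1 ≤ H := Nat.le_floor (by exact_mod_cast h1)
  have hHle : (H : ℝ) ≤ h := Nat.floor_le (by linarith)
  have hHge : h / 2 ≤ H := by
    have := Nat.lt_floor_add_one h
    have : (1 : ℝ) ≤ H := by exact_mod_cast hH1
    linarith
  have hH0 : (0 : ℝ) < H := by exact_mod_cast hH1
  obtain ⟨X, hX0, hY, hX⟩ := exists_abs_sum_psiProd_le E A (L ^ 30) k H x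
    (fun p hp => ⟨(hE p hp).1, (hE p hp).2.2.1, by
      have := (hE p hp).2.2.2
      rwa [← pow_mul]⟩)
    (by positivity) ((Nat.pow_le_pow_right hL0 (by norm_num)).trans hk) hH1
    (by rwa [← pow_mul])
  have hF := sum_pow_four_le E A (fun p hp => ⟨(hE p hp).1, (hE p hp).2.1, (hE p hp).2.2.1⟩) H hH1
  set e := ∏ p ∈ E, p with he
  have he0 : 0 < e := by omega
  have heR0 : (0 : ℝ) < e := by exact_mod_cast he0
  have hekR : (e : ℝ) ≤ L ^ 34 * k ^ 2 := by exact_mod_cast hek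
  have hsqrt : √(e : ℝ) ≤ L ^ 17 * k := by
    rw [Real.sqrt_le_left (by positivity)]
    linarith [hekR, (by ring : ((L : ℝ) ^ 17 * k) ^ 2 = L ^ 34 * k ^ 2)]
  have hD : (79 : ℝ) ^ #E ≤ L ^ 7 := by
    calc (79 : ℝ) ^ #E ≤ 128 ^ #E := by gcongr; norm_num
      _ = (2 ^ #E) ^ 7 := by rw [← pow_mul, mul_comm, pow_mul]; norm_num
      _ ≤ L ^ 7 := by gcongr; exact_mod_cast hEL
  have hse : 0 < √(e : ℝ) := Real.sqrt_pos.2 heR0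
  have hHk : (k : ℝ) ≤ 128 * L ^ 121 * H := by
    have : h / 2 = k / (128 * L ^ 121) := by rw [hh]; field_simp; norm_num
    rw [this, div_le_iff₀ (by positivity)] at hHge
    linarith
  have heH : (e : ℝ) * H ^ 2 ≤ 16384 * L ^ 276 * H ^ 4 := by
    calc (e : ℝ) * H ^ 2 ≤ (L : ℝ) ^ 34 * k ^ 2 * H ^ 2 := by gcongr
      _ ≤ (L : ℝ) ^ 34 * (128 * L ^ 121 * H) ^ 2 * H ^ 2 := by gcongr
      _ = _ := by ring
  have hX4 : X ^ 4 ≤ 24 * L ^ 97 * k ^ 3 * (16384 * L ^ 276 * H ^ 4 + L ^ 17 * k * H ^ 4) := by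
    refine hX.trans ?_
    have e1 : (e : ℝ) * ((H : ℝ) ^ 2 + (H : ℝ) ^ 4 / √(e : ℝ)) = e * H ^ 2 + √e * H ^ 4 := by
      rw [mul_add]
      congr 1
      nth_rewrite 1 [← Real.mul_self_sqrt heR0.le]
      field_simp
    calc 3 * ((L ^ 30 : ℕ) : ℝ) ^ 3 * k ^ 3 *
          ∑ z ∈ range e, (∑ b ∈ range H, psiProd E (z + A * b)) ^ 4
        ≤ 3 * ((L ^ 30 : ℕ) : ℝ) ^ 3 * k ^ 3 *
          (e * (79 ^ #E * (8 * ((H : ℝ) ^ 2 + (H : ℝ) ^ 4 / √(e : ℝ))))) := by gcongr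
      _ = 24 * (L : ℝ) ^ 90 * k ^ 3 * 79 ^ #E * (e * ((H : ℝ) ^ 2 + (H : ℝ) ^ 4 / √(e : ℝ))) := by
        push_cast; ring
      _ = 24 * (L : ℝ) ^ 90 * k ^ 3 * 79 ^ #E * (e * H ^ 2 + √e * H ^ 4) := by rw [e1]
      _ ≤ 24 * (L : ℝ) ^ 90 * k ^ 3 * L ^ 7 * (16384 * L ^ 276 * H ^ 4 + L ^ 17 * k * H ^ 4) := by
        gcongr
      _ = _ := by ring
  have hXle : X ≤ L ^ 29 * H * k / 8 := by
    refine le_of_pow_le_pow_left₀ (n := 4) (by norm_num) (by positivity) (hX4.trans ?_)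
    have a1 : 16384 * (L : ℝ) ^ 276 ≤ L ^ 18 * k := by
      calc 16384 * (L : ℝ) ^ 276 ≤ (L : ℝ) ^ 2 * L ^ 276 := by gcongr; nlinarith
        _ = (L : ℝ) ^ 18 * L ^ 260 := by ring
        _ ≤ _ := by gcongr
    have a2 : (L : ℝ) ^ 17 * k ≤ L ^ 18 * k / 2000 := by
      have : (L : ℝ) ^ 18 = L * L ^ 17 := by ring
      rw [this]
      have : 0 ≤ (L : ℝ) ^ 17 * k := by positivity
      nlinarith
    calc 24 * (L : ℝ) ^ 97 * k ^ 3 * (16384 * L ^ 276 * H ^ 4 + L ^ 17 * k * H ^ 4)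
        ≤ 24 * (L : ℝ) ^ 97 * k ^ 3 * (L ^ 18 * k * H ^ 4 + L ^ 18 * k / 2000 * H ^ 4) := by gcongr
      _ ≤ 48 * ((L : ℝ) ^ 115 * k ^ 4 * H ^ 4) := by
        have : 0 ≤ (L : ℝ) ^ 115 * k ^ 4 * H ^ 4 := by positivity
        nlinarith
      _ ≤ L / 4096 * ((L : ℝ) ^ 115 * k ^ 4 * H ^ 4) := by
        gcongr
        linarith
      _ = _ := by ring
  have hfin : X / (((L ^ 30 : ℕ) : ℝ) * H) ≤ k / (8 * L) := by
    rw [div_le_div_iff₀ (by positivity) (by positivity)]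
    calc X * (8 * L) ≤ L ^ 29 * H * k / 8 * (8 * L) := by gcongr
      _ = _ := by push_cast; ring
  have hfin2 : 8 * ((L ^ 30 : ℕ) : ℝ) ^ 4 * H ≤ k / (8 * L) := by
    calc 8 * ((L ^ 30 : ℕ) : ℝ) ^ 4 * H ≤ 8 * ((L ^ 30 : ℕ) : ℝ) ^ 4 * h := by gcongr
      _ = _ := by rw [hh]; push_cast; field_simp; norm_num
  refine hY.trans ((add_le_add hfin2 hfin).trans (le_of_eq ?_))
  field_simp
  norm_num

theorem abs_sum_range_le_of_blocks (f : ℕ → ℝ) (hf : ∀ n, |f n| ≤ 1) (l : ℕ) (B : ℝ)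
    (hB : ∀ j, |∑ t ∈ range l, f (j + t)| ≤ B) (k : ℕ) :
    |∑ t ∈ range k, f t| ≤ (k / l : ℕ) * B + (k % l : ℕ) := by
  have h : ∀ q : ℕ, |∑ t ∈ range (l * q), f t| ≤ q * B := by
    intro q
    induction q with
    | zero => simp
    | succ q ih =>
      rw [mul_add_one, sum_range_add]
      refine (abs_add_le _ _).trans ?_
      push_cast
      linarith [hB (l * q)]
  conv_lhs => rw [← Nat.div_add_mod k l, sum_range_add]
  refine (abs_add_le _ _).trans (add_le_add (h _) ?_)
  exact (abs_sum_le_sum_abs _ _).trans ((sum_le_sum fun t _ => hf _).trans (by simp))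

theorem abs_sum_psiProd_le (E : Finset ℕ) (A L k x : ℕ)
    (hE : ∀ p ∈ E, p.Prime ∧ p ≠ 2 ∧ A.Coprime p ∧ L ^ 400 ≤ p) (hne : E.Nonempty)
    (hL : 200000 ≤ L) (hEL : 2 ^ #E ≤ L) (hk : L ^ 260 ≤ k)
    (hek : ∏ p ∈ E, p ≤ L ^ 34 * k ^ 2) :
    |∑ t ∈ range k, psiProd E (x + A * t)| ≤ k / (2 * L) := by
  have hL0 : 0 < L := by omega
  have hE' : ∀ p ∈ E, p.Prime ∧ p ≠ 2 ∧ A.Coprime p ∧ 2 * L ^ 60 < p := by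
    intro p hp
    refine ⟨(hE p hp).1, (hE p hp).2.1, (hE p hp).2.2.1, lt_of_lt_of_le ?_ (hE p hp).2.2.2⟩
    calc 2 * L ^ 60 < L * L ^ 60 := by gcongr; omega
      _ = L ^ 61 := by ring
      _ ≤ L ^ 400 := Nat.pow_le_pow_right hL0 (by norm_num)
  have hLR : (200000 : ℝ) ≤ L := by exact_mod_cast hL
  have hLR0 : (0 : ℝ) < L := by linarith
  rcases lt_or_ge (8 * L ^ 120 * k) (∏ p ∈ E, p) with hke | hke
  · refine (abs_sum_psiProd_le_of_large_modulus E A L k x hE' hL hEL hk hke hek).trans ?_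
    gcongr
    norm_num
  have heL : L ^ 400 ≤ ∏ p ∈ E, p := by
    obtain ⟨q, hq⟩ := hne
    exact (hE q hq).2.2.2.trans
      (Nat.le_of_dvd (prod_pos fun p hp => (hE p hp).1.pos) (dvd_prod_of_mem _ hq))
  set e := ∏ p ∈ E, p with he
  set l := e / (64 * L ^ 121) with hl
  have hd0 : 0 < 64 * L ^ 121 := by positivity
  have hle : l * (64 * L ^ 121) ≤ e := Nat.div_mul_le_self _ _
  have hl260 : L ^ 260 ≤ l := by
    rw [hl, Nat.le_div_iff_mul_le hd0]
    refine le_trans ?_ heL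
    calc L ^ 260 * (64 * L ^ 121) ≤ L ^ 260 * (L * L ^ 121) := by gcongr; omega
      _ = L ^ 382 := by ring
      _ ≤ L ^ 400 := Nat.pow_le_pow_right hL0 (by norm_num)
  have hl0 : 0 < l := lt_of_lt_of_le (by positivity) hl260
  have hel : e ≤ 128 * L ^ 121 * l := by
    have h1 : e < (l + 1) * (64 * L ^ 121) := by
      rw [hl, mul_comm]
      exact Nat.lt_mul_div_succ _ hd0
    have h2 : (l + 1) * (64 * L ^ 121) ≤ (2 * l) * (64 * L ^ 121) :=
      Nat.mul_le_mul_right _ (by omega)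
    linarith
  have hle' : 8 * L ^ 120 * l < e := by
    refine lt_of_lt_of_le ?_ hle
    have h0 : 0 < L ^ 120 * l := by positivity
    calc 8 * L ^ 120 * l = 8 * (L ^ 120 * l) := by ring
      _ < (64 * L) * (L ^ 120 * l) := Nat.mul_lt_mul_of_pos_right (by omega) h0
      _ = _ := by ring
  have hel2 : e ≤ L ^ 34 * l ^ 2 := by
    refine hel.trans ?_
    calc 128 * L ^ 121 * l ≤ L * L ^ 121 * l := by gcongr; omega
      _ = L ^ 122 * l := by ring
      _ ≤ L ^ 260 * l := by gcongr; all_goals omega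
      _ ≤ l * l := by gcongr
      _ = 1 * l ^ 2 := by ring
      _ ≤ L ^ 34 * l ^ 2 := by gcongr; exact Nat.one_le_pow _ _ hL0
  have hblock := abs_sum_range_le_of_blocks (fun t => psiProd E (x + A * t))
    (fun n => abs_psiProd_le_one E (fun p hp => (hE p hp).1) _) l (l / (4 * L)) (fun j => by
      have := abs_sum_psiProd_le_of_large_modulus E A L l (x + A * j) hE' hL hEL hl260 hle' hel2
      simpa only [mul_add, add_assoc] using this) k
  refine hblock.trans ?_
  have h1 : ((k / l : ℕ) : ℝ) * (l / (4 * L)) ≤ k / (4 * L) := by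
    rw [← mul_div_assoc]
    gcongr
    exact_mod_cast Nat.div_mul_le_self k l
  have h2 : ((k % l : ℕ) : ℝ) ≤ k / (8 * L) := by
    rw [le_div_iff₀ (by positivity)]
    have h3 : k % l ≤ l := (Nat.mod_lt _ hl0).le
    have h4 : l * (8 * L) ≤ k := by
      have h5 := hle.trans hke
      have h6 : (8 * L ^ 120) * (l * (8 * L)) ≤ (8 * L ^ 120) * k := by linarith
      exact Nat.le_of_mul_le_mul_left h6 (by positivity)
    have h5 : k % l * (8 * L) ≤ k := (Nat.mul_le_mul_right _ h3).trans h4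
    exact_mod_cast h5
  refine (add_le_add h1 h2).trans ?_
  have h7 : (k : ℝ) / (4 * L) + k / (8 * L) = 3 / 4 * (k / (2 * L)) := by field_simp; ring
  rw [h7]
  have : (0 : ℝ) ≤ k / (2 * L) := by positivity
  linarith

theorem sum_range_mul_eq_of_periodic (n q : ℕ) (f : ℕ → ℝ) (hf : Function.Periodic f n) :
    ∑ x ∈ range (n * q), f x = q * ∑ x ∈ range n, f x := by
  induction q with
  | zero => simp
  | succ q ih =>
    rw [mul_add_one, sum_range_add, ih]
    have : ∀ x, f (n * q + x) = f x := fun x => by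
      rw [add_comm, mul_comm]
      exact hf.nat_mul q x
    simp only [this]
    push_cast
    ring

/-- The proportion of `y` modulo `m` such that no `y + A t`, `t < j`, is a square modulo `m`. -/
noncomputable def gapAvg (m A j : ℕ) : ℝ :=
  (∑ y ∈ range m, ∏ t ∈ range j, (1 - sqInd m ((y + A * t : ℕ) : ZMod m))) / m

theorem sqInd_prod (P : Finset ℕ) (hP : ∀ p ∈ P, p.Prime) (n : ℕ) :
    sqInd (∏ p ∈ P, p) n = ∏ p ∈ P, sqInd p n := by
  induction P using Finset.induction_on with
  | empty => rw [prod_empty, prod_empty, sqInd, if_pos ⟨0, Subsingleton.elim _ _⟩]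
  | insert p s hps ih =>
    have hs : ∀ q ∈ s, q.Prime := fun q hq => hP q (mem_insert_of_mem hq)
    have hcop : p.Coprime (∏ q ∈ s, q) := Nat.Coprime.prod_right fun q hq =>
      (Nat.coprime_primes (hP p (mem_insert_self _ _)) (hs q hq)).2 fun h => hps (h ▸ hq)
    rw [prod_insert hps, prod_insert hps, sqInd_mul _ _ hcop, ih hs]

theorem sum_powerset_psiProd (P : Finset ℕ) (n : ℕ) :
    ∑ E ∈ P.powerset, psiProd E n = ∏ p ∈ P, (sqInd p (n : ZMod p) / sqDens p) := by
  unfold psiProd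
  rw [← prod_one_add]
  exact prod_congr rfl fun p _ => by rw [psi]; ring

theorem sum_pow_four_le_of_large_modulus (P E : Finset ℕ) (hEP : E ⊆ P) (A L j : ℕ)
    (hP : ∀ p ∈ P, p.Prime ∧ p ≠ 2 ∧ A.Coprime p) (hL : 0 < L) (hj : 0 < j)
    (hEL : 2 ^ #E ≤ L) (hE : L ^ 34 * j ^ 2 < ∏ p ∈ E, p) :
    ∑ y ∈ range (∏ p ∈ P, p), (∑ t ∈ range j, psiProd E (y + A * t)) ^ 4 ≤
      (∏ p ∈ P, p : ℕ) * (8 * L ^ 7 * ((j : ℝ) ^ 2 + (j : ℝ) ^ 3 / L ^ 17)) := by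
  have hF := sum_pow_four_le E A (fun p hp => hP p (hEP hp)) j hj
  rw [← prod_sdiff hEP, mul_comm, sum_range_mul_eq_of_periodic]
  swap
  · intro y
    refine congrArg (· ^ 4) (sum_congr rfl fun t _ => psiProd_congr _ _ _ ?_)
    rw [add_right_comm]
    simp [Nat.ModEq]
  set e := ∏ p ∈ E, p with he
  have heR : (L : ℝ) ^ 34 * j ^ 2 ≤ e := by exact_mod_cast hE.le
  have hLR : (0 : ℝ) < L := by exact_mod_cast hL
  have hjR : (0 : ℝ) < j := by exact_mod_cast hj
  have hsq : (L : ℝ) ^ 17 * j ≤ √(e : ℝ) := by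
    refine Real.le_sqrt_of_sq_le ?_
    calc ((L : ℝ) ^ 17 * j) ^ 2 = (L : ℝ) ^ 34 * j ^ 2 := by ring
      _ ≤ (e : ℝ) := heR
  have hD : (79 : ℝ) ^ #E ≤ L ^ 7 := by
    calc (79 : ℝ) ^ #E ≤ 128 ^ #E := by gcongr; norm_num
      _ = (2 ^ #E) ^ 7 := by rw [← pow_mul, mul_comm, pow_mul]; norm_num
      _ ≤ L ^ 7 := by gcongr; exact_mod_cast hEL
  have h1 : (j : ℝ) ^ 4 / √(e : ℝ) ≤ (j : ℝ) ^ 3 / L ^ 17 := by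
    calc (j : ℝ) ^ 4 / √(e : ℝ) ≤ (j : ℝ) ^ 4 / (L ^ 17 * j) := by gcongr
      _ = _ := by field_simp
  push_cast
  calc ((∏ p ∈ P \ E, (p : ℝ)) * ∑ z ∈ range e, (∑ t ∈ range j, psiProd E (z + A * t)) ^ 4)
      ≤ (∏ p ∈ P \ E, (p : ℝ)) *
        (e * (79 ^ #E * (8 * ((j : ℝ) ^ 2 + (j : ℝ) ^ 4 / √(e : ℝ))))) := by gcongr
    _ ≤ (∏ p ∈ P \ E, (p : ℝ)) *
        (e * (L ^ 7 * (8 * ((j : ℝ) ^ 2 + (j : ℝ) ^ 3 / L ^ 17)))) := by gcongr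
    _ = _ := by ring

theorem gapAvg_le (P : Finset ℕ) (A L j : ℕ)
    (hP : ∀ p ∈ P, p.Prime ∧ p ≠ 2 ∧ A.Coprime p ∧ L ^ 400 ≤ p)
    (hL : 200000 ≤ L) (hPL : 2 ^ #P ≤ L) (hj : L ^ 260 ≤ j) :
    gapAvg (∏ p ∈ P, p) A j ≤ 128 * L ^ 11 * (1 / (j : ℝ) ^ 2 + 1 / (j * L ^ 17)) := by
  set m := ∏ p ∈ P, p with hm
  have hm0 : 0 < m := prod_pos fun p hp => (hP p hp).1.pos
  have hmR : (0 : ℝ) < m := by exact_mod_cast hm0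
  have hL0 : 0 < L := by omega
  have hj0 : 0 < j := lt_of_lt_of_le (by positivity) hj
  have hLR : (0 : ℝ) < L := by exact_mod_cast hL0
  have hjR : (0 : ℝ) < j := by exact_mod_cast hj0
  have hPLR : (2 : ℝ) ^ #P ≤ L := by exact_mod_cast hPL
  set Y : Finset ℕ → ℕ → ℝ := fun E y => ∑ t ∈ range j, psiProd E (y + A * t) with hY
  set B := {E ∈ P.powerset | L ^ 34 * j ^ 2 < ∏ p ∈ E, p} with hB
  have hBc : (#B : ℝ) ≤ L := by
    refine le_trans ?_ hPLR
    have : #B ≤ 2 ^ #P := (card_filter_le _ _).trans (card_powerset P).le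
    exact_mod_cast this
  have hEL : ∀ E ∈ P.powerset, 2 ^ #E ≤ L := fun E hE =>
    (Nat.pow_le_pow_right (by norm_num) (card_le_card (mem_powerset.1 hE))).trans hPL
  have hpt : ∀ y, ∏ t ∈ range j, (1 - sqInd m ((y + A * t : ℕ) : ZMod m)) ≤
      16 * L ^ 3 / (j : ℝ) ^ 4 * ∑ E ∈ B, Y E y ^ 4 := by
    intro y
    have hnn : 0 ≤ 16 * L ^ 3 / (j : ℝ) ^ 4 * ∑ E ∈ B, Y E y ^ 4 :=
      mul_nonneg (by positivity) (sum_nonneg fun _ _ => by positivity)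
    by_cases hsq : ∃ t ∈ range j, IsSquare ((y + A * t : ℕ) : ZMod m)
    · obtain ⟨t, ht, hs⟩ := hsq
      rw [prod_eq_zero ht (by rw [sqInd, if_pos hs, sub_self])]
      exact hnn
    push Not at hsq
    have h1 : ∏ t ∈ range j, (1 - sqInd m ((y + A * t : ℕ) : ZMod m)) ≤ 1 :=
      prod_le_one (fun t _ => by linarith [sqInd_le_one m ((y + A * t : ℕ) : ZMod m)])
        fun t _ => by linarith [sqInd_nonneg m ((y + A * t : ℕ) : ZMod m)]
    refine h1.trans ?_
    have h2 : ∑ E ∈ P.powerset, Y E y = 0 := by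
      rw [sum_comm]
      refine sum_eq_zero fun t ht => ?_
      rw [sum_powerset_psiProd, prod_div_distrib, ← sqInd_prod P fun p hp => (hP p hp).1]
      rw [← hm, sqInd, if_neg (hsq t ht), zero_div]
    have hemp : (∅ : Finset ℕ) ∈ P.powerset := empty_mem_powerset P
    rw [← add_sum_erase _ _ hemp] at h2
    have h3 : Y ∅ y = j := by simp [hY, psiProd]
    have h4 : (j : ℝ) ≤ ∑ E ∈ P.powerset.erase ∅, |Y E y| := by
      have := neg_abs_le (∑ E ∈ P.powerset.erase ∅, Y E y)
      have := abs_sum_le_sum_abs (fun E => Y E y) (P.powerset.erase ∅)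
      have h5 := abs_of_nonneg hjR.le
      have h6 : ∑ E ∈ P.powerset.erase ∅, Y E y = -j := by linarith
      rw [h6, abs_neg, h5] at this
      exact this
    have h7 : ∀ E ∈ P.powerset.erase ∅, |Y E y| ≤
        j / (2 * L) + if L ^ 34 * j ^ 2 < ∏ p ∈ E, p then |Y E y| else 0 := by
      intro E hE
      obtain ⟨hE0, hEP⟩ := mem_erase.1 hE
      split_ifs with h
      · have : (0 : ℝ) ≤ j / (2 * L) := by positivity
        linarith
      · rw [add_zero]
        exact abs_sum_psiProd_le E A L j y (fun p hp => hP p (mem_powerset.1 hEP hp))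
          (nonempty_iff_ne_empty.2 hE0) hL (hEL E hEP) hj (not_lt.1 h)
    have h8 : (j : ℝ) ≤ j / 2 + ∑ E ∈ B, |Y E y| := by
      refine h4.trans ((sum_le_sum h7).trans ?_)
      rw [sum_add_distrib, sum_const, nsmul_eq_mul, ← sum_filter]
      have hc : (#(P.powerset.erase ∅) : ℝ) ≤ L := by
        refine le_trans ?_ hPLR
        have : #(P.powerset.erase ∅) ≤ 2 ^ #P := (card_erase_le).trans (card_powerset P).le
        exact_mod_cast this
      refine add_le_add ?_ (sum_le_sum_of_subset_of_nonneg
        (filter_subset_filter _ (erase_subset _ _)) fun _ _ _ => abs_nonneg _)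
      calc (#(P.powerset.erase ∅) : ℝ) * (j / (2 * L)) ≤ L * (j / (2 * L)) := by gcongr
        _ = j / 2 := by field_simp
    have h9 := pow_sum_le_card_mul_sum_pow (s := B) (f := fun E => |Y E y|)
      (fun _ _ => abs_nonneg _) 3
    simp only [Even.pow_abs (show Even 4 by decide)] at h9
    have h10 : (j / 2 : ℝ) ^ 4 ≤ L ^ 3 * ∑ E ∈ B, Y E y ^ 4 := by
      calc (j / 2 : ℝ) ^ 4 ≤ (∑ E ∈ B, |Y E y|) ^ 4 := by gcongr; linarith
        _ ≤ (#B : ℝ) ^ 3 * ∑ E ∈ B, Y E y ^ 4 := h9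
        _ ≤ L ^ 3 * ∑ E ∈ B, Y E y ^ 4 := by gcongr
    rw [div_mul_eq_mul_div, le_div_iff₀ (by positivity)]
    linarith [(by ring : (j / 2 : ℝ) ^ 4 = j ^ 4 / 16)]
  unfold gapAvg
  rw [div_le_iff₀ hmR]
  refine (sum_le_sum fun y _ => hpt y).trans ?_
  rw [← mul_sum, sum_comm]
  have hb : ∀ E ∈ B, ∑ y ∈ range m, Y E y ^ 4 ≤
      m * (8 * L ^ 7 * ((j : ℝ) ^ 2 + (j : ℝ) ^ 3 / L ^ 17)) := by
    intro E hE
    obtain ⟨hEP, hEl⟩ := mem_filter.1 hE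
    exact sum_pow_four_le_of_large_modulus P E (mem_powerset.1 hEP) A L j
      (fun p hp => ⟨(hP p hp).1, (hP p hp).2.1, (hP p hp).2.2.1⟩) hL0 hj0 (hEL E hEP) hEl
  calc 16 * L ^ 3 / (j : ℝ) ^ 4 * ∑ E ∈ B, ∑ y ∈ range m, Y E y ^ 4
      ≤ 16 * L ^ 3 / (j : ℝ) ^ 4 *
        ∑ E ∈ B, m * (8 * L ^ 7 * ((j : ℝ) ^ 2 + (j : ℝ) ^ 3 / L ^ 17)) := by
        gcongr with E hE; exact hb E hE
    _ = #B * (16 * L ^ 3 / (j : ℝ) ^ 4 *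
        (m * (8 * L ^ 7 * ((j : ℝ) ^ 2 + (j : ℝ) ^ 3 / L ^ 17)))) := by
        rw [sum_const, nsmul_eq_mul]; ring
    _ ≤ L * (16 * L ^ 3 / (j : ℝ) ^ 4 *
        (m * (8 * L ^ 7 * ((j : ℝ) ^ 2 + (j : ℝ) ^ 3 / L ^ 17)))) := by gcongr
    _ = _ := by field_simp; ring

theorem thinAvg_le_gapAvg (A m k : ℕ) (hA : 0 < A) (hm : 0 < m) (hAm : A.Coprime m) :
    thinAvg (A * m) 1 k ≤ gapAvg m A (k / A) := by
  have : NeZero A := ⟨hA.ne'⟩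
  have : NeZero m := ⟨hm.ne'⟩
  have hAR : (0 : ℝ) < A := by exact_mod_cast hA
  have hmR : (0 : ℝ) < m := by exact_mod_cast hm
  set j := k / A with hj
  set G : ZMod A → ZMod m → ℝ := fun u v =>
    ∏ t ∈ range j, (1 - sqInd m (v + ((A - u.val + A * t : ℕ) : ZMod m))) with hG
  have h01 : ∀ (n : ℕ) (y : ZMod n), 0 ≤ 1 - sqInd n y ∧ 1 - sqInd n y ≤ 1 := fun n y =>
    ⟨by linarith [sqInd_le_one n y], by linarith [sqInd_nonneg n y]⟩
  have hpt : ∀ x : ℕ, ∏ i ∈ Icc 1 k, (1 - 1 * sqInd (A * m) ((x + i : ℕ) : ZMod (A * m))) ≤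
      G x x := by
    intro x
    simp only [one_mul]
    have hx : x % A < A := Nat.mod_lt _ hA
    have hval : (x : ZMod A).val = x % A := ZMod.val_natCast _ _
    set g : ℕ → ℕ := fun t => A - x % A + A * t with hg
    have hinj : Set.InjOn g (range j) := by
      intro t _ t' _ h
      simp only [hg] at h
      exact Nat.eq_of_mul_eq_mul_left hA (by omega)
    have hsub : (range j).image g ⊆ Icc 1 k := by
      intro i hi
      obtain ⟨t, ht, rfl⟩ := mem_image.1 hi
      have h1 : A * (t + 1) ≤ A * j := Nat.mul_le_mul_left _ (mem_range.1 ht)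
      have h2 : A * j ≤ k := Nat.mul_div_le k A
      rw [mul_add_one] at h1
      simp only [hg, mem_Icc]
      omega
    rw [← prod_sdiff hsub, prod_image hinj]
    have h2 : ∀ t ∈ range j, 1 - sqInd (A * m) ((x + g t : ℕ) : ZMod (A * m)) =
        1 - sqInd m ((x : ZMod m) + ((A - (x : ZMod A).val + A * t : ℕ) : ZMod m)) := by
      intro t _
      have h3 : ((x + g t : ℕ) : ZMod A) = 0 := by
        rw [ZMod.natCast_eq_zero_iff]
        have : x + g t = A * (x / A + 1 + t) := by
          have := Nat.div_add_mod x A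
          simp only [hg]
          rw [mul_add, mul_add]
          omega
        exact ⟨_, this⟩
      rw [sqInd_mul A m hAm, h3, sqInd_zero, one_mul, hval, ← Nat.cast_add]
    rw [prod_congr rfl h2]
    exact mul_le_of_le_one_left (prod_nonneg fun t _ => (h01 _ _).1)
      (prod_le_one (fun t _ => (h01 _ _).1) fun t _ => (h01 _ _).2)
  have hsum : ∑ x ∈ range (A * m), G x x = A * (m * gapAvg m A j) := by
    rw [sum_range_mul_eq_sum_sum A m hAm]
    have : ∀ u : ZMod A, ∑ v, G u v = m * gapAvg m A j := by
      intro u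
      rw [gapAvg, mul_div_cancel₀ _ hmR.ne']
      have h := sum_range_natCast m (fun v : ZMod m =>
        ∏ t ∈ range j, (1 - sqInd m (v + ((A * t : ℕ) : ZMod m))))
      simp only [Nat.cast_add] at h ⊢
      rw [h, hG, ← Equiv.sum_comp (Equiv.addRight ((A - u.val : ℕ) : ZMod m))
        (fun v => ∏ t ∈ range j, (1 - sqInd m (v + ((A * t : ℕ) : ZMod m))))]
      refine sum_congr rfl fun v _ => prod_congr rfl fun t _ => ?_
      simp only [Equiv.coe_addRight, Nat.cast_add, add_assoc]
    simp only [this, sum_const, card_univ, ZMod.card, nsmul_eq_mul]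
  rw [thinAvg, div_le_iff₀ (by positivity)]
  refine (sum_le_sum fun x _ => hpt x).trans (hsum.le.trans (le_of_eq ?_))
  push_cast
  ring

theorem sum_Ioc_one_div_sq_le (K M : ℕ) (hK : 0 < K) :
    ∑ k ∈ Ioc K M, 1 / (k : ℝ) ^ 2 ≤ 1 / (K : ℝ) := by
  rcases le_or_gt K M with h | h
  · have := sum_Ioc_inv_sq_le_sub (α := ℝ) hK.ne' h
    simp only [one_div]
    have : (0 : ℝ) ≤ (M : ℝ)⁻¹ := by positivity
    linarith
  · rw [Ioc_eq_empty (by omega)]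
    simp

theorem sum_Ioc_one_div_le (K M : ℕ) : ∑ k ∈ Ioc K M, 1 / (k : ℝ) ≤ 1 + Real.log M := by
  have h := harmonic_le_one_add_log M
  rw [harmonic_eq_sum_Icc] at h
  push_cast at h
  refine le_trans ?_ h
  simp only [one_div]
  exact sum_le_sum_of_subset_of_nonneg (fun k hk => by rw [mem_Ioc] at hk; rw [mem_Icc]; omega)
    fun _ _ _ => by positivity

theorem sum_thinAvg_tail_le (P : Finset ℕ) (A L : ℕ) (hA : 0 < A) (hAL : A ≤ L)
    (hP : ∀ p ∈ P, p.Prime ∧ p ≠ 2 ∧ A.Coprime p ∧ L ^ 400 ≤ p)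
    (hL : 200000 ≤ L) (hPL : 2 ^ #P ≤ L) (hlog : Real.log (A * ∏ p ∈ P, p : ℕ) ≤ L + 1) :
    ∑ k ∈ Ioc (A * L ^ 260) (A * ∏ p ∈ P, p), thinAvg (A * ∏ p ∈ P, p) 1 k ≤
      1 / L := by
  set m := ∏ p ∈ P, p with hm
  have hm0 : 0 < m := prod_pos fun p hp => (hP p hp).1.pos
  have hAm : A.Coprime m := Nat.Coprime.prod_right fun p hp => (hP p hp).2.2.1
  have hL0 : 0 < L := by omega
  have hLR : (200000 : ℝ) ≤ L := by exact_mod_cast hL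
  have hLR0 : (0 : ℝ) < L := by linarith
  have hpt : ∀ k ∈ Ioc (A * L ^ 260) (A * m), thinAvg (A * m) 1 k ≤
      512 * L ^ 13 * (1 / (k : ℝ) ^ 2) + 256 / L ^ 5 * (1 / (k : ℝ)) := by
    intro k hk
    rw [mem_Ioc] at hk
    have hj : L ^ 260 ≤ k / A := by
      rw [Nat.le_div_iff_mul_le hA, mul_comm]
      exact hk.1.le
    have hj0 : 0 < k / A := lt_of_lt_of_le (by positivity) hj
    have hk0 : (0 : ℝ) < k := by
      have : 0 < k := by omega
      exact_mod_cast this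
    refine (thinAvg_le_gapAvg A m k hA hm0 hAm).trans
      ((gapAvg_le P A L (k / A) hP hL hPL hj).trans ?_)
    have hkj : (k : ℝ) / (2 * L) ≤ (k / A : ℕ) := by
      rw [div_le_iff₀ (by positivity)]
      have h1 : k < (k / A + 1) * A := by
        rw [mul_comm]; exact Nat.lt_mul_div_succ _ hA
      have h2 : (k / A + 1) * A ≤ (2 * (k / A)) * L := Nat.mul_le_mul (by omega) hAL
      have h3 : k ≤ k / A * (2 * L) := by linarith
      exact_mod_cast h3
    calc 128 * (L : ℝ) ^ 11 * (1 / ((k / A : ℕ) : ℝ) ^ 2 + 1 / (((k / A : ℕ) : ℝ) * L ^ 17))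
        ≤ 128 * (L : ℝ) ^ 11 * (1 / ((k : ℝ) / (2 * L)) ^ 2 + 1 / ((k : ℝ) / (2 * L) * L ^ 17)) := by
          gcongr
      _ = _ := by field_simp; ring
  refine (sum_le_sum hpt).trans ?_
  rw [sum_add_distrib, ← mul_sum, ← mul_sum]
  have h1 := sum_Ioc_one_div_sq_le (A * L ^ 260) (A * m) (by positivity)
  have h2 := sum_Ioc_one_div_le (A * L ^ 260) (A * m)
  have h3 : (1 : ℝ) / (A * L ^ 260 : ℕ) ≤ 1 / L ^ 260 := by
    push_cast
    gcongr
    have : (1 : ℝ) ≤ A := by exact_mod_cast hA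
    exact le_mul_of_one_le_left (by positivity) this
  calc 512 * (L : ℝ) ^ 13 * ∑ k ∈ Ioc (A * L ^ 260) (A * m), 1 / (k : ℝ) ^ 2 +
        256 / L ^ 5 * ∑ k ∈ Ioc (A * L ^ 260) (A * m), 1 / (k : ℝ)
      ≤ 512 * (L : ℝ) ^ 13 * (1 / (L : ℝ) ^ 260) + 256 / (L : ℝ) ^ 5 * (2 * L) := by
        gcongr
        · exact h1.trans h3
        · linarith
    _ = 512 / (L : ℝ) ^ 246 * (1 / (L : ℝ)) + 512 / (L : ℝ) ^ 3 * (1 / (L : ℝ)) := by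
        field_simp; ring
    _ ≤ 1 / 2 * (1 / (L : ℝ)) + 1 / 2 * (1 / (L : ℝ)) := by
        have h4 : ∀ n : ℕ, n ≠ 0 → 512 / (L : ℝ) ^ n ≤ 1 / 2 := by
          intro n hn
          have : (200000 : ℝ) ≤ L ^ n := hLR.trans (le_self_pow₀ (by linarith) hn)
          rw [div_le_iff₀ (by positivity)]
          linarith
        have h5 : (0 : ℝ) ≤ 1 / L := by positivity
        exact add_le_add (mul_le_mul_of_nonneg_right (h4 _ (by norm_num)) h5)
          (mul_le_mul_of_nonneg_right (h4 _ (by norm_num)) h5)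
    _ = 1 / (L : ℝ) := by ring

theorem sum_thinAvg_model_error_le (P : Finset ℕ) (A L : ℕ) (hA : 0 < A) (hAL : A ≤ L)
    (hP : ∀ p ∈ P, p.Prime ∧ p ≠ 2 ∧ A.Coprime p ∧ L ^ 1100 ≤ p)
    (hL : 200000 ≤ L) (hPL : 2 ^ #P ≤ L) :
    ∑ k ∈ Icc 1 (A * L ^ 260),
      |thinAvg (A * ∏ p ∈ P, p) 1 k - thinAvg A (∏ p ∈ P, sqDens p) k| ≤ 1 / (L : ℝ) := by
  have hL0 : 0 < L := by omega
  have hLR : (200000 : ℝ) ≤ L := by exact_mod_cast hL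
  have hLR0 : (0 : ℝ) < L := by linarith
  have hALR : (A : ℝ) ≤ L := by exact_mod_cast hAL
  have hK : ((A * L ^ 260 : ℕ) : ℝ) ≤ (L : ℝ) ^ 261 := by
    push_cast
    calc (A : ℝ) * L ^ 260 ≤ (L : ℝ) * L ^ 260 := by gcongr
      _ = (L : ℝ) ^ 261 := by ring
  have hPc : (#P : ℝ) ≤ L := by
    have : #P ≤ L := (Nat.lt_two_pow_self).le.trans hPL
    exact_mod_cast this
  have hL1 : (1 : ℝ) ≤ (L : ℝ) ^ 261 := one_le_pow₀ (by linarith)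
  have hk : ∀ k ∈ Icc 1 (A * L ^ 260),
      |thinAvg (A * ∏ p ∈ P, p) 1 k - thinAvg A (∏ p ∈ P, sqDens p) k| ≤ 1 / (L : ℝ) ^ 262 := by
    intro k hk
    have hkK : (k : ℝ) ≤ (L : ℝ) ^ 261 :=
      le_trans (by exact_mod_cast (mem_Icc.1 hk).2) hK
    have h := abs_thinAvg_mul_prod_sub_le A hA.ne' k P
      (fun p hp => ⟨(hP p hp).1, (hP p hp).2.1, (hP p hp).2.2.1⟩) 1 zero_le_one le_rfl
    rw [one_mul] at h
    refine h.trans ?_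
    have hp : ∀ p ∈ P, 17 * ((k : ℝ) + 1) / √(p : ℝ) ≤ 34 * (L : ℝ) ^ 261 / (L : ℝ) ^ 550 := by
      intro p hp
      have h1 : (L : ℝ) ^ 550 ≤ √(p : ℝ) := by
        refine Real.le_sqrt_of_sq_le ?_
        rw [← pow_mul]
        exact_mod_cast (hP p hp).2.2.2
      have h2 : 17 * ((k : ℝ) + 1) ≤ 34 * (L : ℝ) ^ 261 := by linarith
      gcongr
    refine (sum_le_sum hp).trans ?_
    rw [sum_const, nsmul_eq_mul]
    calc (#P : ℝ) * (34 * (L : ℝ) ^ 261 / (L : ℝ) ^ 550)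
        ≤ L * (L * (L : ℝ) ^ 261 / (L : ℝ) ^ 550) := by gcongr; linarith
      _ = 1 / (L : ℝ) ^ 287 := by field_simp
      _ ≤ 1 / (L : ℝ) ^ 262 := by
        gcongr
        · linarith
        · norm_num
  refine (sum_le_sum hk).trans ?_
  rw [sum_const, nsmul_eq_mul, Nat.card_Icc, Nat.add_sub_cancel]
  calc ((A * L ^ 260 : ℕ) : ℝ) * (1 / (L : ℝ) ^ 262) ≤ (L : ℝ) ^ 261 * (1 / (L : ℝ) ^ 262) := by
        gcongr
    _ = 1 / (L : ℝ) := by field_simp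

theorem one_sub_pow_le_one_div (d : ℝ) (hd0 : 0 < d) (hd1 : d ≤ 1) (n : ℕ) (hn : 0 < n) :
    (1 - d) ^ n ≤ 1 / (n * d) := by
  have hn' : (0 : ℝ) < n := by exact_mod_cast hn
  have h1 : 1 + n * d ≤ (1 + d) ^ n := one_add_mul_le_pow (by linarith) n
  have h2 : (1 - d) ^ n * (1 + d) ^ n ≤ 1 := by
    rw [← mul_pow]
    exact pow_le_one₀ (mul_nonneg (by linarith) (by linarith)) (by nlinarith)
  have h3 : 0 ≤ (1 - d) ^ n := pow_nonneg (by linarith) n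
  rw [le_div_iff₀ (by positivity)]
  nlinarith

theorem one_div_two_pow_card_le_prod_sqDens (P : Finset ℕ) (hP : ∀ p ∈ P, 0 < p) :
    1 / 2 ^ #P ≤ ∏ p ∈ P, sqDens p := by
  rw [← one_div_pow, ← prod_const]
  refine prod_le_prod (fun _ _ => by norm_num) fun p hp => ?_
  have : (0 : ℝ) < p := by exact_mod_cast hP p hp
  rw [sqDens, div_le_div_iff₀ (by norm_num) (by positivity)]
  linarith

theorem abs_stoch_QR_sub_le (P : Finset ℕ) (A L : ℕ) (hA : 0 < A) (hAL : A ≤ L)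
    (hP : ∀ p ∈ P, p.Prime ∧ p ≠ 2 ∧ A.Coprime p ∧ L ^ 1100 ≤ p) (hne : P.Nonempty)
    (hL : 200000 ≤ L) (hPL : 2 ^ #P ≤ L) (hlog : Real.log (A * ∏ p ∈ P, p : ℕ) ≤ L + 1)
    (hd : #(QR A) * ∏ p ∈ P, sqDens p ≤ 1 / 2) :
    |(stoch (A * ∏ p ∈ P, p) (QR (A * ∏ p ∈ P, p)) : ℝ) - (A * ∏ p ∈ P, p : ℕ) *
        (A / #(QR A) * (2 / ∏ p ∈ P, sqDens p - 1))| ≤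
      (A * ∏ p ∈ P, p : ℕ) * (5 / L + 5 * A * (#(QR A) * ∏ p ∈ P, sqDens p)) := by
  have hL0 : 0 < L := by omega
  have hLR : (200000 : ℝ) ≤ L := by exact_mod_cast hL
  have hLR0 : (0 : ℝ) < L := by linarith
  have hALR : (A : ℝ) ≤ L := by exact_mod_cast hAL
  have : NeZero A := ⟨hA.ne'⟩
  have hM0 : 0 < A * ∏ p ∈ P, p := Nat.mul_pos hA (prod_pos fun p hp => (hP p hp).1.pos)
  have hKM : A * L ^ 260 ≤ A * ∏ p ∈ P, p := by
    obtain ⟨p, hp⟩ := hne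
    refine Nat.mul_le_mul_left _ ?_
    calc L ^ 260 ≤ L ^ 1100 := Nat.pow_le_pow_right hL0 (by norm_num)
      _ ≤ p := (hP p hp).2.2.2
      _ ≤ _ := Nat.le_of_dvd (prod_pos fun p hp => (hP p hp).1.pos) (dvd_prod_of_mem _ hp)
  have herr := sum_thinAvg_model_error_le P A L hA hAL hP hL hPL
  have htail := sum_thinAvg_tail_le P A L hA hAL
    (fun p hp => ⟨(hP p hp).1, (hP p hp).2.1, (hP p hp).2.2.1,
      (Nat.pow_le_pow_right hL0 (by norm_num)).trans (hP p hp).2.2.2⟩) hL hPL hlog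
  have hδlow := one_div_two_pow_card_le_prod_sqDens P fun p hp => (hP p hp).1.pos
  rw [stoch_QR_eq _ hM0.ne']
  set M := A * ∏ p ∈ P, p with hM
  set δ := ∏ p ∈ P, sqDens p with hδ
  have hδL : 1 / (L : ℝ) ≤ δ := by
    refine le_trans ?_ hδlow
    gcongr
    exact_mod_cast hPL
  have hδ0 : 0 < δ := lt_of_lt_of_le (by positivity) hδL
  have hQ1 : (1 : ℝ) ≤ #(QR A) := by
    have : 0 < #(QR A) := card_pos.2 ⟨0, (mem_QR_iff A hA.ne' 0).2 ⟨0, by simp⟩⟩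
    exact_mod_cast this
  have hδ1 : δ < 1 := by nlinarith
  have hmodel := abs_model_truncated_sub_le A δ hδ1 hδ0 hd (L ^ 260)
  have hgeo : 3 * A * (1 - δ) ^ (L ^ 260) / δ ≤ 1 / (L : ℝ) := by
    have h1 := one_sub_pow_le_one_div δ hδ0 hδ1.le (L ^ 260) (by positivity)
    push_cast at h1
    have h2 : 1 / ((L : ℝ) ^ 260 * δ) ≤ 1 / ((L : ℝ) ^ 260 * (1 / L)) := by gcongr
    have h3 : 0 ≤ (1 - δ) ^ (L ^ 260) := pow_nonneg (by linarith) _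
    calc 3 * A * (1 - δ) ^ (L ^ 260) / δ
        ≤ L * L * (1 / ((L : ℝ) ^ 260 * (1 / L))) / (1 / L) := by
          gcongr
          · linarith
          · exact h1.trans h2
      _ = 1 / (L : ℝ) ^ 256 := by field_simp
      _ ≤ 1 / (L : ℝ) := by
        gcongr
        exact le_self_pow₀ (by linarith) (by norm_num)
  have hsplit : ∑ k ∈ Icc 1 M, thinAvg M 1 k =
      ∑ k ∈ Icc 1 (A * L ^ 260), thinAvg M 1 k + ∑ k ∈ Ioc (A * L ^ 260) M, thinAvg M 1 k := by
    rw [← sum_union]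
    · congr 1
      ext k
      simp only [mem_union, mem_Icc, mem_Ioc]
      omega
    · rw [disjoint_left]
      intro k h1 h2
      rw [mem_Icc] at h1
      rw [mem_Ioc] at h2
      omega
  have htail0 : 0 ≤ ∑ k ∈ Ioc (A * L ^ 260) M, thinAvg M 1 k :=
    sum_nonneg fun k _ => thinAvg_nonneg _ _ _ zero_le_one le_rfl
  have herr' : |∑ k ∈ Icc 1 (A * L ^ 260), thinAvg M 1 k -
      ∑ k ∈ Icc 1 (A * L ^ 260), thinAvg A δ k| ≤ 1 / (L : ℝ) := by
    rw [← sum_sub_distrib]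
    exact (abs_sum_le_sum_abs _ _).trans herr
  rw [← mul_sub, abs_mul, Nat.abs_cast]
  refine mul_le_mul_of_nonneg_left ?_ (Nat.cast_nonneg _)
  rw [hsplit]
  have h5 : (5 : ℝ) / L = 5 * (1 / L) := by ring
  rw [h5]
  rw [abs_le] at *
  constructor <;> linarith

theorem card_QR_mul_prod (A : ℕ) (hA : 0 < A) (P : Finset ℕ)
    (hP : ∀ p ∈ P, p.Prime ∧ p ≠ 2 ∧ A.Coprime p) :
    (#(QR (A * ∏ p ∈ P, p)) : ℝ) = #(QR A) * ((∏ p ∈ P, p : ℕ) * ∏ p ∈ P, sqDens p) := by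
  have hmul : ∀ a b : ℕ, 0 < a → 0 < b → a.Coprime b →
      (#(QR (a * b)) : ℝ) = #(QR a) * #(QR b) := by
    intro a b ha hb hab
    have : NeZero a := ⟨ha.ne'⟩
    have : NeZero b := ⟨hb.ne'⟩
    have : NeZero (a * b) := ⟨(Nat.mul_pos ha hb).ne'⟩
    rw [card_QR_eq_sum, card_QR_eq_sum, card_QR_eq_sum, ← sum_range_natCast]
    simp only [sqInd_mul a b hab]
    rw [sum_range_mul_eq_sum_sum a b hab (fun u v => sqInd a u * sqInd b v), sum_mul_sum]
  induction P using Finset.induction_on with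
  | empty => rw [prod_empty, prod_empty, mul_one, Nat.cast_one, mul_one, mul_one]
  | insert p s hps ih =>
    obtain ⟨hp, hp2, hAp⟩ := hP p (mem_insert_self _ _)
    have hs : ∀ q ∈ s, q.Prime ∧ q ≠ 2 ∧ A.Coprime q := fun q hq => hP q (mem_insert_of_mem hq)
    have : Fact p.Prime := ⟨hp⟩
    have hcop : (A * ∏ q ∈ s, q).Coprime p :=
      Nat.Coprime.mul_left hAp (Nat.Coprime.prod_left fun q hq =>
        (Nat.coprime_primes (hs q hq).1 hp).2 fun h => hps (h ▸ hq))
    have hpos : 0 < A * ∏ q ∈ s, q := Nat.mul_pos hA (prod_pos fun q hq => (hs q hq).1.pos)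
    have hp0 : (p : ℝ) ≠ 0 := by exact_mod_cast hp.ne_zero
    rw [prod_insert hps, prod_insert hps, mul_comm p, ← mul_assoc, hmul _ _ hpos hp.pos hcop, ih hs,
      card_QR_eq_sum p, sum_sqInd p hp2, sqDens]
    push_cast
    field_simp

theorem two_pow_card_primeFactors_pow_five_le (A : ℕ) (hA : A ≠ 0) :
    (2 ^ #A.primeFactors) ^ 5 ≤ 32 ^ 32 * A := by
  have h1 : ∀ p ∈ A.primeFactors, 32 ≤ (if p < 32 then 32 else 1) * p := by
    intro p hp
    have := (Nat.prime_of_mem_primeFactors hp).pos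
    split_ifs <;> omega
  calc (2 ^ #A.primeFactors) ^ 5 = ∏ p ∈ A.primeFactors, 32 := by
        rw [prod_const, ← pow_mul, mul_comm, pow_mul]; norm_num
    _ ≤ ∏ p ∈ A.primeFactors, (if p < 32 then 32 else 1) * p :=
        prod_le_prod (fun _ _ => Nat.zero_le _) h1
    _ = (∏ p ∈ A.primeFactors with p < 32, 32) * ∏ p ∈ A.primeFactors, p := by
        rw [prod_mul_distrib, prod_filter]
    _ ≤ 32 ^ 32 * A := by
        refine Nat.mul_le_mul ?_ (Nat.le_of_dvd (Nat.pos_of_ne_zero hA) (Nat.prod_primeFactors_dvd A))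
        rw [prod_const]
        refine Nat.pow_le_pow_right (by norm_num) ?_
        calc _ ≤ #(range 32) := card_le_card fun p hp => mem_range.2 (mem_filter.1 hp).2
          _ = 32 := card_range _

theorem prod_sqDens_le (P : Finset ℕ) (h0 : ∀ p ∈ P, 0 < p)
    (hP : ∑ p ∈ P, (1 : ℝ) / p ≤ 1 / 2) : ∏ p ∈ P, sqDens p ≤ 2 / 2 ^ #P := by
  have h1 : ∏ p ∈ P, sqDens p = (∏ p ∈ P, (1 + 1 / (p : ℝ))) / 2 ^ #P := by
    rw [← prod_const, ← prod_div_distrib]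
    refine prod_congr rfl fun p hp => ?_
    have : (p : ℝ) ≠ 0 := by exact_mod_cast (h0 p hp).ne'
    rw [sqDens]
    field_simp
  rw [h1]
  gcongr
  calc ∏ p ∈ P, (1 + 1 / (p : ℝ)) ≤ ∏ p ∈ P, Real.exp (1 / p) :=
        prod_le_prod (fun _ _ => by positivity) fun p _ => by
          linarith [Real.add_one_le_exp (1 / (p : ℝ))]
    _ = Real.exp (∑ p ∈ P, (1 : ℝ) / p) := (Real.exp_sum _ _).symm
    _ ≤ Real.exp (Real.log 2) := by
        gcongr
        linarith [Real.log_two_gt_d9]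
    _ = 2 := Real.exp_log (by norm_num)

theorem card_QR_le (A : ℕ) : #(QR A) ≤ A :=
  card_image_le.trans (card_range A).le

theorem abs_stoch_sub_le_of_inOmega (l : ℝ) (hl : (2 : ℝ) ^ 100 ≤ l) (M : ℕ) (hlM : Real.log M = l)
    (hsq : Squarefree M) (hω1 : 0.9 * Real.log l < #M.primeFactors)
    (hω2 : #M.primeFactors < 1.1 * Real.log l) (A m : ℕ) (hMA : M = A * m) (hA3 : 3 ≤ A)
    (hA : (A : ℝ) ≤ l ^ (0.1 : ℝ)) (hm : ∀ p : ℕ, p.Prime → p ∣ m → l ^ (1100 : ℝ) < p) :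
    |(stoch M (QR M) : ℝ) - (2 * (M : ℝ) ^ 2 / #(QR M) - M * A / #(QR A))| ≤
      2 ^ 40 * M * l ^ (-(0.4 : ℝ)) := by
  have hl1 : (200001 : ℝ) ≤ l := le_trans (by norm_num) hl
  have hl0 : 0 < l := by linarith
  have hM0 : M ≠ 0 := hsq.ne_zero
  rw [hMA] at hsq
  obtain ⟨hcop, -, hsqm⟩ := Nat.squarefree_mul_iff.1 hsq
  set P := m.primeFactors with hPdef
  have hprod : ∏ p ∈ P, p = m := Nat.prod_primeFactors_of_squarefree hsqm
  have hm0 : m ≠ 0 := hsqm.ne_zero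
  set L := ⌊l⌋₊ with hLdef
  have hLl : (L : ℝ) ≤ l := Nat.floor_le hl0.le
  have hlL : l < L + 1 := Nat.lt_floor_add_one l
  have hL : 200000 ≤ L := Nat.le_floor (by push_cast; linarith)
  have hLR : (200000 : ℝ) ≤ L := by exact_mod_cast hL
  have hP : ∀ p ∈ P, p.Prime ∧ p ≠ 2 ∧ A.Coprime p ∧ L ^ 1100 ≤ p := by
    intro p hp
    have hpp := Nat.prime_of_mem_primeFactors hp
    have hpm := Nat.dvd_of_mem_primeFactors hp
    have h1 := hm p hpp hpm
    have h2 : l ^ (1100 : ℝ) = l ^ 1100 := by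
      rw [← Real.rpow_natCast]; norm_num
    rw [h2] at h1
    have h3 : ((L ^ 1100 : ℕ) : ℝ) < p := by
      rw [Nat.cast_pow]
      exact lt_of_le_of_lt (pow_le_pow_left₀ (Nat.cast_nonneg _) hLl _) h1
    have h4 : L ^ 1100 < p := by exact_mod_cast h3
    refine ⟨hpp, ?_, hcop.coprime_dvd_right hpm, h4.le⟩
    rintro rfl
    have : L ≤ L ^ 1100 := Nat.le_self_pow (by norm_num) L
    omega
  have hP0 : ∀ p ∈ P, 0 < p := fun p hp => (hP p hp).1.pos
  have hAl : (A : ℝ) ≤ l := hA.trans (by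
    conv_rhs => rw [← Real.rpow_one l]
    exact Real.rpow_le_rpow_of_exponent_le (by linarith) (by norm_num))
  have hAL : A ≤ L := Nat.le_floor hAl
  have hA0 : 0 < A := by omega
  have hne : P.Nonempty := by
    rw [hPdef, Nat.nonempty_primeFactors]
    by_contra! h
    have hm1 : m = 1 := by omega
    rw [hm1, mul_one] at hMA
    have h2 := Real.log_le_sub_one_of_pos (x := (M : ℝ)) (by positivity)
    rw [hlM, hMA] at h2
    linarith
  have hcard : #M.primeFactors = #A.primeFactors + #P := by
    rw [hMA, hcop.primeFactors_mul, card_union_of_disjoint hcop.disjoint_primeFactors]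
  have h2pow : ∀ n : ℕ, (2 : ℝ) ^ n = Real.exp (n * Real.log 2) := fun n => by
    rw [Real.exp_nat_mul, Real.exp_log (by norm_num)]
  have hlogl : 0 < Real.log l := Real.log_pos (by linarith)
  have hPM : (2 : ℝ) ^ #M.primeFactors ≤ l := by
    rw [h2pow]
    conv_rhs => rw [← Real.exp_log hl0]
    gcongr
    nlinarith [Real.log_two_lt_d9, Real.log_two_gt_d9]
  have hPL : 2 ^ #P ≤ L := by
    refine Nat.le_floor (le_trans ?_ hPM)
    push_cast
    gcongr
    · norm_num
    · exact Nat.primeFactors_mono ⟨A, hMA.trans (mul_comm A m)⟩ hM0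
  have hPcL : (#P : ℝ) ≤ L := by
    have : #P ≤ L := (Nat.lt_two_pow_self).le.trans hPL
    exact_mod_cast this
  have hδ : ∏ p ∈ P, sqDens p ≤ 2 / 2 ^ #P := by
    refine prod_sqDens_le P hP0 ?_
    have h1 : ∀ p ∈ P, (1 : ℝ) / p ≤ 1 / L ^ 2 := by
      intro p hp
      gcongr
      have : L ^ 2 ≤ p := (Nat.pow_le_pow_right (by omega) (by norm_num)).trans (hP p hp).2.2.2
      exact_mod_cast this
    refine (sum_le_sum h1).trans ?_
    rw [sum_const, nsmul_eq_mul, mul_one_div, div_le_div_iff₀ (by positivity) (by norm_num)]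
    nlinarith
  have hδ0 : 0 < ∏ p ∈ P, sqDens p := prod_pos fun p hp => sqDens_pos p (hP0 p hp)
  have hω : l ^ (0.62 : ℝ) * l ^ (0.0037 : ℝ) ≤ (2 : ℝ) ^ #M.primeFactors := by
    rw [h2pow, ← Real.rpow_add hl0, Real.rpow_def_of_pos hl0]
    refine Real.exp_le_exp.2 ?_
    nlinarith [Real.log_two_gt_d9]
  have hωA : (2 : ℝ) ^ #A.primeFactors ≤ 32 ^ 7 * l ^ (0.02 : ℝ) := by
    refine le_of_pow_le_pow_left₀ (n := 5) (by norm_num) (by positivity) ?_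
    have h1 : ((2 : ℝ) ^ #A.primeFactors) ^ 5 ≤ 32 ^ 32 * A := by
      exact_mod_cast two_pow_card_primeFactors_pow_five_le A hA0.ne'
    have h2 : (l ^ (0.02 : ℝ)) ^ 5 = l ^ (0.1 : ℝ) := by
      rw [← Real.rpow_natCast, ← Real.rpow_mul hl0.le]; norm_num
    rw [mul_pow, h2]
    refine h1.trans ?_
    gcongr
    norm_num
  have hhA : (#(QR A) : ℝ) ≤ A := by exact_mod_cast card_QR_le A
  have hmain : A * (#(QR A) * ∏ p ∈ P, sqDens p) ≤ 2 ^ 36 * l ^ (-(0.4 : ℝ)) := by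
    have h1 : (2 : ℝ) / 2 ^ #P = 2 * 2 ^ #A.primeFactors / 2 ^ #M.primeFactors := by
      rw [hcard, pow_add]; field_simp
    calc A * (#(QR A) * ∏ p ∈ P, sqDens p)
        ≤ l ^ (0.1 : ℝ) * (l ^ (0.1 : ℝ) * (2 * (32 ^ 7 * l ^ (0.02 : ℝ)) / l ^ (0.62 : ℝ))) := by
          rw [h1] at hδ
          have h2 : 1 ≤ l ^ (0.0037 : ℝ) := Real.one_le_rpow (by linarith) (by norm_num)
          have h3 : l ^ (0.62 : ℝ) ≤ 2 ^ #M.primeFactors :=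
            (le_mul_of_one_le_right (by positivity) h2).trans hω
          have h4 : ∏ p ∈ P, sqDens p ≤ 2 * (32 ^ 7 * l ^ (0.02 : ℝ)) / l ^ (0.62 : ℝ) := by
            refine hδ.trans ?_
            gcongr
          gcongr
          exact hhA.trans hA
      _ = 2 ^ 36 * l ^ (-(0.4 : ℝ)) := by
          have h5 : l ^ (-(0.4 : ℝ)) = l ^ (0.1 : ℝ) * l ^ (0.1 : ℝ) * l ^ (0.02 : ℝ) / l ^ (0.62 : ℝ) := by
            rw [← Real.rpow_add hl0, ← Real.rpow_add hl0, ← Real.rpow_sub hl0]; norm_num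
          rw [h5]
          ring
  have hl4 : l ^ (-(0.4 : ℝ)) ≤ 1 / 2 ^ 40 := by
    rw [Real.rpow_neg hl0.le, ← one_div]
    gcongr
    calc (2 : ℝ) ^ 40 = ((2 : ℝ) ^ 100) ^ (0.4 : ℝ) := by
          rw [← Real.rpow_natCast, ← Real.rpow_natCast, ← Real.rpow_mul (by norm_num)]; norm_num
      _ ≤ l ^ (0.4 : ℝ) := by gcongr
  have hd : #(QR A) * ∏ p ∈ P, sqDens p ≤ 1 / 2 := by
    have h1 : (3 : ℝ) ≤ A := by exact_mod_cast hA3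
    have h2 : 0 ≤ #(QR A) * ∏ p ∈ P, sqDens p := mul_nonneg (Nat.cast_nonneg _) hδ0.le
    nlinarith
  have hinv : 5 / (L : ℝ) ≤ 10 * l ^ (-(0.4 : ℝ)) := by
    have h1 : 5 / (L : ℝ) ≤ 5 / (l / 2) := by gcongr; linarith
    have h2 : 5 / (l / 2) = 10 * l ^ (-(1 : ℝ)) := by rw [Real.rpow_neg_one]; field_simp; norm_num
    have h3 : l ^ (-(1 : ℝ)) ≤ l ^ (-(0.4 : ℝ)) :=
      Real.rpow_le_rpow_of_exponent_le (by linarith) (by norm_num)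
    linarith
  have hfin := abs_stoch_QR_sub_le P A L hA0 hAL hP hne hL hPL
    (by rw [hprod, ← hMA, hlM]; exact hlL.le) hd
  have hcardQ := card_QR_mul_prod A hA0 P fun p hp => ⟨(hP p hp).1, (hP p hp).2.1, (hP p hp).2.2.1⟩
  rw [hprod, ← hMA] at hfin hcardQ
  have hQ0 : (#(QR A) : ℝ) ≠ 0 := by
    have : 0 < #(QR A) := card_pos.2 ⟨0, (mem_QR_iff A hA0.ne' 0).2 ⟨0, by simp⟩⟩
    exact_mod_cast this.ne'
  have hmR : (m : ℝ) ≠ 0 := by exact_mod_cast hm0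
  have heq : 2 * (M : ℝ) ^ 2 / #(QR M) - M * A / #(QR A) =
      M * (A / #(QR A) * (2 / ∏ p ∈ P, sqDens p - 1)) := by
    have hδ' := hδ0.ne'
    have hMR : (M : ℝ) = A * m := by exact_mod_cast hMA
    rw [hcardQ, hMR]
    field_simp
  rw [heq]
  refine hfin.trans ?_
  have h40 : 5 / (L : ℝ) + 5 * A * (#(QR A) * ∏ p ∈ P, sqDens p) ≤ 2 ^ 40 * l ^ (-(0.4 : ℝ)) := by
    have : 0 ≤ l ^ (-(0.4 : ℝ)) := by positivity
    linarith
  calc _ ≤ (M : ℝ) * (2 ^ 40 * l ^ (-(0.4 : ℝ))) := by gcongr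
    _ = _ := by ring

end SquareGaps

/-- Theorem 1.5: there are absolute constants `C₀ > 2` and `C > 0` such that for every
sufficiently large `M ∈ Ω(C₀)`, writing `M = A·m` as in the definition of `Ω`,
`|S(R_M) - (2M²/|R_M| - M·A/|R_A|)| ≤ C·M·(log M)^(-0.4)`. -/
theorem stmt_4 :
    ∃ C₀ : ℝ, 2 < C₀ ∧ ∃ C : ℝ, 0 < C ∧ ∃ N : ℕ,
      ∀ M : ℕ, N ≤ M → inOmega C₀ M →
        ∀ A m : ℕ, M = A * m → 3 ≤ A → (A : ℝ) ≤ Real.log M ^ (0.1 : ℝ) →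
          (∀ p : ℕ, p.Prime → p ∣ m → Real.log M ^ C₀ < (p : ℝ)) →
          |(stoch M (QR M) : ℝ) -
              (2 * (M : ℝ) ^ 2 / ((QR M).card : ℝ) - (M : ℝ) * A / ((QR A).card : ℝ))| ≤
            C * M * Real.log M ^ (-(0.4 : ℝ)) := by
  refine ⟨1100, by norm_num, 2 ^ 40, by norm_num, ⌈Real.exp (2 ^ 100)⌉₊, ?_⟩
  intro M hM ⟨hsq, hω1, hω2, _⟩ A m hMA hA3 hA hm
  have hl : (2 : ℝ) ^ 100 ≤ Real.log M := by
    have h1 := Nat.ceil_le.1 hM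
    rwa [Real.le_log_iff_exp_le (lt_of_lt_of_le (Real.exp_pos _) h1)]
  exact SquareGaps.abs_stoch_sub_le_of_inOmega _ hl M rfl hsq hω1 hω2 A m hMA hA3 hA hm
end

section
/- For all integers M ≥ 2 and 2 ≤ k ≤ M, the average s(k) of the stochasticity parameter over all k-element subsets of Z_M satisfies s(k) = M·(2M − k + 1)/(k + 1). -/
open Finset

/-- The "universe" finset of `ZMod M` (all residues), valid for any `M ≥ 1`. -/
def univM (M : ℕ) : Finset (ZMod M) := (Finset.range M).image (fun a : ℕ => (a : ZMod M))

/-- `s(k) = s(k, Z_M)`: the average of `S(U)` over all subsets `U ⊆ Z_M` of size `k`. -/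
noncomputable def savg (M k : ℕ) : ℚ :=
  (∑ U ∈ (univM M).powersetCard k, (stoch M U : ℚ)) / (Nat.choose M k : ℚ)

/-- The number of `(k + 1)`-subsets of a finite type that contain `u` and avoid a set `A ∌ u`. -/
lemma card_powersetCard_mem_disjoint {α : Type*} [Fintype α] [DecidableEq α] (k : ℕ) (u : α)
    (A : Finset α) (hu : u ∉ A) :
    #{U ∈ (univ : Finset α).powersetCard (k + 1) | u ∈ U ∧ Disjoint U A} =
      (Fintype.card α - 1 - #A).choose k := by
  have hcard : #(insert u A)ᶜ = Fintype.card α - 1 - #A := by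
    rw [card_compl, card_insert_of_notMem hu]
    omega
  rw [← hcard, ← card_powersetCard]
  refine card_nbij' (fun U => U.erase u) (fun V => insert u V) ?_ ?_ ?_ ?_
  · intro U hU
    simp only [coe_filter, Set.mem_ofPred_eq, mem_powersetCard, subset_univ, true_and] at hU
    obtain ⟨hc, huU, hd⟩ := hU
    simp only [mem_coe, mem_powersetCard, card_erase_of_mem huU, hc, Nat.add_sub_cancel, and_true]
    intro x hx
    have hxA : x ∉ A := Finset.disjoint_left.mp hd (mem_of_mem_erase hx)
    simp [ne_of_mem_erase hx, hxA]
  · intro V hV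
    simp only [mem_coe, mem_powersetCard] at hV
    obtain ⟨hs, hc⟩ := hV
    have huV : u ∉ V := fun h => by simpa using hs h
    simp only [coe_filter, Set.mem_ofPred_eq, mem_powersetCard, subset_univ, true_and,
      card_insert_of_notMem huV, hc, mem_insert_self, disjoint_insert_left, hu,
      not_false_eq_true]
    refine Finset.disjoint_left.mpr fun x hx hxA => ?_
    have := hs hx
    simp [hxA] at this
  · intro U hU
    simp only [coe_filter, Set.mem_ofPred_eq] at hU
    exact insert_erase hU.2.1
  · intro V hV
    simp only [mem_coe, mem_powersetCard] at hV
    exact erase_insert fun h => by simpa using hV.1 h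

lemma sum_range_choose_sub (M k : ℕ) :
    ∑ d ∈ range M, (M - 1 - d).choose k = M.choose (k + 1) := by
  induction M with
  | zero => simp
  | succ M ih =>
    rw [sum_range_succ', Nat.choose_succ_succ, ← ih, add_comm]
    congr 1
    refine sum_congr rfl fun d _ => ?_
    congr 1
    omega

lemma sum_range_odd_mul_choose_sub (M k : ℕ) :
    ∑ d ∈ range M, (2 * d + 1) * (M - 1 - d).choose k =
      M.choose (k + 1) + 2 * M.choose (k + 2) := by
  induction M with
  | zero => simp
  | succ M ih =>
    have h : ∑ d ∈ range M, (2 * (d + 1) + 1) * (M + 1 - 1 - (d + 1)).choose k =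
        ∑ d ∈ range M, (2 * d + 1) * (M - 1 - d).choose k +
          2 * ∑ d ∈ range M, (M - 1 - d).choose k := by
      rw [mul_sum, ← sum_add_distrib]
      refine sum_congr rfl fun d _ => ?_
      rw [show M + 1 - 1 - (d + 1) = M - 1 - d by omega]
      ring
    rw [sum_range_succ', h, ih, sum_range_choose_sub, Nat.choose_succ_succ M k,
      Nat.choose_succ_succ M (k + 1)]
    simp only [Nat.add_sub_cancel, Nat.sub_zero]
    ring

lemma sum_range_odd (g : ℕ) : ∑ d ∈ range g, (2 * d + 1) = g ^ 2 := by
  induction g with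
  | zero => simp
  | succ g ih => rw [sum_range_succ, ih]; ring

lemma univM_eq_univ (M : ℕ) [NeZero M] : univM M = univ := by
  refine eq_univ_of_forall fun x => mem_image.mpr ⟨x.val, ?_, ZMod.natCast_zmod_val x⟩
  exact mem_range.mpr (ZMod.val_lt x)

/-- The `d` residues following `u`. -/
def nextResidues (M : ℕ) (u : ZMod M) (d : ℕ) : Finset (ZMod M) :=
  (Icc 1 d).image fun i : ℕ => u + (i : ZMod M)

lemma card_nextResidues {M d : ℕ} (u : ZMod M) (hd : d < M) : #(nextResidues M u d) = d := by
  rw [nextResidues, card_image_of_injOn, Nat.card_Icc, Nat.add_sub_cancel]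
  intro i hi j hj hij
  simp only [coe_Icc, Set.mem_Icc] at hi hj
  have h : (i : ZMod M) = j := add_left_cancel hij
  rw [ZMod.natCast_eq_natCast_iff'] at h
  rwa [Nat.mod_eq_of_lt (by omega), Nat.mod_eq_of_lt (by omega)] at h

lemma notMem_nextResidues {M d : ℕ} (u : ZMod M) (hd : d < M) : u ∉ nextResidues M u d := by
  intro h
  obtain ⟨i, hi, hiu⟩ := mem_image.mp h
  rw [mem_Icc] at hi
  have h0 : (i : ZMod M) = 0 := by simpa using hiu
  rw [ZMod.natCast_eq_zero_iff] at h0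
  have := Nat.le_of_dvd (by omega) h0
  omega

lemma cycGap_mem {M : ℕ} [NeZero M] {U : Finset (ZMod M)} {u : ZMod M} (hu : u ∈ U) :
    M ∈ {k : ℕ | 0 < k ∧ u + (k : ZMod M) ∈ U} :=
  ⟨NeZero.pos M, by simpa using hu⟩

lemma lt_cycGap_iff {M : ℕ} [NeZero M] {U : Finset (ZMod M)} {u : ZMod M} (hu : u ∈ U) (d : ℕ) :
    d < cycGap M U u ↔ Disjoint U (nextResidues M u d) := by
  constructor
  · intro h
    refine Finset.disjoint_right.mpr fun x hx hxU => ?_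
    obtain ⟨i, hi, rfl⟩ := mem_image.mp hx
    rw [mem_Icc] at hi
    have : cycGap M U u ≤ i := Nat.sInf_le ⟨hi.1, hxU⟩
    omega
  · intro h
    by_contra hlt
    have hm : 0 < cycGap M U u ∧ u + (cycGap M U u : ZMod M) ∈ U := Nat.sInf_mem ⟨M, cycGap_mem hu⟩
    exact Finset.disjoint_left.mp h hm.2
      (mem_image.mpr ⟨_, mem_Icc.mpr ⟨hm.1, not_lt.mp hlt⟩, rfl⟩)

lemma cycGap_sq {M : ℕ} [NeZero M] {U : Finset (ZMod M)} {u : ZMod M} (hu : u ∈ U) :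
    cycGap M U u ^ 2 =
      ∑ d ∈ range M, if Disjoint U (nextResidues M u d) then 2 * d + 1 else 0 := by
  have hle : cycGap M U u ≤ M := Nat.sInf_le (cycGap_mem hu)
  rw [← sum_range_odd, ← sum_filter]
  refine sum_congr ?_ fun _ _ => rfl
  ext d
  rw [mem_filter, mem_range, mem_range, ← lt_cycGap_iff hu]
  omega

lemma sum_stoch (M k : ℕ) [NeZero M] :
    ∑ U ∈ (univM M).powersetCard (k + 1), stoch M U =
      M * (M.choose (k + 1) + 2 * M.choose (k + 2)) := by
  have h (U : Finset (ZMod M)) : stoch M U = ∑ u : ZMod M, ∑ d ∈ range M,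
      if u ∈ U ∧ Disjoint U (nextResidues M u d) then 2 * d + 1 else 0 := by
    rw [stoch, ← sum_subset (subset_univ U)]
    · refine sum_congr rfl fun u hu => ?_
      simp [cycGap_sq hu, hu]
    · intro u _ hu
      simp [hu]
  simp_rw [h]
  rw [univM_eq_univ, sum_comm]
  have hu (u : ZMod M) : ∑ U ∈ (univ : Finset (ZMod M)).powersetCard (k + 1), ∑ d ∈ range M,
      (if u ∈ U ∧ Disjoint U (nextResidues M u d) then 2 * d + 1 else 0) =
        M.choose (k + 1) + 2 * M.choose (k + 2) := by
    rw [sum_comm, ← sum_range_odd_mul_choose_sub]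
    refine sum_congr rfl fun d hd => ?_
    have hdM := mem_range.mp hd
    rw [← sum_filter, sum_const, smul_eq_mul, mul_comm,
      card_powersetCard_mem_disjoint k u _ (notMem_nextResidues u hdM),
      card_nextResidues u hdM, ZMod.card]
  simp only [hu, sum_const, card_univ, ZMod.card, smul_eq_mul]

/-- For all integers M ≥ 2 and 2 ≤ k ≤ M, the average of the stochasticity parameter over
all k-element subsets of Z_M equals M(2M - k + 1)/(k + 1). -/
theorem stmt_6 (M k : ℕ) (hM : 2 ≤ M) (hk : 2 ≤ k) (hkM : k ≤ M) :
    savg M k = (M : ℚ) * (2 * M - k + 1) / (k + 1) := by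
  have : NeZero M := ⟨by omega⟩
  obtain ⟨j, rfl⟩ : ∃ j, k = j + 1 := ⟨k - 1, by omega⟩
  have hpos : (M.choose (j + 1) : ℚ) ≠ 0 := by exact_mod_cast (Nat.choose_pos hkM).ne'
  have hrec : (M.choose (j + 2) : ℚ) * (j + 2) = M.choose (j + 1) * (M - (j + 1)) := by
    have h := Nat.choose_succ_right_eq M (j + 1)
    rw [← Nat.cast_inj (R := ℚ)] at h
    push_cast [Nat.cast_sub hkM] at h
    linear_combination h
  have hj : (j : ℚ) + 1 + 1 ≠ 0 := by positivity
  rw [savg, ← Nat.cast_sum, sum_stoch]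
  push_cast
  rw [div_eq_div_iff hpos hj]
  linear_combination 2 * (M : ℚ) * hrec
end
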